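/- Let K be a global function field of characteristic p containing a primitive q-th root of unity, where q ≠ p is prime. Let a, b ∈ K^× and let 𝔭_K be a prime of K such that: (1) ord_{𝔭_K} b < 0 and ord_{𝔭_K} b ≢ 0 mod q; (2) a is a unit at 𝔭_K and the residue of a is not a q-th power in the residue field of 𝔭_K; (3) a ≡ 1 modulo every prime 𝔟_K ≠ 𝔭_K with ord_{𝔟_K} b ≠ 0. Given x ∈ K^×, set L_1 = K((1+(bx^q+b^q)^{-1})^{1/q}) and L_2 = L_1((1+(a+a^{-1})b^{-1})^{1/q}) (under the hypotheses all elements inverted here are nonzero). Then there exists y ∈ L_2(a^{1/q}) with N_{L_2(a^{1/q})/L_2}(y) = b x^q + b^q if and only if ord_{𝔭_K} x > ((q−1)/q)·ord_{𝔭_K} b. -/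

import Mathlib

noncomputable section

/-- A normalized (surjective onto `ℤ`) discrete valuation on a field `K`, i.e. a
"prime" of a global function field. -/
structure FFPrime (K : Type) [Field K] where
  ord : K → WithTop ℤ
  ord_zero : ord 0 = ⊤
  ord_ne_top : ∀ x : K, x ≠ 0 → ord x ≠ ⊤
  ord_one : ord 1 = 0
  ord_mul : ∀ x y : K, ord (x * y) = ord x + ord y
  ord_add : ∀ x y : K, min (ord x) (ord y) ≤ ord (x + y)
  ord_surj : ∀ n : ℤ, ∃ x : K, ord x = (n : WithTop ℤ)

namespace FFPrime

variable {K L : Type} [Field K] [Field L]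

/-- `w` lies over `v` along `φ`, with ramification index `e`. -/
def LiesOverWith (w : FFPrime L) (v : FFPrime K) (φ : K →+* L) (e : ℕ) : Prop :=
  0 < e ∧ ∀ x : K, w.ord (φ x) = ((e : ℤ) : WithTop ℤ) * v.ord x

/-- `w` lies over `v` along `φ`. -/
def LiesOver (w : FFPrime L) (v : FFPrime K) (φ : K →+* L) : Prop :=
  ∃ e : ℕ, w.LiesOverWith v φ e

open Classical in
/-- The ramification index `e(w/v)`. -/
noncomputable def ramIdx (w : FFPrime L) (v : FFPrime K) (φ : K →+* L) : ℕ :=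
  if h : ∃ e : ℕ, w.LiesOverWith v φ e then h.choose else 0

/-- The residue field of `v` has exactly `n` elements. -/
def HasResidueCard (v : FFPrime K) (n : ℕ) : Prop :=
  ∃ s : Finset K, s.card = n ∧ (∀ x ∈ s, 0 ≤ v.ord x) ∧
    (∀ x ∈ s, ∀ y ∈ s, x ≠ y → ¬ 0 < v.ord (x - y)) ∧
    (∀ z : K, 0 ≤ v.ord z → ∃ x ∈ s, 0 < v.ord (z - x))

open Classical in
/-- The residue (relative) degree `f(w/v)`: the unique `f ≥ 1` with
`#κ_w = (#κ_v) ^ f` (residue fields of global function fields are finite). -/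
noncomputable def resDeg (w : FFPrime L) (v : FFPrime K) : ℕ :=
  if h : ∃ f : ℕ, 0 < f ∧ ∃ m n : ℕ, 1 < m ∧ v.HasResidueCard m ∧
      w.HasResidueCard n ∧ n = m ^ f then h.choose else 0

/-- `v` splits completely in the extension given by `φ`: every prime above it has
ramification index and residue degree `1`. -/
def SplitsCompletely (v : FFPrime K) (φ : K →+* L) : Prop :=
  ∀ w : FFPrime L, w.LiesOver v φ → w.ramIdx v φ = 1 ∧ w.resDeg v = 1

/-- `v` is inert in the finite extension `M/K`: there is a unique prime above it, with
ramification index `1` and residue degree `[M : K]`. -/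
def IsInert (v : FFPrime K) (M : Type) [Field M] [Algebra K M] : Prop :=
  (∃! w : FFPrime M, w.LiesOver v (algebraMap K M)) ∧
    ∀ w : FFPrime M, w.LiesOver v (algebraMap K M) →
      w.ramIdx v (algebraMap K M) = 1 ∧ w.resDeg v = Module.finrank K M

/-- `v` ramifies in the extension given by `φ`: some prime above it has ramification
index `> 1`. -/
def Ramifies (v : FFPrime K) (φ : K →+* L) : Prop :=
  ∃ w : FFPrime L, w.LiesOver v φ ∧ 2 ≤ w.ramIdx v φ

/-- `ord_v z ≡ 0 mod q`. -/
def OrdDvd (v : FFPrime K) (q : ℕ) (z : K) : Prop :=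
  ∃ n : ℤ, v.ord z = (((q : ℤ) * n : ℤ) : WithTop ℤ)

end FFPrime

/-- A nontrivial (rank one) valuation on a possibly infinite algebraic extension of a
global function field, with values in `ℚ ∪ {∞}`. -/
structure FFVal (B : Type) [Field B] where
  ord : B → WithTop ℚ
  ord_zero : ord 0 = ⊤
  ord_ne_top : ∀ x : B, x ≠ 0 → ord x ≠ ⊤
  ord_one : ord 1 = 0
  ord_mul : ∀ x y : B, ord (x * y) = ord x + ord y
  ord_add : ∀ x y : B, min (ord x) (ord y) ≤ ord (x + y)
  nontrivial : ∃ x : B, ord x ≠ 0 ∧ ord x ≠ ⊤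

/-- The valuation `V` of the big field restricts, up to a normalization factor `c`, to
the (normalized discrete) prime `v` of `K` along `φ`; i.e. `v` is the prime of `K`
lying below `V`. -/
def FFVal.RestrictsTo {K B : Type} [Field K] [Field B] (V : FFVal B) (v : FFPrime K)
    (φ : K →+* B) : Prop :=
  ∃ c : ℚ, 0 < c ∧
    ∀ x : K, V.ord (φ x) = ((c : ℚ) : WithTop ℚ) * WithTop.map (fun n : ℤ => (n : ℚ)) (v.ord x)

/-- The algebraic extension `B` of the rational function field `F0 = 𝔽_p(t)` is
`q`-bounded: for every valuation of `B`, the `q`-adic valuations of the ramification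
indices and residue degrees along every finite subextension are bounded. -/
def IsQBounded (q : ℕ) (F0 B : Type) [Field F0] [Field B] [Algebra F0 B] : Prop :=
  ∀ V : FFVal B, ∃ C : ℕ,
    ∀ L : IntermediateField F0 B, FiniteDimensional F0 L →
      ∀ v0 : FFPrime F0, ∀ vL : FFPrime L,
        V.RestrictsTo v0 (algebraMap F0 B) →
        V.RestrictsTo vL L.val.toRingHom →
        padicValNat q (vL.ramIdx v0 (algebraMap F0 L)) ≤ C ∧
        padicValNat q (vL.resDeg v0) ≤ C

/-- The prime `v` of `K` has uniformly `q`-bounded ramification in `B`. -/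
def UnifQBoundedRam (q : ℕ) {K : Type} [Field K] (B : Type) [Field B] [Algebra K B]
    (v : FFPrime K) : Prop :=
  ∃ C : ℕ, ∀ F : IntermediateField K B, FiniteDimensional K F →
    ∀ w : FFPrime F, w.LiesOver v (algebraMap K F) →
      padicValNat q (w.ramIdx v (algebraMap K F)) ≤ C

/-- The prime `v` of `K` has uniformly absolutely bounded ramification in `B`. -/
def UnifAbsBoundedRam {K : Type} [Field K] (B : Type) [Field B] [Algebra K B]
    (v : FFPrime K) : Prop :=
  ∃ C : ℕ, ∀ F : IntermediateField K B, FiniteDimensional K F →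
    ∀ w : FFPrime F, w.LiesOver v (algebraMap K F) →
      w.ramIdx v (algebraMap K F) ≤ C

/-- The prime `v` of `K` has uniformly `q`-bounded relative (residue) degree in `B`. -/
def UnifQBoundedRes (q : ℕ) {K : Type} [Field K] (B : Type) [Field B] [Algebra K B]
    (v : FFPrime K) : Prop :=
  ∃ C : ℕ, ∀ F : IntermediateField K B, FiniteDimensional K F →
    ∀ w : FFPrime F, w.LiesOver v (algebraMap K F) →
      padicValNat q (w.resDeg v) ≤ C

/-- The prime `v` of `K` is uniformly `q`-bounded in `B`. -/
def UniformlyQBoundedAt (q : ℕ) {K : Type} [Field K] (B : Type) [Field B] [Algebra K B]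
    (v : FFPrime K) : Prop :=
  UnifQBoundedRam q B v ∧ UnifQBoundedRes q B v

/-- The integral closure in `B` of the valuation ring `O_v = {x ∈ K : ord_v x ≥ 0}`. -/
def valIntegralClosure {K : Type} [Field K] (v : FFPrime K) (B : Type) [Field B]
    [Algebra K B] : Set B :=
  {x : B | ∃ P : Polynomial K, P.Monic ∧ (∀ n : ℕ, 0 ≤ v.ord (P.coeff n)) ∧
    Polynomial.aeval x P = 0}

/-- The integral closure in `B` of the ring `O_{K,S}` of `S`-integers of `K`. -/
def sIntegralClosure {K : Type} [Field K] (S : Set (FFPrime K)) (B : Type) [Field B]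
    [Algebra K B] : Set B :=
  {x : B | ∃ P : Polynomial K, P.Monic ∧
    (∀ n : ℕ, ∀ v : FFPrime K, v ∉ S → 0 ≤ v.ord (P.coeff n)) ∧
    Polynomial.aeval x P = 0}

/-- Elements of `B` that are units at every prime of `B` lying over a prime of `S`. -/
def unitsAtS {K : Type} [Field K] (S : Set (FFPrime K)) (B : Type) [Field B]
    [Algebra K B] : Set B :=
  {x : B | ∀ V : FFVal B, (∃ v ∈ S, V.RestrictsTo v (algebraMap K B)) → V.ord x = 0}

/-- Elements `x` of `B` with `ord (x - 1) > 0` at every prime of `B` lying over a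
prime of `S`. -/
def onesAtS {K : Type} [Field K] (S : Set (FFPrime K)) (B : Type) [Field B]
    [Algebra K B] : Set B :=
  {x : B | ∀ V : FFVal B, (∃ v ∈ S, V.RestrictsTo v (algebraMap K B)) → 0 < V.ord (x - 1)}

/-- A subset of a commutative ring is first-order definable in the language of rings
`{0, 1, +, ·}` with parameters from the ring. -/
def FODefinable {R : Type} [CommRing R] (X : Set R) : Prop :=
  letI : FirstOrder.Ring.CompatibleRing R := FirstOrder.Ring.compatibleRingOfRing R
  Set.Definable₁ (Set.univ : Set R) FirstOrder.Language.ring X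

/-- A subset of a commutative ring is existentially (diophantine) definable: it is cut
out by a block of existential quantifiers followed by a system of polynomial equations,
with parameters (coefficients) from the ring. -/
def ExistDefinable {R : Type} [CommRing R] (X : Set R) : Prop :=
  ∃ (k m : ℕ) (P : Fin m → MvPolynomial (Fin (k + 1)) R),
    ∀ x : R, x ∈ X ↔ ∃ y : Fin k → R, ∀ i : Fin m,
      MvPolynomial.eval (Fin.cons x y) (P i) = 0

/-- Solvability of the norm equation `N(y) = b·x^q + b^q` over (every realization of)
the tower `L₂(a^{1/q})/L₂`, where `L₁ = F((1+(b x^q+b^q)⁻¹)^{1/q})` and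
`L₂ = L₁((1+(a+a⁻¹)b⁻¹)^{1/q})`. -/
def NormTower2Solvable (q : ℕ) (F : Type) [Field F] (a b x : F) : Prop :=
  ∀ (M1 : Type) [Field M1] [Algebra F M1] (α1 : M1),
    α1 ^ q = algebraMap F M1 (1 + (b * x ^ q + b ^ q)⁻¹) →
    IntermediateField.adjoin F {α1} = ⊤ →
    ∀ (M2 : Type) [Field M2] [Algebra M1 M2] (α2 : M2),
      α2 ^ q = algebraMap M1 M2 (algebraMap F M1 (1 + (a + a⁻¹) * b⁻¹)) →
      IntermediateField.adjoin M1 {α2} = ⊤ →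
      ∀ (M3 : Type) [Field M3] [Algebra M2 M3] (α3 : M3),
        α3 ^ q = algebraMap M2 M3 (algebraMap M1 M2 (algebraMap F M1 a)) →
        IntermediateField.adjoin M2 {α3} = ⊤ →
        ∃ y : M3, Algebra.norm M2 y = algebraMap M1 M2 (algebraMap F M1 (b * x ^ q + b ^ q))

/-- Solvability of the norm equation `N(y) = b·x^q + b^q` over (every realization of)
the tower `L₄(a^{1/q})/L₄`, where `L₁ = F((1+(b x^q+b^q)⁻¹)^{1/q})`,
`L₃ = L₁((1+x⁻¹)^{1/q})` and `L₄ = L₃((1+(a+a⁻¹)x⁻¹)^{1/q})`. -/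
def NormTower4Solvable (q : ℕ) (F : Type) [Field F] (a b x : F) : Prop :=
  ∀ (M1 : Type) [Field M1] [Algebra F M1] (α1 : M1),
    α1 ^ q = algebraMap F M1 (1 + (b * x ^ q + b ^ q)⁻¹) →
    IntermediateField.adjoin F {α1} = ⊤ →
    ∀ (M3 : Type) [Field M3] [Algebra M1 M3] (α3 : M3),
      α3 ^ q = algebraMap M1 M3 (algebraMap F M1 (1 + x⁻¹)) →
      IntermediateField.adjoin M1 {α3} = ⊤ →
      ∀ (M4 : Type) [Field M4] [Algebra M3 M4] (α4 : M4),
        α4 ^ q = algebraMap M3 M4 (algebraMap M1 M3 (algebraMap F M1 (1 + (a + a⁻¹) * x⁻¹))) →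
        IntermediateField.adjoin M3 {α4} = ⊤ →
        ∀ (M5 : Type) [Field M5] [Algebra M4 M5] (α5 : M5),
          α5 ^ q = algebraMap M4 M5 (algebraMap M3 M4 (algebraMap M1 M3 (algebraMap F M1 a))) →
          IntermediateField.adjoin M4 {α5} = ⊤ →
          ∃ y : M5, Algebra.norm M4 y =
            algebraMap M3 M4 (algebraMap M1 M3 (algebraMap F M1 (b * x ^ q + b ^ q)))

/-- Unsolvability of the norm equation `N(y) = b·x^q + b^q` over (every realization of)
the tower `L₄(a^{1/q})/L₄` as in `NormTower4Solvable`. -/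
def NormTower4Unsolvable (q : ℕ) (F : Type) [Field F] (a b x : F) : Prop :=
  ∀ (M1 : Type) [Field M1] [Algebra F M1] (α1 : M1),
    α1 ^ q = algebraMap F M1 (1 + (b * x ^ q + b ^ q)⁻¹) →
    IntermediateField.adjoin F {α1} = ⊤ →
    ∀ (M3 : Type) [Field M3] [Algebra M1 M3] (α3 : M3),
      α3 ^ q = algebraMap M1 M3 (algebraMap F M1 (1 + x⁻¹)) →
      IntermediateField.adjoin M1 {α3} = ⊤ →
      ∀ (M4 : Type) [Field M4] [Algebra M3 M4] (α4 : M4),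
        α4 ^ q = algebraMap M3 M4 (algebraMap M1 M3 (algebraMap F M1 (1 + (a + a⁻¹) * x⁻¹))) →
        IntermediateField.adjoin M3 {α4} = ⊤ →
        ∀ (M5 : Type) [Field M5] [Algebra M4 M5] (α5 : M5),
          α5 ^ q = algebraMap M4 M5 (algebraMap M3 M4 (algebraMap M1 M3 (algebraMap F M1 a))) →
          IntermediateField.adjoin M4 {α5} = ⊤ →
          ¬ ∃ y : M5, Algebra.norm M4 y =
            algebraMap M3 M4 (algebraMap M1 M3 (algebraMap F M1 (b * x ^ q + b ^ q)))



namespace FFPrime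
variable {K : Type} [Field K] (v : FFPrime K)

/-- integer-valued order (junk value `0` at `0`) -/
def o (x : K) : ℤ := (v.ord x).untopD 0

lemma ord_eq {x : K} (hx : x ≠ 0) : v.ord x = (v.o x : WithTop ℤ) := by
  unfold o
  obtain ⟨n, hn⟩ := WithTop.ne_top_iff_exists.mp (v.ord_ne_top x hx)
  rw [← hn]; rfl

lemma o_of_ord {x : K} {n : ℤ} (h : v.ord x = (n : WithTop ℤ)) : v.o x = n := by
  unfold o; rw [h]; rfl

lemma o_mul {x y : K} (hx : x ≠ 0) (hy : y ≠ 0) : v.o (x * y) = v.o x + v.o y := by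
  apply o_of_ord
  rw [v.ord_mul, v.ord_eq hx, v.ord_eq hy]; rfl

@[simp] lemma o_one : v.o 1 = 0 := by
  apply o_of_ord; rw [v.ord_one]; rfl

lemma o_inv (x : K) : v.o x⁻¹ = - v.o x := by
  by_cases hx : x = 0
  · subst hx; simp [o, v.ord_zero]
  have := v.o_mul hx (inv_ne_zero hx)
  rw [mul_inv_cancel₀ hx, o_one] at this
  omega

lemma o_div {x y : K} (hx : x ≠ 0) (hy : y ≠ 0) : v.o (x / y) = v.o x - v.o y := by
  rw [div_eq_mul_inv, v.o_mul hx (inv_ne_zero hy), o_inv]; ring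

lemma o_pow {x : K} (hx : x ≠ 0) (n : ℕ) : v.o (x ^ n) = n * v.o x := by
  induction n with
  | zero => simp
  | succ k ih => rw [pow_succ, v.o_mul (pow_ne_zero _ hx) hx, ih]; push_cast; ring

lemma o_zpow {x : K} (hx : x ≠ 0) (n : ℤ) : v.o (x ^ n) = n * v.o x := by
  cases n with
  | ofNat n => simpa using v.o_pow hx n
  | negSucc n =>
    rw [zpow_negSucc, o_inv, v.o_pow hx]; push_cast [Int.negSucc_eq]; ring

@[simp] lemma o_neg_one : v.o (-1) = 0 := by
  have := v.o_mul (x := -1) (y := -1) (by simp) (by simp)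
  simp at this; omega

lemma o_neg (x : K) : v.o (-x) = v.o x := by
  by_cases hx : x = 0
  · simp [hx]
  rw [← neg_one_mul, v.o_mul (by simp) hx]; simp

lemma ord_nonneg_iff {x : K} : 0 ≤ v.ord x ↔ x = 0 ∨ 0 ≤ v.o x := by
  by_cases hx : x = 0
  · simp [hx, v.ord_zero]
  · rw [v.ord_eq hx]; simp [hx]

lemma ord_pos_iff {x : K} : 0 < v.ord x ↔ x = 0 ∨ 0 < v.o x := by
  by_cases hx : x = 0
  · simp [hx, v.ord_zero]
  · rw [v.ord_eq hx]; simp [hx]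

lemma o_add {x y : K} (hx : x ≠ 0) (hy : y ≠ 0) (h : x + y ≠ 0) :
    min (v.o x) (v.o y) ≤ v.o (x + y) := by
  have := v.ord_add x y
  rw [v.ord_eq hx, v.ord_eq hy, v.ord_eq h] at this
  exact_mod_cast this

lemma o_add_eq {x y : K} (hx : x ≠ 0) (h : y = 0 ∨ v.o x < v.o y) :
    x + y ≠ 0 ∧ v.o (x + y) = v.o x := by
  rcases h with rfl | h
  · simpa using hx
  by_cases hy : y = 0
  · subst hy; simpa using hx
  have hne : x + y ≠ 0 := by
    intro h0
    have : y = -x := by linear_combination h0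
    rw [this, o_neg] at h; exact lt_irrefl _ h
  refine ⟨hne, le_antisymm ?_ ?_⟩
  · by_contra hlt
    push Not at hlt
    have := v.o_add hne (neg_ne_zero.mpr hy) (by simpa using hx)
    rw [o_neg, add_neg_cancel_right] at this
    rcases min_le_iff.mp this with h1 | h1 <;> omega
  · have := v.o_add hx hy hne
    rwa [min_eq_left h.le] at this

lemma ord_neg (x : K) : v.ord (-x) = v.ord x := by
  by_cases hx : x = 0
  · simp [hx]
  · rw [v.ord_eq hx, v.ord_eq (neg_ne_zero.mpr hx), o_neg]

lemma ord_sub_nonneg {x y : K} (hx : 0 ≤ v.ord x) (hy : 0 ≤ v.ord y) : 0 ≤ v.ord (x - y) := by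
  rw [sub_eq_add_neg]
  refine le_trans (le_min hx ?_) (v.ord_add _ _)
  rwa [ord_neg]

lemma ord_add_pos {x y : K} (hx : 0 < v.ord x) (hy : 0 < v.ord y) : 0 < v.ord (x + y) :=
  lt_of_lt_of_le (lt_min hx hy) (v.ord_add _ _)

lemma ord_sub_pos {x y : K} (hx : 0 < v.ord x) (hy : 0 < v.ord y) : 0 < v.ord (x - y) := by
  rw [sub_eq_add_neg]
  exact v.ord_add_pos hx (by rwa [ord_neg])

/-- the valuation ring -/
def vring : ValuationSubring K where
  carrier := {x | 0 ≤ v.ord x}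
  mul_mem' := fun {x y} hx hy => by
    simp only [Set.mem_ofPred_eq] at *
    rw [v.ord_mul]; exact add_nonneg hx hy
  one_mem' := by simp [v.ord_one]
  add_mem' := fun {x y} hx hy => le_trans (le_min hx hy) (v.ord_add x y)
  zero_mem' := by simp [v.ord_zero]
  neg_mem' := fun {x} hx => by
    simp only [Set.mem_ofPred_eq] at *
    rwa [v.ord_neg]
  mem_or_inv_mem' := fun x => by
    simp only [Set.mem_ofPred_eq, ord_nonneg_iff, o_inv]
    omega

lemma mem_vring {x : K} : x ∈ v.vring ↔ 0 ≤ v.ord x := Iff.rfl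

lemma mem_vring' {x : K} : x ∈ v.vring ↔ x = 0 ∨ 0 ≤ v.o x := v.ord_nonneg_iff

lemma exists_unif : ∃ π : K, π ≠ 0 ∧ v.o π = 1 := by
  obtain ⟨π, h⟩ := v.ord_surj 1
  refine ⟨π, ?_, v.o_of_ord h⟩
  rintro rfl
  rw [v.ord_zero] at h
  exact absurd h (by simp)

lemma vring_ne_top : v.vring ≠ ⊤ := by
  obtain ⟨π, h0, h1⟩ := v.exists_unif
  intro h
  have : π⁻¹ ∈ v.vring := by rw [h]; trivial
  rw [mem_vring', o_inv, h1] at this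
  simp [h0] at this

lemma ext_vring {v w : FFPrime K} (h : v.vring = w.vring) : v = w := by
  have key : ∀ x : K, x ≠ 0 → (0 ≤ v.o x ↔ 0 ≤ w.o x) := fun x hx => by
    have : x ∈ v.vring ↔ x ∈ w.vring := by rw [h]
    simpa [mem_vring', hx] using this
  have key2 : ∀ x : K, x ≠ 0 → (v.o x ≤ 0 ↔ w.o x ≤ 0) := fun x hx => by
    have := key x⁻¹ (inv_ne_zero hx)
    simpa [o_inv] using this
  obtain ⟨π, h0, h1⟩ := v.exists_unif
  have hwpos : 1 ≤ w.o π := by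
    have := key2 π h0
    omega
  have hm : ∀ x : K, x ≠ 0 → w.o x = v.o x * w.o π := by
    intro x hx
    have hz : x * π ^ (-(v.o x)) ≠ 0 := mul_ne_zero hx (zpow_ne_zero _ h0)
    have e : v.o (x * π ^ (-(v.o x))) = 0 := by
      rw [v.o_mul hx (zpow_ne_zero _ h0), v.o_zpow h0, h1]; ring
    have e' : w.o (x * π ^ (-(v.o x))) = 0 := by
      have := key _ hz; have := key2 _ hz; omega
    rw [w.o_mul hx (zpow_ne_zero _ h0), w.o_zpow h0] at e'
    linarith
  obtain ⟨ρ, g0, g1⟩ := w.exists_unif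
  have : w.o π = 1 := by
    have := hm ρ g0
    rw [g1] at this
    exact Int.eq_one_of_dvd_one (by omega) ⟨v.o ρ, by linarith⟩
  have : v.ord = w.ord := by
    funext x
    by_cases hx : x = 0
    · rw [hx, v.ord_zero, w.ord_zero]
    · rw [v.ord_eq hx, w.ord_eq hx, hm x hx, this, mul_one]
  cases v; cases w; simp only at this; subst this; rfl

section ofV
variable (V : ValuationSubring K) (π : K) (h0 : π ≠ 0) (h1 : π ∈ V) (h2 : π⁻¹ ∉ V)
  (H : ∀ z : K, z ≠ 0 → ∃ n : ℤ, z * π ^ (-n) ∈ V ∧ (z * π ^ (-n))⁻¹ ∈ V)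

include h0 h1 h2 in
lemma ofV_aux {n : ℤ} : π ^ n ∈ V ↔ 0 ≤ n := by
  constructor
  · intro h
    by_contra hn
    push Not at hn
    obtain ⟨k, rfl⟩ : ∃ k : ℕ, n = -(k + 1 : ℕ) := ⟨(-n - 1).toNat, by push_cast; omega⟩
    apply h2
    have : π⁻¹ = π ^ (-((k + 1 : ℕ) : ℤ)) * π ^ k := by
      rw [zpow_neg, zpow_natCast, pow_succ]; field_simp
    rw [this]
    exact V.mul_mem _ _ h (pow_mem h1 k)
  · intro h
    lift n to ℕ using h
    simpa using pow_mem h1 n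

/-- discrete valuation from a valuation ring with uniformizer -/
def ofV : FFPrime K := by
  classical
  have hn : ∀ z (hz : z ≠ 0) (m : ℤ), z * π ^ (-m) ∈ V ↔ m ≤ (H z hz).choose := by
    intro z hz m
    have hs := (H z hz).choose_spec
    set n := (H z hz).choose
    have e : z * π ^ (-m) = (z * π ^ (-n)) * π ^ (n - m) := by
      rw [mul_assoc, ← zpow_add₀ h0]; congr 2; ring
    have e' : π ^ (n - m) = (z * π ^ (-n))⁻¹ * (z * π ^ (-m)) := by
      rw [e, ← mul_assoc, inv_mul_cancel₀, one_mul]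
      exact mul_ne_zero hz (zpow_ne_zero _ h0)
    rw [← sub_nonneg, ← ofV_aux V π h0 h1 h2]
    constructor
    · intro h; rw [e']; exact V.mul_mem _ _ hs.2 h
    · intro h; rw [e]; exact V.mul_mem _ _ hs.1 h
  exact
  { ord := fun z => if h : z = 0 then ⊤ else (((H z h).choose : ℤ) : WithTop ℤ)
    ord_zero := by simp
    ord_ne_top := fun x hx => by simp [hx]
    ord_one := by
      have hs := (H 1 one_ne_zero).choose_spec
      set n := (H 1 one_ne_zero).choose with hn'
      have : n = 0 := by
        rw [one_mul, ← zpow_neg, ofV_aux V π h0 h1 h2, ofV_aux V π h0 h1 h2] at hs; omega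
      simp only [one_ne_zero, dite_false]
      rw [← hn', this]; rfl
    ord_mul := fun x y => by
      by_cases hx : x = 0
      · simp [hx]
      by_cases hy : y = 0
      · simp [hy]
      have hxy := mul_ne_zero hx hy
      simp only [hx, hy, hxy, dite_false]
      rw [← WithTop.coe_add]
      congr 1
      have sx := (H x hx).choose_spec
      have sy := (H y hy).choose_spec
      have sz := (H _ hxy).choose_spec
      set n := (H x hx).choose
      set m := (H y hy).choose
      set k := (H _ hxy).choose
      have e1 : π ^ (k - (n + m)) = ((x * y) * π ^ (-k))⁻¹ * ((x * π ^ (-n)) * (y * π ^ (-m))) := by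
        rw [mul_inv, mul_inv, sub_eq_add_neg, zpow_add₀ h0, neg_add, zpow_add₀ h0, zpow_neg _ k]
        have := zpow_ne_zero k h0
        field_simp
      have e2 : π ^ ((n + m) - k) = ((x * y) * π ^ (-k)) * ((x * π ^ (-n))⁻¹ * (y * π ^ (-m))⁻¹) := by
        rw [← neg_sub, zpow_neg, e1]
        simp only [mul_inv_rev, inv_inv]; ring
      have i1 : 0 ≤ k - (n + m) := by
        rw [← ofV_aux V π h0 h1 h2, e1]
        exact V.mul_mem _ _ sz.2 (V.mul_mem _ _ sx.1 sy.1)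
      have i2 : 0 ≤ (n + m) - k := by
        rw [← ofV_aux V π h0 h1 h2, e2]
        exact V.mul_mem _ _ sz.1 (V.mul_mem _ _ sx.2 sy.2)
      omega
    ord_add := fun x y => by
      by_cases hx : x = 0
      · simp [hx]
      by_cases hy : y = 0
      · simp [hy]
      by_cases hxy : x + y = 0
      · simp [hxy]
      simp only [hx, hy, hxy, dite_false]
      rw [← WithTop.coe_min, WithTop.coe_le_coe, ← hn _ hxy, add_mul]
      exact V.add_mem _ _ ((hn x hx _).mpr (min_le_left _ _)) ((hn y hy _).mpr (min_le_right _ _))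
    ord_surj := fun n => ⟨π ^ n, by
      have hz : π ^ n ≠ 0 := zpow_ne_zero _ h0
      simp only [hz, dite_false]
      congr 1
      have hs := (H _ hz).choose_spec
      set k := (H _ hz).choose
      rw [← zpow_add₀ h0, ← zpow_neg, ofV_aux V π h0 h1 h2, ofV_aux V π h0 h1 h2] at hs
      omega⟩ }

lemma ofV_ord_nonneg {z : K} : 0 ≤ (ofV V π h0 h1 h2 H).ord z ↔ z ∈ V := by
  by_cases hz : z = 0
  · simp [hz, (ofV V π h0 h1 h2 H).ord_zero]
  have : (ofV V π h0 h1 h2 H).ord z = (((H z hz).choose : ℤ) : WithTop ℤ) := by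
    simp [ofV, hz]
  rw [this]
  have hs := (H z hz).choose_spec
  set n := (H z hz).choose
  have e : z = (z * π ^ (-n)) * π ^ n := by
    rw [mul_assoc, ← zpow_add₀ h0]; simp
  have e' : π ^ n = (z * π ^ (-n))⁻¹ * z := by
    rw [mul_inv, zpow_neg, inv_inv]; field_simp
  have : (0 : WithTop ℤ) ≤ (n : WithTop ℤ) ↔ 0 ≤ n := by norm_cast
  rw [this, ← ofV_aux V π h0 h1 h2]
  constructor
  · intro h; rw [e]; exact V.mul_mem _ _ hs.1 h
  · intro h; rw [e']; exact V.mul_mem _ _ hs.2 h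

lemma ofV_vring : (ofV V π h0 h1 h2 H).vring = V := by
  ext z; rw [mem_vring, ofV_ord_nonneg]

lemma ofV_o_unif : (ofV V π h0 h1 h2 H).o π = 1 := by
  apply o_of_ord
  simp only [ofV, h0, dite_false]
  congr 1
  have hs := (H _ h0).choose_spec
  set k := (H _ h0).choose
  have e : π * π ^ (-k) = π ^ (1 - k) := by
    rw [sub_eq_add_neg, zpow_add₀ h0, zpow_one]
  rw [e, ← zpow_neg, ofV_aux V π h0 h1 h2, ofV_aux V π h0 h1 h2] at hs
  omega
end ofV

end FFPrime



namespace FFPrime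
open Polynomial
variable {K M : Type} [Field K] [Field M] [Algebra K M] (v : FFPrime K)

lemma exists_dominating : ∃ V : ValuationSubring M, ∀ x : K, algebraMap K M x ∈ V ↔ x ∈ v.vring := by
  obtain ⟨π, h0, h1⟩ := v.exists_unif
  let A : Subring M := v.vring.toSubring.map (algebraMap K M)
  have hπ : algebraMap K M π ∈ A := ⟨π, by
    change π ∈ v.vring
    rw [mem_vring', h1]; simp, rfl⟩
  have hne : Ideal.span {(⟨algebraMap K M π, hπ⟩ : A)} ≠ ⊤ := by
    intro h
    rw [Ideal.span_singleton_eq_top, isUnit_iff_exists_inv] at h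
    obtain ⟨⟨_, ⟨b, hb, rfl⟩⟩, e⟩ := h
    have e' : algebraMap K M π * algebraMap K M b = 1 := congrArg Subtype.val e
    rw [← map_mul, ← map_one (algebraMap K M)] at e'
    have e2 := (algebraMap K M).injective e'
    have hb' : b ∈ v.vring := hb
    have hb0 : b ≠ 0 := by rintro rfl; simp at e2
    have := v.o_mul h0 hb0
    rw [e2, o_one, h1] at this
    rw [mem_vring'] at hb'
    simp only [hb0, false_or] at hb'
    omega
  obtain ⟨V, hV1, hV2⟩ := Ideal.image_subset_nonunits_valuationSubring _ hne
  refine ⟨V, fun x => ⟨fun hx => ?_, fun hx => hV1 ⟨x, hx, rfl⟩⟩⟩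
  have hπV : algebraMap K M π ∈ V.nonunits := hV2 ⟨_, Ideal.subset_span rfl, rfl⟩
  rw [ValuationSubring.mem_nonunits_iff_or] at hπV
  have hπV' := hπV.resolve_left (by simpa using h0)
  by_contra hn
  rw [mem_vring'] at hn
  push Not at hn
  apply hπV'
  have hpx : (π * x)⁻¹ ∈ v.vring := by
    rw [mem_vring', o_inv, v.o_mul h0 hn.1, h1]; right; omega
  have e : (algebraMap K M π)⁻¹ = algebraMap K M x * algebraMap K M (π * x)⁻¹ := by
    rw [← map_inv₀, ← map_mul]; congr 1
    have := hn.1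
    field_simp
  rw [e]
  exact V.mul_mem _ _ hx (hV1 ⟨_, hpx, rfl⟩)

lemma mem_of_pow_mem (V : ValuationSubring M) {z : M} {n : ℕ} (hn : n ≠ 0) (h : z ^ n ∈ V) : z ∈ V := by
  rw [← V.valuation_le_one_iff] at h ⊢
  rw [map_pow] at h
  exact (pow_le_one_iff hn).mp h

/-- evaluation hom `O[X] → M` -/
def evH (α : M) : v.vring[X] →+* M := eval₂RingHom ((algebraMap K M).comp v.vring.subtype) α

lemma evH_C (α : M) (c : v.vring) : v.evH α (C c) = algebraMap K M c := by simp [evH]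
lemma evH_X (α : M) : v.evH α X = α := by simp [evH]

variable {v}
lemma hfrac_of_adjoin {α : M} (hα : IsIntegral K α) (htop : IntermediateField.adjoin K {α} = ⊤)
    {π : K} (h0 : π ≠ 0) (h1 : v.o π = 1) (z : M) :
    ∃ k : ℕ, z * algebraMap K M π ^ k ∈ (v.evH α).range := by
  have htop' : Algebra.adjoin K {α} = ⊤ := by
    rw [← IntermediateField.adjoin_simple_toSubalgebra_of_isAlgebraic hα.isAlgebraic, htop]
    rfl
  have hπ : algebraMap K M π ∈ (v.evH α).range :=
    ⟨C ⟨π, by rw [mem_vring', h1]; simp⟩, evH_C _ _ _⟩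
  have hz : z ∈ Algebra.adjoin K {α} := htop' ▸ Algebra.mem_top
  induction hz using Algebra.adjoin_induction with
  | mem x hx =>
    rw [Set.mem_singleton_iff] at hx
    subst hx
    exact ⟨0, by simpa using ⟨X, evH_X _ _⟩⟩
  | algebraMap r =>
    by_cases hr : r = 0
    · subst hr; exact ⟨0, by simp⟩
    refine ⟨(v.o r).natAbs, C ⟨r * π ^ (v.o r).natAbs, ?_⟩, ?_⟩
    · rw [mem_vring', v.o_mul hr (pow_ne_zero _ h0), v.o_pow h0, h1]; right; omega
    · rw [evH_C]; simp
  | add x y _ _ hx hy =>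
    obtain ⟨k, hk⟩ := hx
    obtain ⟨l, hl⟩ := hy
    refine ⟨k + l, ?_⟩
    have : (x + y) * algebraMap K M π ^ (k + l) = (x * algebraMap K M π ^ k) * algebraMap K M π ^ l
      + (y * algebraMap K M π ^ l) * algebraMap K M π ^ k := by ring
    rw [this]
    exact add_mem (mul_mem hk (pow_mem hπ _)) (mul_mem hl (pow_mem hπ _))
  | mul x y _ _ hx hy =>
    obtain ⟨k, hk⟩ := hx
    obtain ⟨l, hl⟩ := hy
    refine ⟨k + l, ?_⟩
    have : (x * y) * algebraMap K M π ^ (k + l) = (x * algebraMap K M π ^ k) * 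
      (y * algebraMap K M π ^ l) := by ring
    rw [this]
    exact mul_mem hk hl

lemma ext_aux (V : ValuationSubring M) (R0 : Subring M) (hR0 : R0 ≤ V.toSubring) {π : M}
    (h0 : π ≠ 0) (h1 : π ∈ V) (h2 : π⁻¹ ∉ V)
    (hfrac : ∀ z : M, ∃ k : ℕ, z * π ^ k ∈ R0) {h : M} (hh : h ∈ V) (hh' : h⁻¹ ∈ V) (hh0 : h ≠ 0)
    (hstep : ∀ z ∈ R0, z ∈ V.nonunits → ∃ z' ∈ R0, h * z = π * z') (z : M) (hz : z ≠ 0) :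
    ∃ n : ℤ, ∃ m : ℕ, ∃ r ∈ R0, r⁻¹ ∈ V ∧ z = π ^ n * (h⁻¹) ^ m * r := by
  have main : ∀ N : ℕ, ∀ z ∈ R0, z ≠ 0 → z * (π⁻¹) ^ N ∉ V → 
      ∃ n : ℤ, ∃ m : ℕ, ∃ r ∈ R0, r⁻¹ ∈ V ∧ z = π ^ n * (h⁻¹) ^ m * r := by
    intro N
    induction N with
    | zero =>
      intro z hz _ hn
      exact absurd (hR0 hz) (by simpa using hn)
    | succ N ih =>
      intro z hz hz0 hn
      by_cases hu : z ∈ V.nonunits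
      · obtain ⟨z', hz', e⟩ := hstep z hz hu
        have hz'0 : z' ≠ 0 := by
          rintro rfl
          rw [mul_zero] at e
          exact mul_ne_zero hh0 hz0 e
        have : z' * π⁻¹ ^ N ∉ V := by
          intro hc
          apply hn
          have : z * π⁻¹ ^ (N + 1) = h⁻¹ * (z' * π⁻¹ ^ N) := by
            rw [pow_succ]; field_simp; linear_combination e
          rw [this]
          exact V.mul_mem _ _ hh' hc
        obtain ⟨n, m, r, hr, hr', e'⟩ := ih z' hz' hz'0 this
        refine ⟨n + 1, m + 1, r, hr, hr', ?_⟩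
        have e3 : z = π * h⁻¹ * z' := by field_simp; linear_combination e
        rw [e3, e', zpow_add_one₀ h0, pow_succ]; ring
      · rw [ValuationSubring.mem_nonunits_iff_or] at hu
        push Not at hu
        exact ⟨0, 0, z, hz, hu.2, by simp⟩
  obtain ⟨k, hk⟩ := hfrac z
  have hk0 : z * π ^ k ≠ 0 := mul_ne_zero hz (pow_ne_zero _ h0)
  obtain ⟨l, hl⟩ := hfrac (z * π ^ k)⁻¹
  obtain ⟨n, m, r, hr, hr', e⟩ := main (l + 1) _ hk hk0 (by
    intro hc
    apply h2
    have : π⁻¹ = (z * π ^ k)⁻¹ * π ^ l * (z * π ^ k * π⁻¹ ^ (l + 1)) := by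
      rw [inv_pow, pow_succ]; field_simp
    rw [this]
    exact V.mul_mem _ _ (hR0 hl) hc)
  refine ⟨n - k, m, r, hr, hr', ?_⟩
  have : z = (z * π ^ k) * π ^ (-(k:ℤ)) := by
    rw [zpow_neg, zpow_natCast]; field_simp
  rw [this, e, sub_eq_add_neg, zpow_add₀ h0]; ring

/-- `P` extends `v` with `e = 1`. -/
def Ext1 (P : FFPrime M) (v : FFPrime K) : Prop := ∀ x : K, P.ord (algebraMap K M x) = v.ord x

lemma Ext1.o {P : FFPrime M} (h : Ext1 P v) (x : K) : P.o (algebraMap K M x) = v.o x := by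
  unfold FFPrime.o; rw [h x]

lemma ext1_of {P : FFPrime M} (h : ∀ x : K, algebraMap K M x ∈ P.vring ↔ x ∈ v.vring)
    {π : K} (h0 : π ≠ 0) (h1 : v.o π = 1) (h2 : P.o (algebraMap K M π) = 1) : Ext1 P v := by
  intro x
  by_cases hx : x = 0
  · simp [hx, v.ord_zero, P.ord_zero]
  have inj := (algebraMap K M).injective
  have hx' : algebraMap K M x ≠ 0 := by simpa using hx
  have h0' : algebraMap K M π ≠ 0 := by simpa using h0
  rw [v.ord_eq hx, P.ord_eq hx']
  congr 1
  have a1 := h (x * π ^ (-(v.o x)))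
  have a2 := h (x * π ^ (-(v.o x)))⁻¹
  have hz : x * π ^ (-(v.o x)) ≠ 0 := mul_ne_zero hx (zpow_ne_zero _ h0)
  have e1 : v.o (x * π ^ (-(v.o x))) = 0 := by
    rw [v.o_mul hx (zpow_ne_zero _ h0), v.o_zpow h0, h1]; ring
  have e2 : P.o (algebraMap K M (x * π ^ (-(v.o x)))) = P.o (algebraMap K M x) - v.o x := by
    rw [map_mul, map_zpow₀, P.o_mul hx' (zpow_ne_zero _ h0'), P.o_zpow h0', h2]; ring
  rw [map_inv₀] at a2
  rw [mem_vring', mem_vring', e1, e2] at a1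
  rw [mem_vring', mem_vring', o_inv, o_inv, e1, e2] at a2
  have hz' : algebraMap K M (x * π ^ (-(v.o x))) ≠ 0 := by
    intro hc; exact hz (inj (by simpa using hc))
  simp only [hz', hz, inv_eq_zero, false_or] at a1 a2
  omega

/-- assembling -/
lemma exists_ext_of_step (V : ValuationSubring M) (hV : ∀ x : K, algebraMap K M x ∈ V ↔ x ∈ v.vring)
    {α : M} (hαV : α ∈ V) (hα : IsIntegral K α) (htop : IntermediateField.adjoin K {α} = ⊤)
    {π : K} (h0 : π ≠ 0) (h1 : v.o π = 1)
    {h : M} (hh : h ∈ V) (hh' : h⁻¹ ∈ V) (hh0 : h ≠ 0)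
    (hstep : ∀ z ∈ (v.evH α).range, z ∈ V.nonunits → 
      ∃ z' ∈ (v.evH α).range, h * z = algebraMap K M π * z') :
    ∃ P : FFPrime M, Ext1 P v ∧ P.vring = V ∧ ((v.evH α).range ≤ V.toSubring) ∧
      ∀ z : M, z ≠ 0 → ∃ n : ℤ, ∃ m : ℕ, ∃ r ∈ (v.evH α).range, r⁻¹ ∈ V ∧ 
        z = algebraMap K M π ^ n * (h⁻¹) ^ m * r := by
  have hR0 : (v.evH α).range ≤ V.toSubring := by
    rintro _ ⟨g, rfl⟩
    change _ ∈ V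
    induction g using Polynomial.induction_on' with
    | add p q hp hq => rw [map_add]; exact V.add_mem _ _ hp hq
    | monomial n c =>
      rw [← C_mul_X_pow_eq_monomial, map_mul, map_pow, evH_C, evH_X]
      exact V.mul_mem _ _ ((hV _).mpr c.2) (pow_mem hαV n)
  have h0' : algebraMap K M π ≠ 0 := by simpa using h0
  have hπ1 : algebraMap K M π ∈ V := (hV _).mpr (by rw [mem_vring', h1]; simp)
  have hπ2 : (algebraMap K M π)⁻¹ ∉ V := by
    rw [← map_inv₀, hV, mem_vring', o_inv, h1]
    simp [h0]
  have key := ext_aux V _ hR0 h0' hπ1 hπ2 (hfrac_of_adjoin hα htop h0 h1) hh hh' hh0 hstep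
  have H : ∀ z : M, z ≠ 0 → ∃ n : ℤ, z * (algebraMap K M π) ^ (-n) ∈ V ∧ 
      (z * (algebraMap K M π) ^ (-n))⁻¹ ∈ V := by
    intro z hz
    obtain ⟨n, m, r, hr, hr', e⟩ := key z hz
    have e2 : z * (algebraMap K M π) ^ (-n) = h⁻¹ ^ m * r := by
      rw [e, zpow_neg]; 
      have := zpow_ne_zero n h0'
      field_simp
    refine ⟨n, ?_, ?_⟩
    · rw [e2]; exact V.mul_mem _ _ (pow_mem hh' _) (hR0 hr)
    · rw [e2, mul_inv, inv_pow, inv_inv]; exact V.mul_mem _ _ (pow_mem hh _) hr'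
  refine ⟨ofV V _ h0' hπ1 hπ2 H, ?_, ofV_vring .., hR0, key⟩
  refine ext1_of ?_ h0 h1 (ofV_o_unif ..)
  intro x
  rw [ofV_vring, hV]

lemma mem_nonunits_iff_ord {P : FFPrime M} {z : M} : z ∈ P.vring.nonunits ↔ 0 < P.ord z := by
  rw [ValuationSubring.mem_nonunits_iff_or, ord_pos_iff, mem_vring', o_inv]
  by_cases hz : z = 0
  · simp [hz]
  · simp [hz]

end FFPrime



namespace FFPrime
open Polynomial
variable {K M : Type} [Field K] [Field M] [Algebra K M] {v : FFPrime K}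

lemma ord_of_root {q : ℕ} (hq : q ≠ 0) {ξ : K} (h : ξ ^ q = 1) : v.ord ξ = 0 := by
  have h0 : ξ ≠ 0 := by rintro rfl; simp [hq] at h
  have := v.o_pow h0 q
  rw [h, o_one] at this
  rw [v.ord_eq h0]
  have : v.o ξ = 0 := by
    rcases mul_eq_zero.mp this.symm with h | h
    · exact absurd (by exact_mod_cast h) hq
    · exact h
  rw [this]; rfl

/-- The split case. -/
lemma exists_split {q : ℕ} (hq : 0 < q) (hqv : v.ord (q : K) = 0) {ζ : K} (hζ : IsPrimitiveRoot ζ q)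
    {d : K} (hd : 0 < v.ord (d - 1)) {α : M} (hα : α ^ q = algebraMap K M d)
    (htop : IntermediateField.adjoin K {α} = ⊤) :
    ∃ P : FFPrime M, Ext1 P v ∧ ∀ z : M, 0 ≤ P.ord z → ∃ x : K, 0 < P.ord (z - algebraMap K M x) := by
  obtain ⟨V, hV⟩ := v.exists_dominating (M := M)
  obtain ⟨π, h0, h1⟩ := v.exists_unif
  have inj := (algebraMap K M).injective
  have hVn : ∀ x : K, algebraMap K M x ∈ V.nonunits ↔ 0 < v.ord x := by
    intro x
    rw [ValuationSubring.mem_nonunits_iff_or, ← map_inv₀, hV, ord_pos_iff, mem_vring', o_inv]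
    by_cases hx : x = 0
    · simp [hx]
    · simp [hx]
  have hdV : d ∈ v.vring := by
    have : d = (d - 1) + 1 := by ring
    rw [this]
    exact v.vring.add_mem _ _ hd.le v.vring.one_mem
  have hαV : α ∈ V := mem_of_pow_mem V hq.ne' (by rw [hα, hV]; exact hdV)
  have hIntg : IsIntegral K α := by
    refine IsIntegral.of_pow hq ?_
    rw [hα]; exact isIntegral_algebraMap
  -- find ξ
  have hζM : IsPrimitiveRoot (algebraMap K M ζ) q := hζ.map_of_injective inj
  have hprod := hζM.pow_sub_pow_eq_prod_sub_mul α 1 hq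
  have hnon : ∏ μ ∈ nthRootsFinset q (1 : M), (α - μ * 1) ∈ V.nonunits := by
    rw [← hprod, hα, one_pow, ← map_one (algebraMap K M), ← map_sub, hVn]; exact hd
  rw [ValuationSubring.mem_nonunits_iff, map_prod] at hnon
  have : ∃ μ ∈ nthRootsFinset q (1 : M), V.valuation (α - μ * 1) < 1 := by
    by_contra hcon
    push Not at hcon
    exact absurd hnon (not_lt.mpr (Finset.one_le_prod' hcon))
  obtain ⟨μ, hμ, hμ'⟩ := this
  rw [mem_nthRootsFinset hq] at hμ
  have : NeZero q := ⟨hq.ne'⟩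
  obtain ⟨i, -, rfl⟩ := hζM.eq_pow_of_pow_eq_one hμ
  set ξ := ζ ^ i with hξ
  have hξ1 : ξ ^ q = 1 := by rw [hξ, ← pow_mul, mul_comm, pow_mul, hζ.pow_eq_one, one_pow]
  have hξv : v.ord ξ = 0 := ord_of_root hq.ne' hξ1
  rw [← map_pow, ← hξ, mul_one, ← ValuationSubring.mem_nonunits_iff] at hμ'
  have hξV : algebraMap K M ξ ∈ V := (hV _).mpr (by rw [mem_vring, hξv])
  -- congruence for elements of R0
  let ξ' : v.vring := ⟨ξ, by rw [mem_vring, hξv]⟩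
  have hcong : ∀ g : v.vring[X], ∃ g1 : v.vring[X], 
      v.evH α g = algebraMap K M ((g.eval ξ' : v.vring) : K) + (α - algebraMap K M ξ) * v.evH α g1 := by
    intro g
    obtain ⟨g1, hg1⟩ := X_sub_C_dvd_sub_C_eval (a := ξ') (p := g)
    refine ⟨g1, ?_⟩
    have : g = C (g.eval ξ') + (X - C ξ') * g1 := by rw [← hg1]; ring
    conv_lhs => rw [this]
    rw [map_add, map_mul, map_sub, evH_C, evH_X, evH_C]
  -- R0 ≤ V
  have hR0 : ∀ g : v.vring[X], v.evH α g ∈ V := by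
    intro g
    induction g using Polynomial.induction_on' with
    | add p q hp hq => rw [map_add]; exact V.add_mem _ _ hp hq
    | monomial n c =>
      rw [← C_mul_X_pow_eq_monomial, map_mul, map_pow, evH_C, evH_X]
      exact V.mul_mem _ _ ((hV _).mpr c.2) (pow_mem hαV n)
  have hmulnon : ∀ x ∈ V.nonunits, ∀ y ∈ V, x * y ∈ V.nonunits := by
    intro x hx y hy
    rw [ValuationSubring.mem_nonunits_iff] at hx ⊢
    rw [map_mul]
    rw [← V.valuation_le_one_iff] at hy
    calc _ ≤ V.valuation x * 1 := by gcongr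
      _ < 1 := by simpa using hx
  -- h
  let hp : v.vring[X] := ∑ k ∈ Finset.range q, X ^ k * C ξ' ^ (q - 1 - k)
  let h : M := v.evH α hp
  have hhmul : h * (α - algebraMap K M ξ) = algebraMap K M (d - 1) := by
    have : hp * (X - C ξ') = X ^ q - C ξ' ^ q := (Commute.all _ _).geom_sum₂_mul q
    have := congrArg (v.evH α) this
    rw [map_mul, map_sub, map_sub, map_pow, map_pow, evH_X, evH_C] at this
    change h * (α - algebraMap K M ξ) = _ at this
    rw [this, hα, map_sub, ← map_pow]
    change _ - algebraMap K M (ξ ^ q) = _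
    rw [hξ1]
  have hpe : ((hp.eval ξ' : v.vring) : K) = q * ξ ^ (q - 1) := by
    have : hp.eval ξ' = q * ξ' ^ (q - 1) := by
      simp only [hp, eval_finsetSum, eval_mul, eval_pow, eval_X, eval_C]
      rw [Finset.sum_congr rfl (g := fun _ => ξ' ^ (q - 1))]
      · simp
      · intro k hk
        rw [← pow_add]; congr 1
        have := Finset.mem_range.mp hk; omega
    rw [this]; simp [ξ']
  obtain ⟨g1, hg1⟩ := hcong hp
  have hhu : h ∉ V.nonunits := by
    intro hc
    have : algebraMap K M (q * ξ ^ (q - 1)) ∈ V.nonunits := by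
      rw [← hpe]
      have e : algebraMap K M ((hp.eval ξ' : v.vring) : K) = h - (α - algebraMap K M ξ) * v.evH α g1 := by
        rw [show h = v.evH α hp from rfl, hg1]; ring
      rw [e]
      exact sub_mem hc (hmulnon _ hμ' _ (hR0 _))
    rw [hVn, v.ord_mul, hqv, zero_add, ord_of_root hq.ne' (by rw [← pow_mul, mul_comm, pow_mul, hξ1, one_pow])] at this
    exact lt_irrefl _ this
  have hh0 : h ≠ 0 := by
    intro hc; apply hhu; rw [hc]; exact zero_mem _
  have hh' : h⁻¹ ∈ V := by
    rw [ValuationSubring.mem_nonunits_iff_or] at hhu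
    push Not at hhu
    exact hhu.2
  have hdiv : ∀ x : K, 0 < v.ord x → ∃ y : v.vring, x = π * y := by
    intro x hx
    refine ⟨⟨π⁻¹ * x, ?_⟩, by simp [h0]⟩
    rw [ord_pos_iff] at hx
    rcases hx with rfl | hx
    · simp
    · by_cases hx0 : x = 0
      · simp [hx0]
      rw [mem_vring', v.o_mul (inv_ne_zero h0) hx0, o_inv, h1]; right; omega
  obtain ⟨e, he⟩ := hdiv _ hd
  obtain ⟨P, hP1, hPV, -, hP3⟩ := exists_ext_of_step V hV hαV hIntg htop h0 h1 (hR0 hp) hh' hh0 (by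
    rintro _ ⟨g, rfl⟩ hz
    obtain ⟨g2, hg2⟩ := hcong g
    have : algebraMap K M ((g.eval ξ' : v.vring) : K) ∈ V.nonunits := by
      have : algebraMap K M ((g.eval ξ' : v.vring) : K) = v.evH α g - (α - algebraMap K M ξ) * v.evH α g2 := by
        rw [hg2]; ring
      rw [this]
      exact sub_mem hz (hmulnon _ hμ' _ (hR0 _))
    rw [hVn] at this
    obtain ⟨e2, he2⟩ := hdiv _ this
    refine ⟨_, ⟨hp * C e2 + C e * g2, rfl⟩, ?_⟩
    rw [map_add, map_mul, map_mul, evH_C, evH_C]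
    change h * v.evH α g = _
    rw [hg2, he2, mul_add, ← mul_assoc, hhmul, he, map_mul, map_mul]
    change _ = algebraMap K M π * (h * _ + _)
    ring)
  refine ⟨P, hP1, ?_⟩
  have hPn : ∀ z, z ∈ V.nonunits ↔ 0 < P.ord z := by
    intro z; rw [← mem_nonunits_iff_ord, hPV]
  have hPv : ∀ z, z ∈ V ↔ 0 ≤ P.ord z := by
    intro z; rw [← mem_vring, hPV]
  simp_rw [← hPn, ← hPv]
  -- residue
  have hres0 : ∀ g : v.vring[X], ∃ x : v.vring, v.evH α g - algebraMap K M x ∈ V.nonunits := by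
    intro g
    obtain ⟨g2, hg2⟩ := hcong g
    refine ⟨g.eval ξ', ?_⟩
    rw [hg2, add_sub_cancel_left]
    exact hmulnon _ hμ' _ (hR0 _)
  have hresm : ∀ z ∈ V, ∀ w ∈ V, (∃ x ∈ v.vring, z - algebraMap K M x ∈ V.nonunits) →
      (∃ x ∈ v.vring, w - algebraMap K M x ∈ V.nonunits) → 
      (∃ x ∈ v.vring, z * w - algebraMap K M x ∈ V.nonunits) := by
    rintro z hz w hw ⟨x, hx, hx'⟩ ⟨y, hy, hy'⟩
    refine ⟨x * y, mul_mem hx hy, ?_⟩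
    have : z * w - algebraMap K M (x * y) = (z - algebraMap K M x) * w + 
      (w - algebraMap K M y) * algebraMap K M x := by rw [map_mul]; ring
    rw [this]
    exact add_mem (hmulnon _ hx' _ hw) (hmulnon _ hy' _ ((hV _).mpr hx))
  have hhinv : ∃ x ∈ v.vring, h⁻¹ - algebraMap K M x ∈ V.nonunits := by
    obtain ⟨x, hx⟩ := hres0 hp
    change h - _ ∈ _ at hx
    have hxn : algebraMap K M x ∉ V.nonunits := by
      intro hc
      apply hhu
      have := add_mem hx hc
      rwa [sub_add_cancel] at this
    have hx0 : (x : K) ≠ 0 := by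
      intro hc; rw [hc, map_zero] at hxn; exact hxn (zero_mem _)
    have hxi : (x : K)⁻¹ ∈ v.vring := by
      rw [ValuationSubring.mem_nonunits_iff_or] at hxn
      push Not at hxn
      rw [← hV, map_inv₀]; exact hxn.2
    refine ⟨_, hxi, ?_⟩
    have hx0' : algebraMap K M x ≠ 0 := by simpa using hx0
    have : h⁻¹ - algebraMap K M (x : K)⁻¹ = (h - algebraMap K M x) * (-(h⁻¹ * algebraMap K M (x:K)⁻¹)) := by
      rw [map_inv₀]; field_simp; ring
    rw [this]
    exact hmulnon _ hx _ (V.neg_mem _ (V.mul_mem _ _ hh' ((hV _).mpr hxi)))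
  intro z hz
  by_cases hz0 : z = 0
  · exact ⟨0, by simpa [hz0] using zero_mem V.nonunits⟩
  obtain ⟨n, m, r, ⟨g, rfl⟩, hr', e5⟩ := hP3 z hz0
  have hn : 0 ≤ n := by
    have hπ1 : algebraMap K M π ∈ V := (hV _).mpr (by rw [mem_vring', h1]; simp)
    have hπ2 : (algebraMap K M π)⁻¹ ∉ V := by
      rw [← map_inv₀, hV, mem_vring', o_inv, h1]
      simp [h0]
    rw [← ofV_aux V (algebraMap K M π) (by simpa using h0) hπ1 hπ2]
    have hr0 : v.evH α g ≠ 0 := by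
      intro hc; apply hz0; rw [e5, hc, mul_zero]
    have : algebraMap K M π ^ n = z * h ^ m * (v.evH α g)⁻¹ := by
      have hh9 : v.evH α hp ≠ 0 := hh0
      change _ = z * (v.evH α hp) ^ m * _
      rw [e5, inv_pow]; field_simp
    rw [this]
    exact V.mul_mem _ _ (V.mul_mem _ _ hz (pow_mem (hR0 hp) _)) hr'
  lift n to ℕ using hn
  have hπO : π ∈ v.vring := by rw [mem_vring', h1]; simp
  have hpow : ∀ m : ℕ, ∃ x ∈ v.vring, h⁻¹ ^ m - algebraMap K M x ∈ V.nonunits := by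
    intro m
    induction m with
    | zero => exact ⟨1, one_mem _, by simpa using zero_mem V.nonunits⟩
    | succ k ih => rw [pow_succ]; exact hresm _ (pow_mem hh' _) _ hh' ih hhinv
  obtain ⟨x, hx⟩ := hres0 g
  obtain ⟨x, -, h⟩ := hresm (algebraMap K M π ^ n * h⁻¹ ^ m) 
    (V.mul_mem _ _ (pow_mem ((hV _).mpr hπO) _) (pow_mem hh' _)) _ (hR0 g)
    (hresm _ (pow_mem ((hV _).mpr hπO) _) _ (pow_mem hh' _) ⟨π ^ n, pow_mem hπO _, by simpa using zero_mem V.nonunits⟩ (hpow m))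
    ⟨x, x.2, hx⟩
  refine ⟨x, ?_⟩
  rw [e5, zpow_natCast]; exact h

end FFPrime



namespace FFPrime
open Polynomial
variable {K M : Type} [Field K] [Field M] [Algebra K M] {v : FFPrime K}

/-- The inert case. -/
lemma exists_inert {q : ℕ} (hq : q.Prime) {a : K} (ha : v.ord a = 0)
    (ha' : ¬ ∃ u : K, 0 < v.ord (a - u ^ q)) {α : M} (hα : α ^ q = algebraMap K M a)
    (htop : IntermediateField.adjoin K {α} = ⊤) :
    ∃ P : FFPrime M, Ext1 P v ∧ (∀ V : ValuationSubring M, 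
      (∀ x : K, algebraMap K M x ∈ V ↔ x ∈ v.vring) → V = P.vring) ∧ 
      Module.finrank K M = q ∧ ∀ y : M, y ≠ 0 → v.o (Algebra.norm K y) = q * P.o y := by
  obtain ⟨V, hV⟩ := v.exists_dominating (M := M)
  obtain ⟨π, h0, h1⟩ := v.exists_unif
  have inj := (algebraMap K M).injective
  have haV : a ∈ v.vring := by rw [mem_vring, ha]
  have hαV' : ∀ V : ValuationSubring M, (∀ x : K, algebraMap K M x ∈ V ↔ x ∈ v.vring) → α ∈ V := 
    fun V hV => mem_of_pow_mem V hq.ne_zero (by rw [hα, hV]; exact haV)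
  have hαV := hαV' V hV
  have hIntg : IsIntegral K α := by
    refine IsIntegral.of_pow hq.pos ?_
    rw [hα]; exact isIntegral_algebraMap
  have hirr : Irreducible (X ^ q - C a) := by
    apply X_pow_sub_C_irreducible_of_prime hq
    intro b hb
    apply ha'
    exact ⟨b, by rw [hb, sub_self, v.ord_zero]; exact WithTop.coe_lt_top 0⟩
  have hmin : minpoly K α = X ^ q - C a := by
    refine (minpoly.eq_of_irreducible_of_monic hirr ?_ (monic_X_pow_sub_C a hq.ne_zero)).symm
    simp [hα]
  have hfin : Module.finrank K M = q := by
    have := IntermediateField.adjoin.finrank hIntg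
    rw [htop, hmin, natDegree_X_pow_sub_C, IntermediateField.finrank_top'] at this
    exact this
  have : FiniteDimensional K M := Module.finite_of_finrank_pos (by rw [hfin]; exact hq.pos)
  have hR0 : ∀ V : ValuationSubring M, (∀ x : K, algebraMap K M x ∈ V ↔ x ∈ v.vring) → 
      ∀ g : v.vring[X], v.evH α g ∈ V := by
    intro V hV g
    induction g using Polynomial.induction_on' with
    | add p q hp hq => rw [map_add]; exact V.add_mem _ _ hp hq
    | monomial n c =>
      rw [← C_mul_X_pow_eq_monomial, map_mul, map_pow, evH_C, evH_X]
      exact V.mul_mem _ _ ((hV _).mpr c.2) (pow_mem (hαV' V hV) n)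
  let ψ : v.vring →+* V := 
    ((algebraMap K M).comp v.vring.subtype).codRestrict V.toSubring (fun x => (hV x).mpr x.2)
  have hloc : IsLocalHom ψ := by
    refine ⟨fun x hx => ?_⟩
    rw [isUnit_iff_exists_inv] at hx ⊢
    obtain ⟨y, hy⟩ := hx
    have hy' : algebraMap K M x * (y : M) = 1 := congrArg Subtype.val hy
    have hx0 : (x : K) ≠ 0 := by intro hc; rw [hc] at hy'; simp at hy'
    refine ⟨⟨(x : K)⁻¹, ?_⟩, by ext; simp [hx0]⟩
    rw [← hV, map_inv₀, inv_eq_of_mul_eq_one_right hy']; exact y.2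
  let κ := IsLocalRing.ResidueField v.vring
  let κV := IsLocalRing.ResidueField V
  let ψ' : κ →+* κV := IsLocalRing.ResidueField.map ψ
  letI : Algebra κ κV := ψ'.toAlgebra
  let a' : v.vring := ⟨a, haV⟩
  have hirr' : Irreducible (X ^ q - C (IsLocalRing.residue v.vring a')) := by
    apply X_pow_sub_C_irreducible_of_prime hq
    intro b hb
    obtain ⟨u, rfl⟩ := IsLocalRing.residue_surjective b
    apply ha'
    refine ⟨u, ?_⟩
    rw [← map_pow, ← sub_eq_zero, ← map_sub, IsLocalRing.residue_eq_zero_iff, 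
      ← ValuationSubring.coe_mem_nonunits_iff, mem_nonunits_iff_ord] at hb
    rw [← ord_neg]
    simpa [a'] using hb
  let αb : κV := IsLocalRing.residue V ⟨α, hαV⟩
  have hmin' : minpoly κ αb = X ^ q - C (IsLocalRing.residue v.vring a') := by
    refine (minpoly.eq_of_irreducible_of_monic hirr' ?_ (monic_X_pow_sub_C _ hq.ne_zero)).symm
    have e1 : (⟨α, hαV⟩ : V) ^ q = ψ a' := by
      apply Subtype.ext
      exact hα
    have e2 : algebraMap κ κV (IsLocalRing.residue v.vring a') = IsLocalRing.residue V (ψ a') := rfl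
    simp only [map_sub, map_pow, aeval_X, aeval_C]
    rw [e2, ← e1, map_pow, sub_self]
  obtain ⟨P, hP1, hPV, -, hP3⟩ := exists_ext_of_step V hV hαV hIntg htop h0 h1 (h := 1) V.one_mem 
    (by simpa using V.one_mem) one_ne_zero (by
    rintro _ ⟨g, rfl⟩ hz
    let m : v.vring[X] := X ^ q - C a'
    have hmm : m.Monic := monic_X_pow_sub_C _ hq.ne_zero
    have hm0 : v.evH α m = 0 := by
      simp only [m, map_sub, map_pow, evH_X, evH_C, hα, a', sub_self]
    have hg : v.evH α g = v.evH α (g %ₘ m) := by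
      conv_lhs => rw [← modByMonic_add_div g m, map_add, map_mul, hm0, zero_mul, add_zero]
    rw [hg] at hz ⊢
    set r := g %ₘ m
    have hrd : r.degree < q := by
      have := degree_modByMonic_lt g hmm
      rwa [degree_X_pow_sub_C hq.pos] at this
    have hev : aeval αb (r.map (IsLocalRing.residue v.vring)) = 
        IsLocalRing.residue V ⟨v.evH α r, hR0 V hV r⟩ := by
      have e3 : (⟨v.evH α r, hR0 V hV r⟩ : V) = eval₂ ψ ⟨α, hαV⟩ r := by
        apply Subtype.ext
        have := hom_eval₂ r ψ V.subtype ⟨α, hαV⟩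
        exact this.symm
      rw [e3, hom_eval₂, aeval_def, eval₂_map]
      rfl
    have hzero : aeval αb (r.map (IsLocalRing.residue v.vring)) = 0 := by
      rw [hev, IsLocalRing.residue_eq_zero_iff, ← ValuationSubring.coe_mem_nonunits_iff]
      exact hz
    have hr0 : r.map (IsLocalRing.residue v.vring) = 0 := by
      refine eq_zero_of_dvd_of_degree_lt (minpoly.dvd κ αb hzero) ?_
      rw [hmin', degree_X_pow_sub_C hq.pos]
      exact lt_of_le_of_lt degree_map_le hrd
    have hco : ∀ n, ∃ c : v.vring, r.coeff n = ⟨π, by rw [mem_vring', h1]; simp⟩ * c := by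
      intro n
      have : (r.map (IsLocalRing.residue v.vring)).coeff n = 0 := by rw [hr0]; simp
      rw [coeff_map, IsLocalRing.residue_eq_zero_iff, ← ValuationSubring.coe_mem_nonunits_iff, 
        mem_nonunits_iff_ord] at this
      refine ⟨⟨π⁻¹ * r.coeff n, ?_⟩, by ext; simp [h0]⟩
      by_cases hx0 : (r.coeff n : K) = 0
      · simp [hx0]
      rw [ord_pos_iff] at this
      replace this := this.resolve_left hx0
      rw [mem_vring', v.o_mul (inv_ne_zero h0) hx0, o_inv, h1]; right; omega
    have hdvd : C (⟨π, by rw [mem_vring', h1]; simp⟩ : v.vring) ∣ r := by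
      rw [C_dvd_iff_dvd_coeff]
      intro n; obtain ⟨c, hc⟩ := hco n; exact ⟨c, hc⟩
    obtain ⟨r', hr'⟩ := hdvd
    refine ⟨_, ⟨r', rfl⟩, ?_⟩
    rw [hr', map_mul, evH_C, one_mul])
  have h0' : algebraMap K M π ≠ 0 := by simpa using h0
  have hπ1 : algebraMap K M π ∈ V := (hV _).mpr (by rw [mem_vring', h1]; simp)
  have hπ2 : (algebraMap K M π)⁻¹ ∉ V := by
    rw [← map_inv₀, hV, mem_vring', o_inv, h1]
    simp [h0]
  have hπn := fun n : ℤ => ofV_aux (n := n) V (algebraMap K M π) h0' hπ1 hπ2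
  have hVR : ∀ z ∈ V, ∃ g, z = v.evH α g := by
    intro z hz
    by_cases hz0 : z = 0
    · exact ⟨0, by simp [hz0]⟩
    obtain ⟨n, m, r, ⟨g, rfl⟩, hr', e⟩ := hP3 z hz0
    have hr0 : v.evH α g ≠ 0 := by
      intro hc; apply hz0; rw [e, hc, mul_zero]
    have hn : 0 ≤ n := by
      rw [← hπn]
      have : algebraMap K M π ^ n = z * (v.evH α g)⁻¹ := by
        rw [e]; simp [hr0]
      rw [this]; exact V.mul_mem _ _ hz hr'
    lift n to ℕ using hn
    refine ⟨C ⟨π, by rw [mem_vring', h1]; simp⟩ ^ n * g, ?_⟩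
    rw [map_mul, map_pow, evH_C, e]; simp
  have hintV : ∀ z ∈ V, v.ord (Algebra.norm K z) ≥ 0 := by
    intro z hz
    obtain ⟨g, rfl⟩ := hVR z hz
    letI : Algebra v.vring M := ((algebraMap K M).comp v.vring.subtype).toAlgebra
    haveI : IsScalarTower v.vring K M := IsScalarTower.of_algebraMap_eq (fun x => rfl)
    have hαi : IsIntegral v.vring α := by
      refine IsIntegral.of_pow hq.pos ?_
      rw [hα]
      exact isIntegral_algebraMap (x := a')
    have : IsIntegral v.vring (v.evH α g) := by
      have e : v.evH α g = aeval α g := rfl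
      rw [e]
      induction g using Polynomial.induction_on' with
      | add p q hp hq => 
        rw [map_add]
        exact IsIntegral.add (hp (hR0 V hV p) rfl) (hq (hR0 V hV q) rfl)
      | monomial n c =>
        rw [aeval_monomial]
        exact isIntegral_algebraMap.mul (hαi.pow n)
    have := Algebra.isIntegral_norm K this
    rw [IsIntegrallyClosed.isIntegral_iff] at this
    obtain ⟨y, hy⟩ := this
    rw [← hy]; exact y.2
  have hunit : ∀ z : M, z ≠ 0 → P.o z = 0 → v.o (Algebra.norm K z) = 0 := by
    intro z hz0 hz
    have e1 : z ∈ V := by rw [← hPV, mem_vring', hz]; simp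
    have e2 : z⁻¹ ∈ V := by rw [← hPV, mem_vring', o_inv, hz]; simp
    have i1 := hintV _ e1
    have i2 := hintV _ e2
    have hn0 : Algebra.norm K z ≠ 0 := by rwa [Ne, Algebra.norm_eq_zero_iff]
    rw [Algebra.norm_inv] at i2
    rw [ge_iff_le, ord_nonneg_iff] at i1 i2
    rw [o_inv] at i2
    simp only [hn0, inv_eq_zero, false_or] at i1 i2
    omega
  refine ⟨P, hP1, ?_, hfin, ?_⟩
  · intro V' hV'
    rw [hPV]
    have hle : V ≤ V' := by
      intro z hz
      obtain ⟨g, rfl⟩ := hVR z hz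
      exact hR0 V' hV' g
    refine le_antisymm ?_ hle
    intro z hz
    by_contra hzV
    have hz0 : z ≠ 0 := by rintro rfl; exact hzV V.zero_mem
    have : (algebraMap K M π)⁻¹ ∈ V' := by
      have e : (algebraMap K M π)⁻¹ = z * (algebraMap K M π * z)⁻¹ := by field_simp
      rw [e]
      refine V'.mul_mem _ _ hz (hle ?_)
      rw [← hPV, mem_vring'] at hzV ⊢
      push Not at hzV
      rw [o_inv, P.o_mul h0' hz0, hP1.o, h1]; right; omega
    rw [← map_inv₀, hV', mem_vring', o_inv, h1] at this
    simp [h0] at this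
  · intro y hy
    have hπz := zpow_ne_zero (-(P.o y)) h0'
    have hz : y * algebraMap K M π ^ (-(P.o y)) ≠ 0 := mul_ne_zero hy hπz
    have e1 := hunit _ hz (by rw [P.o_mul hy hπz, P.o_zpow h0', hP1.o, h1]; ring)
    have hn0 : Algebra.norm K y ≠ 0 := by rwa [Ne, Algebra.norm_eq_zero_iff]
    rw [map_mul, Algebra.norm_zpow, Algebra.norm_algebraMap, hfin, v.o_mul hn0 (zpow_ne_zero _ (pow_ne_zero _ h0)),
      v.o_zpow (pow_ne_zero _ h0), v.o_pow h0, h1] at e1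
    linarith

end FFPrime



namespace FFC
open Polynomial
variable {k F : Type} [Field k] [Finite k] [Field F] [Algebra k[X] F]

lemma const_mem (V : ValuationSubring F) (c : k) : algebraMap k[X] F (C c) ∈ V := by
  by_cases hc : c = 0
  · simp [hc]
  have := Fintype.ofFinite k
  refine FFPrime.mem_of_pow_mem V (n := Fintype.card k - 1) ?_ ?_
  · have := Fintype.one_lt_card (α := k); omega
  · rw [← map_pow, ← C_pow, FiniteField.pow_card_sub_one_eq_one c hc]; simp

lemma poly_mem (V : ValuationSubring F) (h : algebraMap k[X] F X ∈ V) (g : k[X]) :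
    algebraMap k[X] F g ∈ V := by
  induction g using Polynomial.induction_on' with
  | add p q hp hq => rw [map_add]; exact V.add_mem _ _ hp hq
  | monomial n a =>
    rw [← C_mul_X_pow_eq_monomial, map_mul, map_pow]
    exact V.mul_mem _ _ (const_mem V a) (pow_mem h n)

lemma mem_of_isIntegral {R : Type*} [CommRing R] [Algebra R F] (V : ValuationSubring F)
    (h : ∀ r : R, algebraMap R F r ∈ V) {x : F} (hx : IsIntegral R x) : x ∈ V := by
  obtain ⟨f, hf, hfx⟩ := hx
  have : IsIntegral V x := by
    let ψ : R →+* V := (algebraMap R F).codRestrict V.toSubring h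
    refine ⟨f.map ψ, hf.map _, ?_⟩
    rw [eval₂_map]; exact hfx
  rw [IsIntegrallyClosed.isIntegral_iff] at this
  obtain ⟨y, rfl⟩ := this
  exact y.2

lemma mem_B_iff (x : F) : x ∈ integralClosure k[X] F ↔
    ∀ V : ValuationSubring F, algebraMap k[X] F X ∈ V → x ∈ V := by
  constructor
  · intro hx V hV
    exact mem_of_isIntegral V (poly_mem V hV) hx
  · intro h
    have h1 : x ∈ (⨅ V : {V : ValuationSubring F // ((algebraMap k[X] F).range : Set F) ⊆ V.toSubring}, V.1.toSubring) := by
      rw [Subring.mem_iInf]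
      rintro ⟨V, hV⟩
      exact h V (hV ⟨X, rfl⟩)
    rw [iInf_valuationSubring_superset] at h1
    have h2 : IsIntegral (Subring.closure ((algebraMap k[X] F).range : Set F)) x := h1
    rw [mem_integralClosure_iff]
    obtain ⟨f, hf, hfx⟩ := h2
    have : f ∈ lifts ((algebraMap k[X] F).codRestrict (Subring.closure ((algebraMap k[X] F).range : Set F))
        (fun r => Subring.subset_closure ⟨r, rfl⟩)) := by
      rw [lifts_iff_coeff_lifts]
      intro n
      obtain ⟨y, hy⟩ : (f.coeff n : F) ∈ (algebraMap k[X] F).range := by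
        have h3 := Subring.closure_eq (algebraMap k[X] F).range
        exact h3.le (f.coeff n).2
      exact ⟨y, Subtype.ext hy⟩
    obtain ⟨g, hg, -, hgm⟩ := lifts_and_natDegree_eq_and_monic this hf
    refine ⟨g, hgm, ?_⟩
    rw [← hg, eval₂_map] at hfx
    exact hfx

/-- Kaplansky's lemma. -/
lemma kap {A : Subring F} (hA : ∀ x : F, IsIntegral A x → x ∈ A) (m : Ideal A) [m.IsPrime] (x : F) :
    ∀ (n : ℕ) (f : A[X]), f.natDegree ≤ n → (∃ i, f.coeff i ∉ m) → eval₂ A.subtype x f = 0 →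
      ∃ u w : A, (u : F) * x = w ∧ (u ∉ m ∨ w ∉ m) := by
  intro n
  induction n with
  | zero =>
    rintro f hf ⟨i, hi⟩ hx
    rw [Nat.le_zero, natDegree_eq_zero] at hf
    obtain ⟨c, rfl⟩ := hf
    rw [eval₂_C] at hx
    have : c = 0 := Subtype.ext hx
    subst this
    simp at hi
  | succ n ih =>
    rintro f hf hi hx
    by_cases hn : f.natDegree ≤ n
    · exact ih f hn hi hx
    have hd : f.natDegree = n + 1 := by omega
    set a := f.leadingCoeff with ha
    have h1 : IsIntegral A ((a : F) * x) := by
      have := isIntegral_leadingCoeff_smul f x (by rw [aeval_def]; exact hx)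
      simpa [Subring.smul_def] using this
    set w : A := ⟨_, hA _ h1⟩ with hw
    by_cases hm : a ∈ m
    swap
    · exact ⟨a, w, rfl, Or.inl hm⟩
    by_cases hwm : w ∈ m
    swap
    · exact ⟨a, w, rfl, Or.inr hwm⟩
    -- g = erase leading + w X^n
    let g := f.eraseLead + C w * X ^ n
    refine ih g ?_ ?_ ?_
    · refine natDegree_add_le_of_degree_le ?_ (natDegree_C_mul_X_pow_le _ _)
      exact (eraseLead_natDegree_le f).trans (by omega)
    · obtain ⟨i, hi⟩ := hi
      have hin : i ≠ f.natDegree := by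
        rintro rfl; exact hi hm
      refine ⟨i, ?_⟩
      simp only [g, coeff_add, eraseLead_coeff_of_ne _ hin, coeff_C_mul, coeff_X_pow]
      split_ifs with h
      · rw [mul_one]; intro hc; exact hi ((Ideal.add_mem_iff_left _ hwm).mp hc)
      · simpa using hi
    · have e := eraseLead_add_C_mul_X_pow f
      rw [← e, eval₂_add, hd] at hx
      simp only [g, eval₂_add, eval₂_mul, eval₂_C, eval₂_X_pow] at hx ⊢
      rw [← hx, pow_succ, hw]
      simp only [Subring.subtype_apply]
      rw [← ha]
      ring

variable [Algebra (RatFunc k) F] [IsScalarTower k[X] (RatFunc k) F] [FiniteDimensional (RatFunc k) F]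

/-- integral closure of `k[X]` is Pruefer. -/
lemma prufer (m : Ideal (integralClosure k[X] F)) [m.IsPrime] (x : F) : 
    ∃ u w : integralClosure k[X] F, (u : F) * x = w ∧ (u ∉ m ∨ w ∉ m) := by
  have hx : IsAlgebraic k[X] x :=
    (IsFractionRing.isAlgebraic_iff k[X] (RatFunc k) F).mpr (Algebra.IsAlgebraic.isAlgebraic x)
  obtain ⟨f, hf, hfx⟩ := hx
  let _ : NormalizedGCDMonoid k[X] := Classical.choice inferInstance
  have hf1 : f.primPart.IsPrimitive := isPrimitive_primPart f
  have hfx' : aeval x f.primPart = 0 := by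
    rw [f.eq_C_content_mul_primPart, map_mul, aeval_C, mul_eq_zero] at hfx
    refine hfx.resolve_left ?_
    rw [IsScalarTower.algebraMap_apply k[X] (RatFunc k) F]
    simpa [content_eq_zero_iff] using hf
  let A : Subring F := (integralClosure k[X] F).toSubring
  let m' : Ideal A := m
  have : m'.IsPrime := ‹m.IsPrime›
  have hA : ∀ x : F, IsIntegral A x → x ∈ A := by
    intro x hx
    exact isIntegral_trans (A := integralClosure k[X] F) x hx
  let ψ : k[X] →+* A := (algebraMap k[X] (integralClosure k[X] F))
  obtain ⟨u, w, h⟩ := kap hA m' x _ (f.primPart.map ψ) le_rfl (by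
    by_contra! hc
    have hu : f.primPart.contentIdeal = ⊤ := by
      rw [← isPrimitive_iff_contentIdeal_eq_top]; exact hf1
    have : f.primPart.contentIdeal ≤ m'.comap ψ := by
      rw [contentIdeal_def, Ideal.span_le]
      intro c hc'
      rw [SetLike.mem_coe, mem_coeffs_iff] at hc'
      obtain ⟨n, -, rfl⟩ := hc'
      have := hc n
      rwa [coeff_map] at this
    rw [hu, top_le_iff] at this
    exact (Ideal.IsPrime.ne_top (I := m'.comap ψ) inferInstance) this) (by
    rw [eval₂_map]
    exact hfx')
  exact ⟨u, w, h⟩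

end FFC


set_option linter.unusedSectionVars false

namespace FFC
open Polynomial
variable {k F : Type} [Field k] [Finite k] [Field F] [Algebra k[X] F]
  [Algebra (RatFunc k) F] [IsScalarTower k[X] (RatFunc k) F] [FiniteDimensional (RatFunc k) F]

lemma algMap_inj : Function.Injective (algebraMap k[X] F) := by
  rw [IsScalarTower.algebraMap_eq k[X] (RatFunc k) F]
  exact (algebraMap (RatFunc k) F).injective.comp (IsFractionRing.injective _ _)

lemma finite_quot_poly (π : k[X]) (h : π ≠ 0) : Finite (k[X] ⧸ Ideal.span {π}) := by
  have : Module.Finite k (AdjoinRoot π) := PowerBasis.finite (AdjoinRoot.powerBasis h)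
  exact Module.finite_of_finite k (M := AdjoinRoot π)

lemma finite_quot_prime (π : k[X]) (h : Prime π) :
    Finite (integralClosure k[X] F ⧸ Ideal.span {algebraMap k[X] (integralClosure k[X] F) π}) := by
  set B := integralClosure k[X] F
  let p : Ideal k[X] := Ideal.span {π}
  have hp : p.IsMaximal := PrincipalIdealRing.isMaximal_of_irreducible h.irreducible
  let _ : Field (k[X] ⧸ p) := Ideal.Quotient.field p
  have hmap : p.map (algebraMap k[X] B) = Ideal.span {algebraMap k[X] B π} := by
    rw [Ideal.map_span]; simp
  rw [← hmap]
  have hr : Module.rank (k[X] ⧸ p) (B ⧸ p.map (algebraMap k[X] B)) ≤ 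
      (Module.finrank (RatFunc k) F : ℕ) := by
    refine rank_le ?_
    intro s hs
    choose b hb using fun i : s => Ideal.Quotient.mk_surjective (i : B ⧸ p.map (algebraMap k[X] B))
    have hli : LinearIndependent (k[X] ⧸ p) 
        (((Submodule.mkQ (p.map (algebraMap k[X] B))).restrictScalars k[X]) ∘ b) := by
      convert hs using 1
      funext i; exact hb i
    have := Ideal.FinrankQuotientMap.linearIndependent_of_nontrivial (RatFunc k)
      (by rw [Ideal.Quotient.algebraMap_eq, Ideal.mk_ker]; exact hp.ne_top)
      ((Algebra.linearMap B F).restrictScalars k[X]) Subtype.val_injective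
      ((Submodule.mkQ (p.map (algebraMap k[X] B))).restrictScalars k[X]) hli
    have := this.fintype_card_le_finrank
    rwa [Fintype.card_coe] at this
  have hfin : Module.Finite (k[X] ⧸ p) (B ⧸ p.map (algebraMap k[X] B)) := by
    have hfree : Module.Free (k[X] ⧸ p) (B ⧸ p.map (algebraMap k[X] B)) := Module.Free.of_divisionRing _ _
    exact Module.rank_lt_aleph0_iff.mp (lt_of_le_of_lt hr Cardinal.natCast_lt_aleph0)
  have : Finite (k[X] ⧸ p) := finite_quot_poly π h.ne_zero
  exact Module.finite_of_finite (k[X] ⧸ p)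

lemma finite_quot_mul {B : Type*} [CommRing B] (x y : B) (hx : Finite (B ⧸ Ideal.span {x}))
    (hy : Finite (B ⧸ Ideal.span {y})) : Finite (B ⧸ Ideal.span {x * y}) := by
  refine Finite.of_surjective (α := (B ⧸ Ideal.span {x}) × (B ⧸ Ideal.span {y})) 
    (fun c => Ideal.Quotient.mk _ (c.1.out + x * c.2.out)) ?_
  intro b
  obtain ⟨b, rfl⟩ := Ideal.Quotient.mk_surjective b
  have h1 := Ideal.Quotient.mk_out (Ideal.Quotient.mk (Ideal.span {x}) b)
  rw [Ideal.Quotient.mk_eq_mk_iff_sub_mem, Ideal.mem_span_singleton'] at h1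
  obtain ⟨c, hc⟩ := h1
  have h2 := Ideal.Quotient.mk_out (Ideal.Quotient.mk (Ideal.span {y}) (-c))
  rw [Ideal.Quotient.mk_eq_mk_iff_sub_mem, Ideal.mem_span_singleton'] at h2
  obtain ⟨d, hd⟩ := h2
  refine ⟨(Ideal.Quotient.mk _ b, Ideal.Quotient.mk _ (-c)), ?_⟩
  rw [Ideal.Quotient.mk_eq_mk_iff_sub_mem, Ideal.mem_span_singleton']
  refine ⟨d, ?_⟩
  dsimp only
  linear_combination x * hd + hc

lemma finite_quot_elt (π : k[X]) (h : π ≠ 0) :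
    Finite (integralClosure k[X] F ⧸ Ideal.span {algebraMap k[X] (integralClosure k[X] F) π}) := by
  induction π using UniqueFactorizationMonoid.induction_on_prime with
  | h₁ => exact absurd rfl h
  | h₂ x hx =>
    rw [Ideal.span_singleton_eq_top.mpr (hx.map _)]
    have : Subsingleton (integralClosure k[X] F ⧸ (⊤ : Ideal (integralClosure k[X] F))) := 
      Ideal.Quotient.subsingleton_iff.mpr rfl
    exact Finite.of_subsingleton
  | h₃ a p ha hp ih =>
    rw [map_mul]
    exact finite_quot_mul _ _ (finite_quot_prime p hp) (ih ha)

lemma finite_quot (I : Ideal (integralClosure k[X] F)) (hI : I ≠ ⊥) :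
    Finite (integralClosure k[X] F ⧸ I) := by
  obtain ⟨x, hx, hx0⟩ := Submodule.exists_mem_ne_zero_of_ne_bot hI
  have h1 : I.comap (algebraMap k[X] (integralClosure k[X] F)) ≠ ⊥ :=
    Ideal.comap_ne_bot_of_integral_mem hx0 hx (Algebra.IsIntegral.isIntegral x)
  obtain ⟨π, hπ, hπ0⟩ := Submodule.exists_mem_ne_zero_of_ne_bot h1
  have := finite_quot_elt (F := F) π hπ0
  refine Finite.of_surjective (Ideal.Quotient.factor (S := Ideal.span {algebraMap k[X] (integralClosure k[X] F) π}) 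
    (T := I) ?_) (Ideal.Quotient.factor_surjective _)
  rw [Ideal.span_singleton_le_iff_mem]; exact hπ

lemma isNoeth : IsNoetherianRing (integralClosure k[X] F) := by
  rw [isNoetherianRing_iff_ideal_fg]
  intro I
  by_cases hI : I = ⊥
  · rw [hI]; exact Submodule.fg_bot
  obtain ⟨x, hx, hx0⟩ := Submodule.exists_mem_ne_zero_of_ne_bot hI
  have := finite_quot (Ideal.span {x}) (by simpa using hx0)
  have hf : Set.Finite ((Ideal.Quotient.mk (Ideal.span {x})) '' (I : Set _)) := Set.toFinite _
  have : (I.map (Ideal.Quotient.mk (Ideal.span {x}))).FG := by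
    have e : Ideal.span (hf.toFinset : Set _) = I.map (Ideal.Quotient.mk (Ideal.span {x})) := by
      rw [hf.coe_toFinset]; rfl
    exact ⟨_, e⟩
  obtain ⟨s, hs, hs'⟩ := Submodule.fg_def.mp this
  choose! g hg using fun i => Ideal.Quotient.mk_surjective (I := Ideal.span {x}) i
  refine Submodule.fg_def.mpr ⟨insert x (g '' s), (hs.image _).insert _, ?_⟩
  change Ideal.span _ = I
  have hsI : Ideal.span s = I.map (Ideal.Quotient.mk (Ideal.span {x})) := hs'
  apply_fun Ideal.comap (Ideal.Quotient.mk (Ideal.span {x})) at hsI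
  rw [Ideal.comap_map_of_surjective _ Ideal.Quotient.mk_surjective, ← RingHom.ker_eq_comap_bot, Ideal.mk_ker,
    sup_eq_left.mpr ((Ideal.span_singleton_le_iff_mem _).mpr hx)] at hsI
  rw [← hsI]
  have : Ideal.map (Ideal.Quotient.mk (Ideal.span {x})) (Ideal.span (g '' s)) = Ideal.span s := by
    rw [Ideal.map_span, Set.image_image]; simp [hg]
  rw [← this, Ideal.comap_map_of_surjective _ Ideal.Quotient.mk_surjective, ← RingHom.ker_eq_comap_bot, Ideal.mk_ker,
    Ideal.span_insert, sup_comm]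

instance isDed : IsDedekindDomain (integralClosure k[X] F) := by
  have := isNoeth (k := k) (F := F)
  have h2 : Ring.DimensionLEOne (integralClosure k[X] F) := ⟨by
    intro I hI hp
    have := finite_quot I hI
    have := Ideal.Quotient.isDomain I
    exact Ideal.Quotient.maximal_of_isField _ (Finite.isField_of_domain _)⟩
  have : IsFractionRing (integralClosure k[X] F) F := 
    integralClosure.isFractionRing_of_finite_extension (RatFunc k) F
  have : IsIntegrallyClosed (integralClosure k[X] F) := 
    integralClosure.isIntegrallyClosedOfFiniteExtension (RatFunc k)
  have : IsDedekindRing (integralClosure k[X] F) := { }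
  exact { }

instance isFrac : IsFractionRing (integralClosure k[X] F) F := 
    integralClosure.isFractionRing_of_finite_extension (RatFunc k) F

end FFC


set_option linter.unusedSectionVars false

namespace FFC
open Polynomial
variable {k F : Type} [Field k] [Finite k] [Field F] [Algebra k[X] F]

/-- the map from the integral closure to a valuation ring containing `X`. -/
def toV (V : ValuationSubring F) (h : algebraMap k[X] F X ∈ V) : integralClosure k[X] F →+* V :=
  ((integralClosure k[X] F).subtype : integralClosure k[X] F →+* F).codRestrict V.toSubring 
    (fun b => (mem_B_iff (b : F)).mp b.2 V h)

lemma toV_coe (V : ValuationSubring F) (h : algebraMap k[X] F X ∈ V) (b) : (toV V h b : F) = b := rfl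

def center (V : ValuationSubring F) (h : algebraMap k[X] F X ∈ V) : Ideal (integralClosure k[X] F) :=
  (IsLocalRing.maximalIdeal V).comap (toV V h)

instance (V : ValuationSubring F) (h : algebraMap k[X] F X ∈ V) : (center V h).IsPrime := 
  Ideal.IsPrime.comap _

lemma mem_center {V : ValuationSubring F} {h : algebraMap k[X] F X ∈ V} {b : integralClosure k[X] F} :
    b ∈ center V h ↔ (b : F) ∈ V.nonunits := by
  rw [center, Ideal.mem_comap, ← ValuationSubring.coe_mem_nonunits_iff, toV_coe]

lemma notMem_center {V : ValuationSubring F} {h : algebraMap k[X] F X ∈ V} {b : integralClosure k[X] F} :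
    b ∉ center V h ↔ (b : F) ≠ 0 ∧ (b : F)⁻¹ ∈ V := by
  rw [mem_center, ValuationSubring.mem_nonunits_iff_or]; tauto

variable [Algebra (RatFunc k) F] [IsScalarTower k[X] (RatFunc k) F] [FiniteDimensional (RatFunc k) F]

lemma le_of_center {V W : ValuationSubring F} (hV : algebraMap k[X] F X ∈ V) (hW : algebraMap k[X] F X ∈ W)
    (h : center V hV = center W hW) : V ≤ W := by
  intro x hx
  obtain ⟨u, w, e, huw⟩ := prufer (center V hV) x
  by_cases hu : u ∈ center V hV
  · have hw := huw.resolve_left (not_not.mpr hu)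
    exfalso; apply hw
    rw [center, Ideal.mem_comap] at hu ⊢
    have : toV V hV w = toV V hV u * ⟨x, hx⟩ := Subtype.ext e.symm
    rw [this]
    exact Ideal.mul_mem_right _ _ hu
  · rw [h, notMem_center] at hu
    have : x = w * (u : F)⁻¹ := by rw [← e]; field_simp [hu.1]
    rw [this]
    exact W.mul_mem _ _ (toV W hW w).2 hu.2

lemma center_ne_bot {V : ValuationSubring F} (hV : algebraMap k[X] F X ∈ V) (h : V ≠ ⊤) :
    center V hV ≠ ⊥ := by
  intro hc
  apply h
  rw [eq_top_iff]
  intro x _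
  obtain ⟨a, b, hb, rfl⟩ := IsFractionRing.div_surjective (A := integralClosure k[X] F) x
  have hb0 : b ≠ 0 := nonZeroDivisors.ne_zero hb
  rw [div_eq_mul_inv]
  have : b ∉ center V hV := by rw [hc]; simpa using hb0
  rw [notMem_center] at this
  exact V.mul_mem _ _ (toV V hV a).2 this.2

lemma exists_sep (P : FFPrime F) (hP : algebraMap k[X] F X ∈ P.vring) :
    ∃ f : F, f ∉ P.vring ∧ ∀ V : ValuationSubring F, algebraMap k[X] F X ∈ V → V ≠ P.vring → f ∈ V := by
  have h0 := center_ne_bot hP P.vring_ne_top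
  obtain ⟨f, hf1, hf2⟩ := FractionalIdeal.exists_notMem_one_of_ne_bot (K := F) h0 (Ideal.IsPrime.ne_top inferInstance)
  have hmax : (center P.vring hP).IsMaximal := Ideal.IsPrime.isMaximal inferInstance h0
  rw [FractionalIdeal.mem_inv_iff (by simpa using h0)] at hf1
  have key : ∀ V : ValuationSubring F, algebraMap k[X] F X ∈ V → V ≠ P.vring → f ∈ V := by
    intro V hV hne
    have : ¬ center P.vring hP ≤ center V hV := by
      intro hle
      have := hmax.eq_of_le (Ideal.IsPrime.ne_top inferInstance) hle
      exact hne (le_antisymm (le_of_center hV hP this.symm) (le_of_center hP hV this))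
    obtain ⟨u, hu, hu'⟩ := SetLike.not_le_iff_exists.mp this
    have h1 := hf1 (algebraMap _ F u) (by
      exact FractionalIdeal.mem_coeIdeal_of_mem _ hu)
    rw [FractionalIdeal.mem_one_iff] at h1
    obtain ⟨w, hw⟩ := h1
    rw [notMem_center] at hu'
    have : f = w * (u : F)⁻¹ := by
      have hw' : (w : F) = f * u := hw
      rw [hw']; field_simp [hu'.1]
    rw [this]
    exact V.mul_mem _ _ (toV V hV w).2 hu'.2
  refine ⟨f, ?_, key⟩
  intro hfP
  apply hf2
  rw [FractionalIdeal.mem_one_iff]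
  refine ⟨⟨f, ?_⟩, rfl⟩
  rw [mem_B_iff]
  intro V hV
  by_cases h : V = P.vring
  · rwa [h]
  · exact key V hV h

lemma finite_residue (P : FFPrime F) (hP : algebraMap k[X] F X ∈ P.vring) :
    Finite (IsLocalRing.ResidueField P.vring) := by
  have h0 := center_ne_bot hP P.vring_ne_top
  have hmax : (center P.vring hP).IsMaximal := Ideal.IsPrime.isMaximal inferInstance h0
  have := finite_quot _ h0
  let ψ := (IsLocalRing.residue P.vring).comp (toV P.vring hP)
  have hker : ∀ b ∈ center P.vring hP, ψ b = 0 := by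
    intro b hb
    rw [RingHom.comp_apply, IsLocalRing.residue_eq_zero_iff]; exact hb
  refine Finite.of_surjective (Ideal.Quotient.lift _ ψ hker) ?_
  intro y
  obtain ⟨x, rfl⟩ := IsLocalRing.residue_surjective y
  obtain ⟨u, w, e, huw⟩ := prufer (center P.vring hP) (x : F)
  have e' : toV P.vring hP w = toV P.vring hP u * x := Subtype.ext e.symm
  have hu : u ∉ center P.vring hP := by
    intro hu
    have hw := huw.resolve_left (not_not.mpr hu)
    apply hw
    rw [center, Ideal.mem_comap] at hu ⊢
    rw [e']
    exact Ideal.mul_mem_right _ _ hu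
  obtain ⟨u', hu'⟩ := Ideal.Quotient.exists_inv (I := center P.vring hP) 
    (a := Ideal.Quotient.mk _ u) (by rwa [Ne, Ideal.Quotient.eq_zero_iff_mem])
  refine ⟨u' * Ideal.Quotient.mk _ w, ?_⟩
  have h1 := congrArg (Ideal.Quotient.lift _ ψ hker) hu'
  simp only [map_mul, map_one, Ideal.Quotient.lift_mk, ψ, RingHom.comp_apply] at h1 ⊢
  rw [e', map_mul]
  linear_combination (IsLocalRing.residue P.vring x) * h1

end FFC


set_option linter.unusedSectionVars false

namespace FFC
open Polynomial
variable {k F : Type} [Field k] [Finite k] [Field F] [Algebra k[X] F]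

lemma val_poly_le {V : ValuationSubring F} (hV : algebraMap k[X] F X ∉ V) (g : k[X]) :
    V.valuation (algebraMap k[X] F g) ≤ V.valuation (algebraMap k[X] F X) ^ g.natDegree := by
  have h1 : 1 < V.valuation (algebraMap k[X] F X) := by
    rw [← not_le, ValuationSubring.valuation_le_one_iff]; exact hV
  conv_lhs => rw [g.as_sum_range_C_mul_X_pow, map_sum]
  refine Valuation.map_sum_le _ ?_
  intro i hi
  rw [map_mul, map_pow, map_mul, map_pow]
  have h2 : V.valuation (algebraMap k[X] F (C (g.coeff i))) ≤ 1 :=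
    (ValuationSubring.valuation_le_one_iff _ _).mpr (const_mem V _)
  refine (mul_le_of_le_one_left' h2).trans ?_
  exact pow_le_pow_right₀ h1.le (by have := Finset.mem_range.mp hi; omega)

lemma val_poly_eq {V : ValuationSubring F} (hV : algebraMap k[X] F X ∉ V) (g : k[X]) (hg : g ≠ 0) :
    V.valuation (algebraMap k[X] F g) = V.valuation (algebraMap k[X] F X) ^ g.natDegree := by
  have h1 : 1 < V.valuation (algebraMap k[X] F X) := by
    rw [← not_le, ValuationSubring.valuation_le_one_iff]; exact hV
  have hc : V.valuation (algebraMap k[X] F (C g.leadingCoeff)) = 1 := by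
    have a1 := (ValuationSubring.valuation_le_one_iff _ _).mpr (const_mem V g.leadingCoeff)
    have a2 := (ValuationSubring.valuation_le_one_iff _ _).mpr (const_mem V g.leadingCoeff⁻¹)
    have a3 : V.valuation (algebraMap k[X] F (C g.leadingCoeff)) * V.valuation (algebraMap k[X] F (C g.leadingCoeff⁻¹)) = 1 := by
      rw [← map_mul, ← map_mul, ← C_mul, mul_inv_cancel₀ (leadingCoeff_ne_zero.mpr hg)]; simp
    refine le_antisymm a1 ?_
    rw [← a3]
    exact mul_le_of_le_one_right' a2
  have e := eraseLead_add_C_mul_X_pow g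
  have hl : V.valuation (algebraMap k[X] F (C g.leadingCoeff * X ^ g.natDegree)) = 
      V.valuation (algebraMap k[X] F X) ^ g.natDegree := by
    rw [map_mul, map_pow, map_mul, map_pow, hc, one_mul]
  conv_lhs => rw [← e, map_add]
  rw [Valuation.map_add_eq_of_lt_right, hl]
  rw [hl]
  by_cases h0 : g.eraseLead = 0
  · rw [h0, map_zero, map_zero]; exact pow_pos (zero_lt_one.trans h1) _
  refine (val_poly_le hV _).trans_lt ?_
  refine pow_lt_pow_right₀ h1 ?_
  exact eraseLead_natDegree_lt_or_eraseLead_eq_zero g |>.resolve_right h0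

lemma exists_bound (ω : F) (hω : IsIntegral k[X] ω) : ∃ m : ℕ, ∀ V : ValuationSubring F,
    algebraMap k[X] F X ∉ V → V.valuation ω ≤ V.valuation (algebraMap k[X] F X) ^ m := by
  obtain ⟨f, hf, hfx⟩ := hω
  let m := (Finset.range f.natDegree).sup (fun i => (f.coeff i).natDegree)
  refine ⟨m, fun V hV => ?_⟩
  have h1 : 1 < V.valuation (algebraMap k[X] F X) := by
    rw [← not_le, ValuationSubring.valuation_le_one_iff]; exact hV
  by_contra! hc
  have hω1 : 1 < V.valuation ω := lt_of_le_of_lt (one_le_pow₀ h1.le) hc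
  have hω0 : 0 < V.valuation ω := lt_trans zero_lt_one hω1
  rw [eval₂_eq_sum_range, Finset.sum_range_succ, hf.coeff_natDegree, map_one, one_mul] at hfx
  have e : ω ^ f.natDegree = - ∑ i ∈ Finset.range f.natDegree, algebraMap k[X] F (f.coeff i) * ω ^ i := by
    linear_combination hfx
  have h2 : V.valuation (∑ i ∈ Finset.range f.natDegree, algebraMap k[X] F (f.coeff i) * ω ^ i) 
      < V.valuation ω ^ f.natDegree := by
    refine Valuation.map_sum_lt _ (pow_pos hω0 _).ne' ?_
    intro i hi
    rw [map_mul, map_pow]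
    have h3 : V.valuation (algebraMap k[X] F (f.coeff i)) < V.valuation ω := by
      refine lt_of_le_of_lt ((val_poly_le hV _).trans ?_) hc
      exact pow_le_pow_right₀ h1.le (Finset.le_sup (f := fun i => (f.coeff i).natDegree) hi)
    calc _ < V.valuation ω * V.valuation ω ^ i := mul_lt_mul_of_pos_right h3 (pow_pos hω0 _)
      _ = V.valuation ω ^ (i+1) := (pow_succ' _ _).symm
      _ ≤ _ := pow_le_pow_right₀ hω1.le (by have := Finset.mem_range.mp hi; omega)
  have := congrArg V.valuation e
  rw [Valuation.map_neg, map_pow] at this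
  exact absurd this h2.ne'

variable [Algebra (RatFunc k) F] [IsScalarTower k[X] (RatFunc k) F] [FiniteDimensional (RatFunc k) F]

lemma fin_one (ω : F) (hω : IsIntegral k[X] ω) : ∃ s : Finset F, ∀ h : RatFunc k,
    ∃ b ∈ integralClosure k[X] F, ∃ c ∈ s, ∀ V : ValuationSubring F, algebraMap k[X] F X ∉ V →
      algebraMap _ F h * ω - b - c ∈ V := by
  classical
  obtain ⟨m, hm⟩ := exists_bound ω hω
  set τ := algebraMap k[X] F X with hτ
  have hτ0 : τ ≠ 0 := by
    rw [hτ, Ne, map_eq_zero_iff _ (algMap_inj (k := k) (F := F))]; exact X_ne_zero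
  have : Finite (degreeLT k m) := Module.finite_of_finite k
  have hfin : (Set.range fun l : degreeLT k m => algebraMap k[X] F l * (τ ^ m)⁻¹ * ω).Finite := Set.finite_range _
  refine ⟨hfin.toFinset, fun h => ?_⟩
  have hd := h.monic_denom
  set d := h.denom with hdd
  set g' := (X ^ m * h.num) /ₘ d with hg'
  set r := (X ^ m * h.num) %ₘ d with hr
  have e1 : r + d * g' = X ^ m * h.num := modByMonic_add_div (X ^ m * h.num) d
  have hXm : (X ^ m : k[X]).Monic := monic_X_pow m
  set g := g' /ₘ X ^ m with hg
  set l := g' %ₘ X ^ m with hl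
  have e2 : l + X ^ m * g = g' := modByMonic_add_div g' (X ^ m)
  have hl' : l ∈ degreeLT k m := by
    rw [mem_degreeLT]
    have := degree_modByMonic_lt g' hXm
    rwa [degree_X_pow] at this
  have hdF : algebraMap k[X] F d ≠ 0 := by
    rw [Ne, map_eq_zero_iff _ (algMap_inj (k := k) (F := F))]; exact hd.ne_zero
  have eh : algebraMap (RatFunc k) F h = algebraMap k[X] F h.num / algebraMap k[X] F d := by
    conv_lhs => rw [← RatFunc.num_div_denom h]
    rw [map_div₀, ← IsScalarTower.algebraMap_apply, ← IsScalarTower.algebraMap_apply]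
  refine ⟨algebraMap k[X] F g * ω, ?_, _, (hfin.mem_toFinset).mpr ⟨⟨l, hl'⟩, rfl⟩, ?_⟩
  · exact Subalgebra.mul_mem _ (Subalgebra.algebraMap_mem _ g) hω
  intro V hV
  have key : algebraMap _ F h * ω - algebraMap k[X] F g * ω - algebraMap k[X] F l * (τ ^ m)⁻¹ * ω
      = (algebraMap k[X] F r / algebraMap k[X] F d) * (ω / τ ^ m) := by
    rw [eh]
    have e1' := congrArg (algebraMap k[X] F) e1
    rw [← e2] at e1'
    simp only [map_add, map_mul, map_pow] at e1'
    rw [← hτ] at e1'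
    field_simp
    linear_combination (-ω) * e1'
  rw [key]
  have h1 : 1 < V.valuation τ := by
    rw [← not_le, ValuationSubring.valuation_le_one_iff]; exact hV
  refine V.mul_mem _ _ ?_ ?_
  · rw [← ValuationSubring.valuation_le_one_iff, map_div₀, val_poly_eq hV d hd.ne_zero]
    refine div_le_one_of_le₀ ((val_poly_le hV _).trans (pow_le_pow_right₀ h1.le ?_)) zero_le
    exact natDegree_le_natDegree (degree_modByMonic_lt _ hd).le
  · rw [← ValuationSubring.valuation_le_one_iff, map_div₀, map_pow]
    exact div_le_one_of_le₀ (hm V hV) zero_le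

lemma fin_all : ∃ s : Finset F, ∀ z : F,
    ∃ b ∈ integralClosure k[X] F, ∃ c ∈ s, ∀ V : ValuationSubring F, algebraMap k[X] F X ∉ V →
      z - b - c ∈ V := by
  classical
  obtain ⟨n, ⟨e⟩⟩ : ∃ n, Nonempty (Module.Basis (Fin n) (RatFunc k) F) := ⟨_, ⟨Module.finBasis (RatFunc k) F⟩⟩
  have h1 : ∀ i, ∃ s : Finset F, ∀ h : RatFunc k,
    ∃ b ∈ integralClosure k[X] F, ∃ c ∈ s, ∀ V : ValuationSubring F, algebraMap k[X] F X ∉ V →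
      algebraMap _ F h * e i - b - c ∈ V := by
    intro i
    have halg : IsAlgebraic k[X] (e i) :=
      (IsFractionRing.isAlgebraic_iff k[X] (RatFunc k) F).mpr (Algebra.IsAlgebraic.isAlgebraic _)
    obtain ⟨d, hd, hω⟩ := halg.exists_integral_multiple 
    obtain ⟨s, hs⟩ := fin_one _ hω
    refine ⟨s, fun h => ?_⟩
    obtain ⟨b, hb, c, hc, H⟩ := hs (h / algebraMap k[X] (RatFunc k) d)
    refine ⟨b, hb, c, hc, fun V hV => ?_⟩
    have := H V hV
    rw [map_div₀, ← IsScalarTower.algebraMap_apply, Algebra.smul_def] at this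
    have hd0 : algebraMap k[X] F d ≠ 0 := by
      rw [Ne, map_eq_zero_iff _ (algMap_inj (k := k) (F := F))]; exact hd
    convert this using 3
    field_simp
  choose s hs using h1
  refine ⟨(Fintype.piFinset s).image (fun c => ∑ i, c i), fun z => ?_⟩
  choose b hb c hc H using fun i => hs i (e.repr z i)
  refine ⟨∑ i, b i, Subalgebra.sum_mem _ (fun i _ => hb i), ∑ i, c i, ?_, ?_⟩
  · rw [Finset.mem_image]
    exact ⟨c, Fintype.mem_piFinset.mpr hc, rfl⟩
  · intro V hV
    have : z - ∑ i, b i - ∑ i, c i = ∑ i, (algebraMap _ F (e.repr z i) * e i - b i - c i) := by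
      conv_lhs => rw [← e.sum_repr z]
      simp [Finset.sum_sub_distrib, Algebra.smul_def]
    rw [this]
    exact V.toSubring.sum_mem (fun i _ => H i V hV)

end FFC


set_option linter.unusedSectionVars false

namespace FFC
open Polynomial
variable {k F : Type} [Field k] [Finite k] [Field F]

lemma transc_of [Algebra k F] (V : ValuationSubring F) {y : F} (hy : y ∉ V) : Transcendental k y := by
  intro h
  apply hy
  refine mem_of_isIntegral V (R := k) ?_ h.isIntegral
  intro c
  let _ : Algebra k[X] F := ((algebraMap k F).comp (evalRingHom (0:k))).toAlgebra
  have := const_mem V c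
  have e : algebraMap k[X] F (C c) = algebraMap k F c := by
    rw [RingHom.algebraMap_toAlgebra]; simp
  rwa [e] at this

lemma change (φ : RatFunc k →+* F) (hφ : φ.Finite) {y : F}
    (hy : (∃ V : ValuationSubring F, y ∉ V) ∨ ∃ V : ValuationSubring F, y⁻¹ ∉ V) :
    ∃ ψ : RatFunc k →+* F, ψ.Finite ∧ ψ RatFunc.X = y := by
  let _ : Algebra (RatFunc k) F := φ.toAlgebra
  let _ : Algebra k F := (φ.comp (algebraMap k (RatFunc k))).toAlgebra
  have : IsScalarTower k (RatFunc k) F := IsScalarTower.of_algebraMap_eq (fun x => rfl)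
  have : FiniteDimensional (RatFunc k) F := hφ
  have hy' : Transcendental k y := by
    rcases hy with ⟨V, hV⟩ | ⟨V, hV⟩
    · exact transc_of V hV
    · have := transc_of (k := k) V hV
      exact fun h => this h.inv
  have hfin : FiniteDimensional (IntermediateField.adjoin k {y}) F := 
    FunctionField.finiteDimensional_of_adjoin_transcendental hy'
  have hinj : Function.Injective (aeval y : k[X] →ₐ[k] F) := transcendental_iff_injective.mp hy'
  have hnz : nonZeroDivisors k[X] ≤ (nonZeroDivisors F).comap (aeval y : k[X] →ₐ[k] F) := by
    intro p hp
    simp only [Submonoid.mem_comap]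
    exact mem_nonZeroDivisors_of_ne_zero (by
      intro h
      have h' : aeval y p = 0 := h
      have := hinj (h'.trans (map_zero _).symm)
      exact nonZeroDivisors.ne_zero hp this)
  let ψ : RatFunc k →ₐ[k] F := RatFunc.liftAlgHom (aeval y) hnz
  have hX : ψ RatFunc.X = y := by
    have : ψ (algebraMap k[X] (RatFunc k) X) = aeval y (X : k[X]) := by
      have := RatFunc.liftAlgHom_apply_div (aeval y) hnz (X : k[X]) 1
      simp only [map_one, div_one] at this
      exact this
    simpa using this
  refine ⟨ψ.toRingHom, ?_, hX⟩
  have hle : IntermediateField.adjoin k {y} ≤ ψ.fieldRange := by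
    rw [IntermediateField.adjoin_simple_le_iff]
    exact ⟨_, hX⟩
  let _ : Algebra (RatFunc k) F := ψ.toRingHom.toAlgebra
  change Module.Finite (RatFunc k) F
  obtain ⟨⟨s, hs⟩⟩ := hfin
  refine ⟨⟨s, ?_⟩⟩
  rw [eq_top_iff] at hs ⊢
  intro x hx
  have := hs (Submodule.mem_top : x ∈ _)
  clear hx
  induction this using Submodule.span_induction with
  | mem x h => exact Submodule.subset_span h
  | zero => exact zero_mem _
  | add x y _ _ h1 h2 => exact add_mem h1 h2
  | smul a x _ h1 => 
    obtain ⟨r, hr⟩ := hle a.2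
    have : a • x = (r : RatFunc k) • x := by
      change (a : F) * x = ψ r * x
      have hr' : ψ r = a := hr
      rw [hr']
    rw [this]
    exact Submodule.smul_mem _ _ h1

/-- an element whose only pole is `P`, and finiteness of the residue field. -/
theorem exists_t (φ : RatFunc k →+* F) (hφ : φ.Finite) (P : FFPrime F) :
    Finite (IsLocalRing.ResidueField P.vring) ∧ ∃ ψ : RatFunc k →+* F, ψ.Finite ∧ 
      ∀ V : ValuationSubring F, ψ RatFunc.X ∉ V ↔ V = P.vring := by
  obtain ⟨φ, hφ, hP⟩ : ∃ φ : RatFunc k →+* F, φ.Finite ∧ φ RatFunc.X ∈ P.vring := by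
    by_cases h : φ RatFunc.X ∈ P.vring
    · exact ⟨φ, hφ, h⟩
    · obtain ⟨ψ, h1, h2⟩ := change φ hφ (y := (φ RatFunc.X)⁻¹) (Or.inr ⟨P.vring, by rwa [inv_inv]⟩)
      refine ⟨ψ, h1, ?_⟩
      rw [h2]
      exact (P.vring.mem_or_inv_mem _).resolve_left h
  let _ : Algebra (RatFunc k) F := φ.toAlgebra
  let _ : Algebra k[X] F := (φ.comp (algebraMap k[X] (RatFunc k))).toAlgebra
  have : IsScalarTower k[X] (RatFunc k) F := IsScalarTower.of_algebraMap_eq (fun x => rfl)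
  have : FiniteDimensional (RatFunc k) F := hφ
  have hX : algebraMap k[X] F X = φ RatFunc.X := by
    change φ (algebraMap k[X] (RatFunc k) X) = _
    rw [RatFunc.algebraMap_X]
  have hP' : algebraMap k[X] F X ∈ P.vring := by rw [hX]; exact hP
  refine ⟨finite_residue P hP', ?_⟩
  obtain ⟨f, hf, hfV⟩ := exists_sep P hP'
  obtain ⟨s, hs⟩ := fin_all (k := k) (F := F)
  choose b hb c hc H using fun i : ℕ => hs (f ^ i)
  obtain ⟨i, j, hij, e⟩ : ∃ i j : ℕ, i < j ∧ c i = c j := by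
    have : Finite s := inferInstance
    obtain ⟨i, j, hne, h⟩ := Finite.exists_ne_map_eq_of_infinite (fun i : ℕ => (⟨c i, hc i⟩ : s))
    have h' : c i = c j := congrArg Subtype.val h
    rcases lt_or_gt_of_ne hne with h1 | h1
    · exact ⟨i, j, h1, h'⟩
    · exact ⟨j, i, h1, h'.symm⟩
  have hf0 : f ≠ 0 := by rintro rfl; exact hf (P.vring.zero_mem)
  rw [FFPrime.mem_vring'] at hf
  push Not at hf
  let t := (f ^ j - b j - c j) - (f ^ i - b i - c i)
  have ht : t = f ^ j - f ^ i - (b j - b i) := by simp only [t, e]; ring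
  have htV : ∀ V : ValuationSubring F, V ≠ P.vring → t ∈ V := by
    intro V hV
    by_cases hX : algebraMap k[X] F X ∈ V
    · have hfm := hfV V hX hV
      rw [ht]
      have hbV : ∀ i, b i ∈ V := fun i => (mem_B_iff _).mp (hb i) V hX
      exact V.toSubring.sub_mem (V.toSubring.sub_mem (pow_mem hfm j) (pow_mem hfm i)) 
        (V.toSubring.sub_mem (hbV j) (hbV i))
    · exact V.toSubring.sub_mem (H j V hX) (H i V hX)
  have htP : t ∉ P.vring := by
    intro h
    have hbP : b j - b i ∈ P.vring := P.vring.toSubring.sub_mem ((mem_B_iff _).mp (hb j) _ hP') ((mem_B_iff _).mp (hb i) _ hP')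
    have h1 : f ^ j - f ^ i ∈ P.vring := by
      have : f ^ j - f ^ i = t + (b j - b i) := by rw [ht]; ring
      rw [this]; exact P.vring.add_mem _ _ h hbP
    have h2 := P.o_add_eq (x := f ^ j) (y := - f ^ i) (pow_ne_zero _ hf0) (by
      right
      rw [FFPrime.o_neg, P.o_pow hf0, P.o_pow hf0]
      have : (i : ℤ) < j := by exact_mod_cast hij
      nlinarith [hf.2])
    rw [← sub_eq_add_neg] at h2
    rw [FFPrime.mem_vring', h2.2, P.o_pow hf0] at h1
    have := h1.resolve_left h2.1
    have hj : (0:ℤ) < j := by exact_mod_cast (by omega : 0 < j)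
    nlinarith [hf.2]
  obtain ⟨ψ, h1, h2⟩ := change φ hφ (y := t) (Or.inl ⟨_, htP⟩)
  refine ⟨ψ, h1, fun V => ⟨fun h => ?_, ?_⟩⟩
  · rw [h2] at h
    by_contra hne
    exact h (htV V hne)
  · rintro rfl
    rwa [h2]

end FFC


set_option linter.unusedSectionVars false

/-- `O` is the ring of functions with poles only at `P`. -/
structure Arith (O : Type) {F : Type} [CommRing O] [IsDedekindDomain O] [Field F] [Algebra O F] 
    [IsFractionRing O F] (P : FFPrime F) : Prop where
  finq : ∀ I : Ideal O, I ≠ ⊥ → Finite (O ⧸ I)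
  h1 : ∃ m0 : ℤ, ∀ z : F, ∃ x : O, ((-m0 : ℤ) : WithTop ℤ) ≤ P.ord (z - algebraMap O F x)
  v0 : ∀ x : O, 0 < P.ord (algebraMap O F x) → x = 0
  res : Finite (IsLocalRing.ResidueField P.vring)
  exP : ∃ x : O, P.ord (algebraMap O F x) < 0

namespace FFC
open Polynomial
variable {k F : Type} [Field k] [Finite k] [Field F] [Algebra k[X] F]

lemma isIntegral_of_forall {R : Type} [CommRing R] [Algebra R F] {x : F}
    (h : ∀ V : ValuationSubring F, (∀ r, algebraMap R F r ∈ V) → x ∈ V) : IsIntegral R x := by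
  have h1 : x ∈ (⨅ V : {V : ValuationSubring F // ((algebraMap R F).range : Set F) ⊆ V.toSubring}, V.1.toSubring) := by
    rw [Subring.mem_iInf]
    rintro ⟨V, hV⟩
    exact h V (fun r => hV ⟨r, rfl⟩)
  rw [iInf_valuationSubring_superset] at h1
  have h2 : IsIntegral (Subring.closure ((algebraMap R F).range : Set F)) x := h1
  obtain ⟨f, hf, hfx⟩ := h2
  have : f ∈ lifts ((algebraMap R F).codRestrict (Subring.closure ((algebraMap R F).range : Set F))
      (fun r => Subring.subset_closure ⟨r, rfl⟩)) := by
    rw [lifts_iff_coeff_lifts]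
    intro n
    obtain ⟨y, hy⟩ : (f.coeff n : F) ∈ (algebraMap R F).range := by
      have h3 := Subring.closure_eq (algebraMap R F).range
      exact h3.le (f.coeff n).2
    exact ⟨y, Subtype.ext hy⟩
  obtain ⟨g, hg, -, hgm⟩ := lifts_and_natDegree_eq_and_monic this hf
  refine ⟨g, hgm, ?_⟩
  rw [← hg, eval₂_map] at hfx
  exact hfx

variable [Algebra (RatFunc k) F] [IsScalarTower k[X] (RatFunc k) F] [FiniteDimensional (RatFunc k) F]

theorem arith (P : FFPrime F) (hP : ∀ V : ValuationSubring F, algebraMap k[X] F X ∉ V ↔ V = P.vring)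
    (hres : Finite (IsLocalRing.ResidueField P.vring)) : Arith (integralClosure k[X] F) P where
  finq := finite_quot
  h1 := by
    classical
    obtain ⟨s, hs⟩ := fin_all (k := k) (F := F)
    refine ⟨∑ c ∈ s, |P.o c|, fun z => ?_⟩
    obtain ⟨b, hb, c, hc, H⟩ := hs z
    have h1 := H P.vring ((hP _).mpr rfl)
    refine ⟨⟨b, hb⟩, ?_⟩
    change _ ≤ P.ord (z - b)
    have hle : |P.o c| ≤ ∑ c ∈ s, |P.o c| := Finset.single_le_sum (f := fun c => |P.o c|) (fun i _ => abs_nonneg _) hc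
    have hn : 0 ≤ ∑ c ∈ s, |P.o c| := Finset.sum_nonneg (fun i _ => abs_nonneg _)
    have e : z - b = (z - b - c) + c := by ring
    rw [e]
    refine le_trans ?_ (P.ord_add _ _)
    refine le_min ?_ ?_
    · rw [FFPrime.mem_vring] at h1
      refine le_trans ?_ h1
      exact_mod_cast (by omega : -∑ c ∈ s, |P.o c| ≤ 0)
    · by_cases hc0 : c = 0
      · rw [hc0, P.ord_zero]; exact le_top
      · rw [P.ord_eq hc0]
        have := neg_abs_le (P.o c)
        exact_mod_cast (by omega)
  v0 := by
    intro x hx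
    by_contra hx0
    have hx0' : (x : F) ≠ 0 := by simpa using hx0
    let _ : Algebra k F := ((algebraMap k[X] F).comp C).toAlgebra
    have hIntg : IsIntegral k (x : F) := by
      refine isIntegral_of_forall (fun V _ => ?_)
      by_cases h : V = P.vring
      · rw [h, FFPrime.mem_vring]; exact hx.le
      · rw [← hP, not_not] at h
        exact (mem_B_iff _).mp x.2 V h
    have hIntg' := hIntg.inv
    have := mem_of_isIntegral P.vring (R := k) (fun c => const_mem P.vring c) hIntg'
    rw [FFPrime.mem_vring', FFPrime.o_inv] at this
    have h2 := P.ord_pos_iff.mp hx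
    have h3 : 0 < P.o (x : F) := h2.resolve_left hx0'
    have := this.resolve_left (inv_ne_zero hx0')
    omega
  res := hres
  exP := by
    have h := (hP P.vring).mpr rfl
    rw [FFPrime.mem_vring, not_le] at h
    exact ⟨algebraMap k[X] _ X, h⟩

end FFC


set_option linter.unusedSectionVars false

namespace Arith
variable {O F : Type} [CommRing O] [IsDedekindDomain O] [Field F] [Algebra O F] 
    [IsFractionRing O F] {P : FFPrime F}

lemma inj : Function.Injective (algebraMap O F) := IsFractionRing.injective O F

variable (O P) in
/-- functions with a pole of order at most `m`. -/
def V (m : ℤ) : AddSubgroup O where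
  carrier := {x | ((-m : ℤ) : WithTop ℤ) ≤ P.ord (algebraMap O F x)}
  add_mem' {x y} hx hy := by
    change ((-m : ℤ) : WithTop ℤ) ≤ P.ord (algebraMap O F _)
    rw [map_add]; exact (le_min hx hy).trans (P.ord_add _ _)
  zero_mem' := by
    change ((-m : ℤ) : WithTop ℤ) ≤ P.ord (algebraMap O F _)
    rw [map_zero, P.ord_zero]; exact le_top
  neg_mem' {x} hx := by
    change ((-m : ℤ) : WithTop ℤ) ≤ P.ord (algebraMap O F _)
    rw [map_neg, P.ord_neg]; exact hx

lemma mem_V {m : ℤ} {x : O} : x ∈ V O P m ↔ ((-m : ℤ) : WithTop ℤ) ≤ P.ord (algebraMap O F x) := Iff.rfl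

lemma mem_V' {m : ℤ} {x : O} : x ∈ V O P m ↔ x = 0 ∨ -m ≤ P.o (algebraMap O F x) := by
  rw [mem_V]
  by_cases hx : x = 0
  · simp [hx, P.ord_zero]
  · have : algebraMap O F x ≠ 0 := by simpa [map_eq_zero_iff _ (inj (O := O) (F := F))] using hx
    rw [P.ord_eq this, WithTop.coe_le_coe]; simp [hx]

lemma V_mono {m m' : ℤ} (h : m ≤ m') : V O P m ≤ V O P m' := by
  intro x hx
  rw [mem_V'] at hx ⊢
  rcases hx with h | h
  · exact Or.inl h
  · right; omega

/-- leading coefficient -/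
lemma exists_lead (P : FFPrime F) (m : ℤ) : ∃ ℓ : V O P m →+ IsLocalRing.ResidueField P.vring, 
    (∀ x, ℓ x = 0 ↔ (x : O) ∈ V O P (m - 1)) ∧
    ((∀ z : F, ∃ x : O, ((-(m-1) : ℤ) : WithTop ℤ) ≤ P.ord (z - algebraMap O F x)) → Function.Surjective ℓ) := by
  obtain ⟨π, h0, h1⟩ := P.exists_unif
  have hz0 : π ^ m ≠ 0 := zpow_ne_zero _ h0
  have hmem : ∀ x : V O P m, algebraMap O F x * π ^ m ∈ P.vring := by
    intro x
    rw [FFPrime.mem_vring']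
    rcases mem_V'.mp x.2 with h | h
    · simp [h]
    · by_cases hx : algebraMap O F x = 0
      · simp [hx]
      right
      rw [P.o_mul hx hz0, P.o_zpow h0, h1]; linarith
  let ℓ : V O P m →+ IsLocalRing.ResidueField P.vring := 
    (IsLocalRing.residue P.vring).toAddMonoidHom.comp
    { toFun := fun x => ⟨algebraMap O F x * π ^ m, hmem x⟩
      map_zero' := by ext; simp
      map_add' := by intro x y; ext; simp [add_mul] }
  have hℓ : ∀ x, ℓ x = IsLocalRing.residue P.vring ⟨algebraMap O F x * π ^ m, hmem x⟩ := fun x => rfl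
  have hzero : ∀ z : P.vring, IsLocalRing.residue P.vring z = 0 ↔ 0 < P.ord (z : F) := by
    intro z
    rw [IsLocalRing.residue_eq_zero_iff, ← ValuationSubring.coe_mem_nonunits_iff, FFPrime.mem_nonunits_iff_ord]
  refine ⟨ℓ, ?_, ?_⟩
  · intro x
    rw [hℓ, hzero, P.ord_pos_iff, mem_V', ]
    by_cases hx : (x : O) = 0
    · simp [hx]
    have hx' : algebraMap O F x ≠ 0 := by simpa [map_eq_zero_iff _ (inj (O := O) (F := F))] using hx
    rw [P.o_mul hx' hz0, P.o_zpow h0, h1]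
    simp only [hx, mul_eq_zero, hx', hz0, or_self, false_or]
    constructor <;> intro h <;> linarith
  · intro H y
    obtain ⟨y, rfl⟩ := IsLocalRing.residue_surjective y
    obtain ⟨x, hx⟩ := H ((y : F) * (π ^ m)⁻¹)
    have hy : ((-m : ℤ) : WithTop ℤ) ≤ P.ord ((y : F) * (π ^ m)⁻¹) := by
      by_cases hy0 : (y : F) = 0
      · simp [hy0, P.ord_zero]
      have := (FFPrime.mem_vring' _).mp y.2
      rw [P.ord_eq (mul_ne_zero hy0 (inv_ne_zero hz0)), P.o_mul hy0 (inv_ne_zero hz0), P.o_inv, P.o_zpow h0, h1]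
      have := this.resolve_left hy0
      exact_mod_cast (by linarith)
    have hxV : x ∈ V O P m := by
      rw [mem_V]
      have e : algebraMap O F x = (y : F) * (π ^ m)⁻¹ + -((y : F) * (π ^ m)⁻¹ - algebraMap O F x) := by ring
      rw [e]
      refine le_trans (le_min hy ?_) (P.ord_add _ _)
      rw [P.ord_neg]
      refine le_trans ?_ hx
      exact_mod_cast (by linarith)
    refine ⟨⟨x, hxV⟩, ?_⟩
    rw [hℓ, ← sub_eq_zero, ← map_sub, hzero]
    have e : (((⟨algebraMap O F x * π ^ m, hmem ⟨x, hxV⟩⟩ : P.vring) - y : P.vring) : F) = 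
        -((y : F) * (π ^ m)⁻¹ - algebraMap O F x) * π ^ m := by
      simp only [AddSubgroupClass.coe_sub]; field_simp; ring
    rw [e, neg_mul, P.ord_neg]
    rw [P.ord_mul, P.ord_eq hz0, P.o_zpow h0, h1]
    by_cases hc : (y : F) * (π ^ m)⁻¹ - algebraMap O F x = 0
    · rw [hc, P.ord_zero]; simp
    rw [P.ord_eq hc] at hx ⊢
    have hx' : (-(m-1) : ℤ) ≤ P.o ((y : F) * (π ^ m)⁻¹ - algebraMap O F x) := by exact_mod_cast hx
    have : (0 : ℤ) < P.o ((y : F) * (π ^ m)⁻¹ - algebraMap O F x) + m * 1 := by linarith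
    exact_mod_cast this

variable (A : Arith O P)
include A

lemma V_neg {m : ℤ} (hm : m < 0) : V O P m = ⊥ := by
  rw [eq_bot_iff]
  intro x hx
  apply A.v0
  rw [P.ord_pos_iff]
  rcases mem_V'.mp hx with h | h
  · left; simp [h]
  · right; omega

lemma finite_V (m : ℤ) : Finite (V O P m) := by
  have := A.res
  by_cases hm : m < 0
  · rw [A.V_neg hm]; infer_instance
  push Not at hm
  lift m to ℕ using hm
  have key : ∀ m : ℤ, Finite (V O P (m - 1)) → Finite (V O P m) := by
    intro m hf
    obtain ⟨ℓ, h1, -⟩ := exists_lead (O := O) P m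
    rw [← Set.finite_univ_iff]
    refine Set.Finite.of_finite_fibers ℓ (Set.toFinite _) (fun y _ => ?_)
    rw [Set.univ_inter]
    change Finite _
    by_cases h : ∃ x, ℓ x = y
    · obtain ⟨x0, rfl⟩ := h
      have : ∀ x, x ∈ ℓ ⁻¹' {ℓ x0} → (x : O) - x0 ∈ V O P (m - 1) := by
        intro x hx
        have := (h1 (x - x0)).mp (by rw [map_sub, sub_eq_zero]; exact hx)
        exact this
      refine Finite.of_injective (fun x : ℓ ⁻¹' {ℓ x0} => (⟨_, this x x.2⟩ : V O P (m - 1))) ?_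
      intro x y hxy
      have := congrArg Subtype.val hxy
      simp only [sub_left_inj] at this
      exact Subtype.ext (Subtype.ext this)
    · have : ℓ ⁻¹' {y} = ∅ := by
        ext x; simp; exact fun hx => h ⟨x, hx⟩
      rw [this]; exact Set.finite_empty
  induction m with
  | zero => apply key; rw [A.V_neg (by simp)]; infer_instance
  | succ n ih => apply key; simpa using ih

/-- size of residue field -/
lemma one_lt_r : 1 < Nat.card (IsLocalRing.ResidueField P.vring) := by
  have := A.res
  exact Finite.one_lt_card

lemma card_step : ∃ m0 : ℕ, (∀ z : F, ∃ x : O, ((-(m0 : ℤ) : ℤ) : WithTop ℤ) ≤ P.ord (z - algebraMap O F x)) ∧ 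
    ∀ j : ℕ, Nat.card (V O P (m0 + j)) = Nat.card (V O P m0) * 
      Nat.card (IsLocalRing.ResidueField P.vring) ^ j := by
  have := A.res
  obtain ⟨m0, hm0⟩ := A.h1
  have hm1 : ∀ m : ℤ, (m0.toNat : ℤ) ≤ m → ∀ z : F, ∃ x : O, ((-m : ℤ) : WithTop ℤ) ≤ P.ord (z - algebraMap O F x) := by
    intro m hm z
    obtain ⟨x, hx⟩ := hm0 z
    refine ⟨x, le_trans ?_ hx⟩
    have := Int.self_le_toNat m0
    exact_mod_cast (by omega)
  refine ⟨m0.toNat, hm1 _ le_rfl, fun j => ?_⟩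
  induction j with
  | zero => simp
  | succ j ih =>
    rw [pow_succ, ← mul_assoc, ← ih]
    set m : ℤ := (m0.toNat : ℤ) + ((j + 1 : ℕ) : ℤ)
    have hmm : (m0.toNat : ℤ) + (j : ℤ) = m - 1 := by simp only [m]; push_cast; ring
    obtain ⟨ℓ, h1, h2⟩ := exists_lead (O := O) P m
    have hs := h2 (hm1 _ (by omega))
    have := A.finite_V m
    rw [hmm]
    rw [AddSubgroup.card_eq_card_quotient_mul_card_addSubgroup ℓ.ker,
      Nat.card_congr (QuotientAddGroup.quotientKerEquivOfSurjective ℓ hs).toEquiv, mul_comm]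
    congr 1
    have hker : ℓ.ker = (V O P (m-1)).addSubgroupOf (V O P m) := by
      ext x; rw [AddMonoidHom.mem_ker, h1, AddSubgroup.mem_addSubgroupOf]
    rw [hker]
    exact Nat.card_congr (AddSubgroup.addSubgroupOfEquivOfLe (V_mono (by omega))).toEquiv

lemma V_top (f : O) (hf : f ≠ 0) (m0 : ℕ) (h : ∀ z : F, ∃ x : O, ((-(m0 : ℤ) : ℤ) : WithTop ℤ) ≤ P.ord (z - algebraMap O F x))
    (x : O) : ∃ y : O, x - f * y ∈ V O P (m0 - P.o (algebraMap O F f)) := by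
  have hf' : algebraMap O F f ≠ 0 := by simpa [map_eq_zero_iff _ (inj (O := O) (F := F))] using hf
  obtain ⟨y, hy⟩ := h (algebraMap O F x / algebraMap O F f)
  refine ⟨y, ?_⟩
  rw [mem_V']
  by_cases h0 : x - f * y = 0
  · exact Or.inl h0
  right
  have h0' : algebraMap O F (x - f * y) ≠ 0 := by rw [Ne, map_eq_zero_iff _ (inj (O := O) (F := F))]; exact h0
  have e : algebraMap O F (x - f * y) = algebraMap O F f * (algebraMap O F x / algebraMap O F f - algebraMap O F y) := by
    rw [map_sub, map_mul]; field_simp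
  rw [e] at h0' ⊢
  have h2 := right_ne_zero_of_mul h0'
  rw [P.ord_eq h2] at hy
  have hy' : -(m0 : ℤ) ≤ P.o (algebraMap O F x / algebraMap O F f - algebraMap O F y) := by exact_mod_cast hy
  rw [P.o_mul hf' h2]; linarith

lemma o_nonpos (f : O) (hf : f ≠ 0) : P.o (algebraMap O F f) ≤ 0 := by
  by_contra! h
  exact hf (A.v0 f (P.ord_pos_iff.mpr (Or.inr h)))

/-- ideals have the expected density -/
lemma card_V_inf (I : Ideal O) (hI : I ≠ ⊥) : ∃ mI : ℕ, ∀ m : ℤ, mI ≤ m → 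
    Nat.card (V O P m) = Nat.card (O ⧸ I) * Nat.card (V O P m ⊓ I.toAddSubgroup : AddSubgroup O) := by
  obtain ⟨m0, h1, -⟩ := A.card_step
  obtain ⟨f, hf, hf0⟩ := Submodule.exists_mem_ne_zero_of_ne_bot hI
  have ho := A.o_nonpos f hf0
  refine ⟨(m0 - P.o (algebraMap O F f)).toNat, fun m hm => ?_⟩
  have hm' : m0 - P.o (algebraMap O F f) ≤ m := by have := Int.self_le_toNat (m0 - P.o (algebraMap O F f)); omega
  let ρ : V O P m →+ O ⧸ I := (Ideal.Quotient.mk I).toAddMonoidHom.comp (V O P m).subtype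
  have hs : Function.Surjective ρ := by
    intro x
    obtain ⟨x, rfl⟩ := Ideal.Quotient.mk_surjective x
    obtain ⟨y, hy⟩ := A.V_top f hf0 m0 h1 x
    refine ⟨⟨_, V_mono hm' hy⟩, ?_⟩
    change Ideal.Quotient.mk I (x - f * y) = _
    rw [Ideal.Quotient.mk_eq_mk_iff_sub_mem]
    simpa using I.mul_mem_right y hf
  rw [AddSubgroup.card_eq_card_quotient_mul_card_addSubgroup ρ.ker,
      Nat.card_congr (QuotientAddGroup.quotientKerEquivOfSurjective ρ hs).toEquiv]
  congr 1
  have hker : ρ.ker = (V O P m ⊓ I.toAddSubgroup).addSubgroupOf (V O P m) := by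
    ext x; rw [AddMonoidHom.mem_ker, AddSubgroup.mem_addSubgroupOf]
    change Ideal.Quotient.mk I x = 0 ↔ _
    rw [Ideal.Quotient.eq_zero_iff_mem, AddSubgroup.mem_inf]
    exact ⟨fun h => ⟨x.2, h⟩, fun h => h.2⟩
  rw [hker]
  exact Nat.card_congr (AddSubgroup.addSubgroupOfEquivOfLe inf_le_left).toEquiv

/-- product formula -/
lemma card_quot_span (f : O) (hf : f ≠ 0) : Nat.card (O ⧸ Ideal.span {f}) = 
    Nat.card (IsLocalRing.ResidueField P.vring) ^ (- P.o (algebraMap O F f)).toNat := by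
  obtain ⟨m0, h1, h2⟩ := A.card_step
  obtain ⟨mI, h3⟩ := A.card_V_inf (Ideal.span {f}) (by simpa using hf)
  have ho := A.o_nonpos f hf
  have hf' : algebraMap O F f ≠ 0 := by simpa [map_eq_zero_iff _ (inj (O := O) (F := F))] using hf
  set d := (- P.o (algebraMap O F f)).toNat with hd
  have hd' : (d : ℤ) = - P.o (algebraMap O F f) := by rw [hd, Int.toNat_of_nonneg (by omega)]
  have e1 := h3 (m0 + (mI + d : ℕ)) (by push_cast; omega)
  rw [h2] at e1
  have e2 : Nat.card (V O P (m0 + (mI + d : ℕ)) ⊓ (Ideal.span {f}).toAddSubgroup : AddSubgroup O) = Nat.card (V O P (m0 + mI)) := by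
    symm
    refine Nat.card_congr (Equiv.ofBijective (fun x => ⟨f * x, ?_⟩) ⟨?_, ?_⟩)
    · rw [AddSubgroup.mem_inf]
      refine ⟨?_, Ideal.mul_mem_right _ _ (Ideal.mem_span_singleton_self f)⟩
      rw [mem_V']
      by_cases hx : (x : O) = 0
      · simp [hx]
      have hx' : algebraMap O F x ≠ 0 := by simpa [map_eq_zero_iff _ (inj (O := O) (F := F))] using hx
      right
      have := (mem_V'.mp x.2).resolve_left hx
      rw [map_mul, P.o_mul hf' hx']; push_cast; omega
    · intro x y hxy
      have := congrArg Subtype.val hxy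
      exact Subtype.ext (mul_left_cancel₀ hf this)
    · rintro ⟨y, hy⟩
      rw [AddSubgroup.mem_inf] at hy
      obtain ⟨x, hx⟩ := Ideal.mem_span_singleton'.mp hy.2
      refine ⟨⟨x, ?_⟩, Subtype.ext ((mul_comm _ _).trans hx)⟩
      rw [mem_V']
      by_cases hx0 : x = 0
      · exact Or.inl hx0
      have hx' : algebraMap O F x ≠ 0 := by simpa [map_eq_zero_iff _ (inj (O := O) (F := F))] using hx0
      right
      have h4 := (mem_V'.mp hy.1)
      rw [← hx] at h4
      have := h4.resolve_left (mul_ne_zero hx0 hf)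
      rw [map_mul, P.o_mul hx' hf'] at this
      push_cast at this; omega
  rw [e2, h2, pow_add] at e1
  have := A.finite_V m0
  have c1 : 0 < Nat.card (V O P m0) := Nat.card_pos
  have c2 := A.one_lt_r
  have c3 : 0 < Nat.card (V O P m0) * Nat.card (IsLocalRing.ResidueField P.vring) ^ mI := by positivity
  apply Nat.eq_of_mul_eq_mul_right c3
  rw [← e1]; ring

end Arith


set_option linter.unusedSectionVars false

namespace DV
open IsDedekindDomain
variable {O F : Type} [CommRing O] [IsDedekindDomain O] [Field F] [Algebra O F] 
    [IsFractionRing O F]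

lemma inj : Function.Injective (algebraMap O F) := IsFractionRing.injective O F
lemma alg_ne {f : O} (hf : f ≠ 0) : algebraMap O F f ≠ 0 := by
  rw [Ne, map_eq_zero_iff _ (inj (O := O) (F := F))]; exact hf

/-- order of `x` at a prime of `O` -/
def nu (v : HeightOneSpectrum O) (x : F) : ℤ := -WithZero.log (v.valuation F x)

variable (v : HeightOneSpectrum O)
lemma nu_zero : nu v (0 : F) = 0 := by simp [nu]
lemma nu_one : nu v (1 : F) = 0 := by simp [nu]
lemma nu_mul {x y : F} (hx : x ≠ 0) (hy : y ≠ 0) : nu v (x * y) = nu v x + nu v y := by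
  simp only [nu, map_mul]
  rw [WithZero.log_mul (by simpa using hx) (by simpa using hy)]; ring
lemma nu_inv (x : F) : nu v x⁻¹ = - nu v x := by
  simp [nu, map_inv₀, WithZero.log_inv]
lemma nu_pow (x : F) (n : ℕ) : nu v (x ^ n) = n * nu v x := by
  simp [nu, map_pow, WithZero.log_pow]
lemma nu_div {x y : F} (hx : x ≠ 0) (hy : y ≠ 0) : nu v (x / y) = nu v x - nu v y := by
  rw [div_eq_mul_inv, nu_mul v hx (inv_ne_zero hy), nu_inv]; ring
lemma nu_nonneg_iff (x : F) : 0 ≤ nu v x ↔ v.valuation F x ≤ 1 := by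
  by_cases hx : x = 0
  · simp [hx, nu_zero]
  rw [nu, le_neg, neg_zero, WithZero.log_le_iff_le_exp (by simpa using hx)]; simp
lemma nu_alg_nonneg (f : O) : 0 ≤ nu v (algebraMap O F f) := by
  rw [nu_nonneg_iff]; exact v.valuation_le_one f
lemma le_nu_alg_iff {f : O} (hf : f ≠ 0) (n : ℕ) : (n : ℤ) ≤ nu v (algebraMap O F f) ↔ f ∈ v.asIdeal ^ n := by
  rw [nu, le_neg, WithZero.log_le_iff_le_exp (by rw [Valuation.ne_zero_iff]; exact alg_ne hf), HeightOneSpectrum.valuation_of_algebraMap,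
    HeightOneSpectrum.intValuation_le_pow_iff_mem]
lemma nu_pos_iff {x : F} (hx : x ≠ 0) : 0 < nu v x ↔ v.valuation F x < 1 := by
  rw [nu, lt_neg, neg_zero, WithZero.log_lt_iff_lt_exp (by simpa using hx)]; simp
lemma exists_nu_eq_one : ∃ x : F, x ≠ 0 ∧ nu v x = 1 := by
  obtain ⟨π, h⟩ := v.valuation_exists_uniformizer F
  refine ⟨π, ?_, ?_⟩
  · rintro rfl; rw [map_zero] at h; exact absurd h.symm WithZero.exp_ne_zero
  · rw [nu, h]; simp

lemma nu_fin (x : F) : {v : HeightOneSpectrum O | nu v x ≠ 0}.Finite := by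
  refine ((HeightOneSpectrum.Support.finite O x).union (HeightOneSpectrum.Support.finite O x⁻¹)).subset ?_
  intro v hv
  by_contra h
  rw [Set.mem_union, not_or] at h
  have h1 : v.valuation F x ≤ 1 := not_lt.mp h.1
  have h2 : v.valuation F x⁻¹ ≤ 1 := not_lt.mp h.2
  rw [← nu_nonneg_iff] at h1 h2
  rw [nu_inv] at h2
  exact hv (by omega)

variable (O) in
/-- divisor away from the missing place -/
def dv (x : F) : HeightOneSpectrum O →₀ ℤ := 
  Finsupp.onFinset (nu_fin x).toFinset (fun v => nu v x) (fun v hv => by simpa using hv)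

@[simp] lemma dv_apply (x : F) : dv O x v = nu v x := rfl
lemma dv_mul {x y : F} (hx : x ≠ 0) (hy : y ≠ 0) : dv O (x * y) = dv O x + dv O y := by
  ext v; simp [nu_mul v hx hy]

variable (O F) in
/-- divisor homomorphism -/
def dvh : Additive Fˣ →+ (HeightOneSpectrum O →₀ ℤ) where
  toFun x := dv O ((Additive.toMul x : Fˣ) : F)
  map_zero' := by ext v; simp [nu_one]
  map_add' x y := by
    rw [toMul_add, Units.val_mul, dv_mul (Units.ne_zero _) (Units.ne_zero _)]

lemma dvh_apply (x : Additive Fˣ) : dvh O F x = dv O ((Additive.toMul x : Fˣ) : F) := rfl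

lemma exists_alg {x : F} (h : ∀ v : HeightOneSpectrum O, 0 ≤ nu v x) : ∃ f : O, algebraMap O F f = x := by
  simp only [nu_nonneg_iff] at h
  exact HeightOneSpectrum.mem_integers_of_valuation_le_one F x h

/-- ideal of an effective divisor -/
def EI (D : HeightOneSpectrum O →₀ ℕ) : Ideal O := D.prod (fun v n => v.asIdeal ^ n)

lemma EI_ne_bot (D : HeightOneSpectrum O →₀ ℕ) : EI D ≠ ⊥ := by
  rw [EI, Finsupp.prod, ← Ideal.zero_eq_bot, Finset.prod_ne_zero_iff]
  intro v _
  exact pow_ne_zero _ v.ne_bot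

lemma mem_EI {D : HeightOneSpectrum O →₀ ℕ} {f : O} (hf : f ≠ 0) : 
    f ∈ EI D ↔ ∀ v, (D v : ℤ) ≤ nu v (algebraMap O F f) := by
  classical
  rw [EI, Finsupp.prod, ← IsDedekindDomain.inf_pow_eq_prod_of_prime D.support (fun v => v.asIdeal) D
    (fun v _ => v.prime) (fun v _ w _ h h' => h (HeightOneSpectrum.ext h'))]
  rw [Submodule.mem_finsetInf]
  constructor
  · intro h v
    by_cases hv : v ∈ D.support
    · rw [le_nu_alg_iff v hf]; exact h v hv
    · rw [Finsupp.notMem_support_iff.mp hv]; exact nu_alg_nonneg v f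
  · intro h v _
    rw [← le_nu_alg_iff (F := F) v hf]; exact h v

/-- norm of a prime -/
def Nq (v : HeightOneSpectrum O) : ℕ := Nat.card (O ⧸ v.asIdeal)

/-- norm of an effective divisor -/
def NN (D : HeightOneSpectrum O →₀ ℕ) : ℕ := D.prod (fun v n => Nq v ^ n)

lemma NN_add (D E : HeightOneSpectrum O →₀ ℕ) : NN (D + E) = NN D * NN E := by
  classical
  exact Finsupp.prod_add_index' (by simp) (by intros; rw [pow_add])

lemma card_EI (D : HeightOneSpectrum O →₀ ℕ) : Nat.card (O ⧸ EI D) = NN D := by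
  classical
  have key : ∀ s : Finset (HeightOneSpectrum O), Submodule.cardQuot (∏ v ∈ s, v.asIdeal ^ D v : Ideal O) = ∏ v ∈ s, Nq v ^ D v := by
    intro s
    induction s using Finset.induction_on with
    | empty => simp
    | insert v s hv ih =>
      rw [Finset.prod_insert hv, Finset.prod_insert hv, cardQuot_mul_of_coprime, ih]
      · have := v.isPrime
        rw [cardQuot_pow_of_prime v.ne_bot]; rfl
      · apply IsCoprime.prod_right
        intro w hw
        exact HeightOneSpectrum.isCoprime_pow_of_ne _ _ (by rintro rfl; exact hv hw) _ _
  exact key D.support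

variable (F) in
/-- effective divisor of an integral element -/
def dvn (f : O) : HeightOneSpectrum O →₀ ℕ := (dv O (algebraMap O F f)).mapRange Int.toNat rfl

lemma dvn_apply (f : O) : (dvn F f v : ℤ) = nu v (algebraMap O F f) := by
  simp [dvn, nu_alg_nonneg v f]

lemma EI_dvn {f : O} (hf : f ≠ 0) : EI (dvn F f) = Ideal.span {f} := by
  ext g
  by_cases hg : g = 0
  · simp [hg]
  rw [mem_EI (F := F) hg, Ideal.mem_span_singleton']
  simp only [dvn_apply]
  constructor
  · intro h
    obtain ⟨a, ha⟩ := exists_alg (O := O) (x := algebraMap O F g / algebraMap O F f) (fun v => by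
      rw [nu_div v (alg_ne hg) (alg_ne hf)]; linarith [h v])
    refine ⟨a, inj (F := F) ?_⟩
    rw [map_mul, ha, div_mul_cancel₀ _ (alg_ne hf)]
  · rintro ⟨a, rfl⟩ v
    have ha : a ≠ 0 := left_ne_zero_of_mul hg
    rw [map_mul, nu_mul v (alg_ne ha) (alg_ne hf)]
    linarith [nu_alg_nonneg (F := F) v a]

variable {P : FFPrime F} (A : Arith O P)
include A

/-- product formula -/
lemma NN_dvn {f : O} (hf : f ≠ 0) : (NN (dvn F f) : ℕ) = 
    Nat.card (IsLocalRing.ResidueField P.vring) ^ (- P.o (algebraMap O F f)).toNat := by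
  rw [← card_EI, EI_dvn hf, A.card_quot_span f hf]

lemma two_le_Nq (v : HeightOneSpectrum O) : 2 ≤ Nq v := by
  have := A.finq v.asIdeal v.ne_bot
  have := v.isPrime
  exact Finite.one_lt_card

lemma NN_pos (D : HeightOneSpectrum O →₀ ℕ) : 0 < NN D := 
  Finset.prod_pos (fun v _ => pow_pos (by have := two_le_Nq A v; omega) _)

/-- finitely many primes of bounded norm -/
lemma fin_Nq (B : ℕ) : {v : HeightOneSpectrum O | Nq v ≤ B}.Finite := by
  obtain ⟨t, ht⟩ := A.exP
  have ht0 : algebraMap O F t ≠ 0 := by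
    intro h; rw [h, P.ord_zero] at ht; simp at ht
  have ht' : P.o (algebraMap O F t) < 0 := by
    rw [P.ord_eq ht0] at ht; exact_mod_cast ht
  have key : ∀ M : ℕ, {v : HeightOneSpectrum O | Nq v = M}.Finite := by
    intro M
    by_cases hM : M < 2
    · convert Set.finite_empty
      ext v; simp only [Set.mem_ofPred_eq, Set.mem_empty_iff_false, iff_false]
      have := two_le_Nq A v; omega
    have hne : t ^ M - t ≠ 0 := by
      intro h
      rw [sub_eq_zero] at h
      have h1 := congrArg (fun x => P.o (algebraMap O F x)) h
      simp only [map_pow, P.o_pow ht0] at h1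
      have : (2 : ℤ) ≤ M := by exact_mod_cast (by omega : 2 ≤ M)
      nlinarith
    refine (nu_fin (O := O) (algebraMap O F (t ^ M - t))).subset ?_
    intro v hv
    have hv' : Nq v = M := hv
    have h1 : t ^ M - t ∈ v.asIdeal ^ 1 := by
      rw [pow_one, ← Ideal.Quotient.eq_zero_iff_mem, map_sub, map_pow, sub_eq_zero]
      have := A.finq v.asIdeal v.ne_bot
      have := v.isMaximal
      let _ := Ideal.Quotient.field v.asIdeal
      have := Fintype.ofFinite (O ⧸ v.asIdeal)
      rw [← hv', Nq, Nat.card_eq_fintype_card, FiniteField.pow_card]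
    rw [← le_nu_alg_iff (F := F) v hne] at h1
    change nu v _ ≠ 0
    intro h; rw [h] at h1; simp at h1
  refine (Set.Finite.biUnion (Set.finite_Iic B) (fun M _ => key M)).subset ?_
  intro v hv
  simp only [Set.mem_iUnion]
  exact ⟨Nq v, hv, rfl⟩

lemma fin_NN (B : ℕ) : {D : HeightOneSpectrum O →₀ ℕ | NN D ≤ B}.Finite := by
  classical
  have hle : ∀ D : HeightOneSpectrum O →₀ ℕ, NN D ≤ B → ∀ v, v ∈ D.support → Nq v ≤ B ∧ D v ≤ B := by
    intro D hD v hv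
    have h1 : Nq v ^ D v ≤ NN D := by
      apply Nat.le_of_dvd (NN_pos A D)
      exact Finset.dvd_prod_of_mem (fun v => Nq v ^ D v) hv
    have h2 := two_le_Nq A v
    have h3 : D v ≠ 0 := Finsupp.mem_support_iff.mp hv
    constructor
    · calc Nq v = Nq v ^ 1 := (pow_one _).symm
        _ ≤ Nq v ^ D v := Nat.pow_le_pow_right (by omega) (by omega)
        _ ≤ B := h1.trans hD
    · have : D v < Nq v ^ D v := Nat.lt_pow_self (by omega)
      omega
  refine (Set.Finite.subset (Finset.finite_toSet ((fin_Nq A B).toFinset.finsupp (fun _ => Finset.range (B + 1)))) ?_)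
  intro D hD
  rw [Finset.mem_coe, Finset.mem_finsupp_iff]
  refine ⟨fun v hv => ?_, fun v hv => ?_⟩
  · rw [Set.Finite.mem_toFinset]; exact (hle D hD v hv).1
  · rw [Finset.mem_range]
    by_cases hv' : v ∈ D.support
    · have := (hle D hD v hv').2; omega
    · rw [Finsupp.notMem_support_iff.mp hv']; omega

end DV


set_option linter.unusedSectionVars false

lemma zeta_aux {T : Type} (N : T → ℕ) (hN : ∀ D, 0 < N D) (jj : T → ℕ) (NE ρ : ℕ) (hNE : 0 < NE) (hρ : 2 ≤ ρ)
    (h : ∀ D, N D * NE = ρ ^ jj D) (hfin : ∀ j, Finite {D // jj D = j}) (α : ℝ) (hα : 0 ≤ α) (J0 : ℕ)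
    (hJ0 : ∀ j, J0 ≤ j → (Nat.card {D // jj D = j} : ℝ) * NE = α * ρ ^ j) :
    ∃ B : ℝ, ∀ s : ℝ, 1 < s → s ≤ 2 → Summable (fun D => (N D : ℝ) ^ (-s)) ∧ 
      |∑' D, (N D : ℝ) ^ (-s) - α / (1 - (ρ : ℝ) ^ (1 - s))| ≤ B := by
  set A : ℕ → ℝ := fun j => (Nat.card {D // jj D = j} : ℝ) with hA
  set J := J0 + NE with hJdef
  have hJ : ∀ j, J ≤ j → A j * NE = α * ρ ^ j := fun j hj => hJ0 j (by omega)
  have hNEJ : (NE : ℝ) ≤ (ρ : ℝ) ^ J := by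
    have h1 : NE < ρ ^ NE := Nat.lt_pow_self (by omega)
    have h2 : ρ ^ NE ≤ ρ ^ J := Nat.pow_le_pow_right (by omega) (by omega)
    exact_mod_cast (h1.le.trans h2)
  have hρ0 : (0 : ℝ) < ρ := by exact_mod_cast (by omega : 0 < ρ)
  have hρ1 : (1 : ℝ) < ρ := by exact_mod_cast (by omega : 1 < ρ)
  have hNE0 : (0 : ℝ) < NE := by exact_mod_cast hNE
  refine ⟨∑ j ∈ Finset.range J, A j + α * J, fun s hs hs2 => ?_⟩
  set y : ℝ := (ρ : ℝ) ^ (1 - s) with hy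
  have hy0 : 0 < y := Real.rpow_pos_of_pos hρ0 _
  have hy1 : y < 1 := Real.rpow_lt_one_of_one_lt_of_neg hρ1 (by linarith)
  set g : ℕ → ℝ := fun j => ((ρ : ℝ) ^ j / NE) ^ (-s) with hg
  have hNg : ∀ D, (N D : ℝ) ^ (-s) = g (jj D) := by
    intro D
    have : (N D : ℝ) = (ρ : ℝ) ^ jj D / NE := by
      rw [eq_div_iff hNE0.ne']; exact_mod_cast h D
    rw [this]
  have hpow : ∀ j : ℕ, ((ρ : ℝ) ^ j) ^ (1 - s) = y ^ j := by
    intro j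
    rw [hy, ← Real.rpow_natCast, ← Real.rpow_natCast, ← Real.rpow_mul hρ0.le, ← Real.rpow_mul hρ0.le, mul_comm]
  -- tail terms
  have htail : ∀ j, J ≤ j → A j * g j = α * ((NE : ℝ) ^ (s - 1) * y ^ j) := by
    intro j hj
    have e1 : A j = α * ((ρ : ℝ) ^ j / NE) := by
      rw [mul_div_assoc', eq_div_iff hNE0.ne']; exact hJ j hj
    have hq : 0 < (ρ : ℝ) ^ j / NE := by positivity
    have e2 : ((ρ : ℝ) ^ j / NE) * g j = ((ρ : ℝ) ^ j / NE) ^ (1 - s) := by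
      rw [hg, sub_eq_add_neg, Real.rpow_add hq, Real.rpow_one]
    rw [e1, mul_assoc, e2, Real.div_rpow (by positivity) hNE0.le, hpow, div_eq_mul_inv, ← Real.rpow_neg hNE0.le, neg_sub,
      mul_comm ((NE : ℝ) ^ (s - 1))]
  set u : ℝ := (NE : ℝ) ^ (s - 1) * y ^ J with hu
  have hshift : HasSum (fun j => A (j + J) * g (j + J)) (α * (u * (1 - y)⁻¹)) := by
    have h1 := ((hasSum_geometric_of_lt_one hy0.le hy1).mul_left u).mul_left α
    refine h1.congr_fun ?_
    intro j
    rw [htail _ (by omega), hu, pow_add]; ring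
  have hsum : HasSum (fun j => A j * g j) (∑ j ∈ Finset.range J, A j * g j + α * (u * (1 - y)⁻¹)) := by
    rw [add_comm]
    exact (hasSum_nat_add_iff J).mp (by simpa using hshift)
  have hfib : ∀ j, (∑' D : {D // jj D = j}, (N D : ℝ) ^ (-s)) = A j * g j := by
    intro j
    have := hfin j
    have : ∀ D : {D // jj D = j}, (N D : ℝ) ^ (-s) = g j := by
      rintro ⟨D, hD⟩; rw [hNg, hD]
    simp_rw [this]
    rw [tsum_const, nsmul_eq_mul]
  let e := Equiv.sigmaFiberEquiv jj
  have hsig : Summable ((fun D => (N D : ℝ) ^ (-s)) ∘ e) := by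
    refine (summable_sigma_of_nonneg (f := (fun D => (N D : ℝ) ^ (-s)) ∘ e) (fun x => Real.rpow_nonneg (Nat.cast_nonneg _) _)).mpr ⟨fun j => ?_, ?_⟩
    · have := hfin j
      have := Fintype.ofFinite {D // jj D = j}
      exact (hasSum_fintype _).summable
    · have : (fun j => ∑' D : {D // jj D = j}, ((fun D => (N D : ℝ) ^ (-s)) ∘ e) ⟨j, D⟩) = fun j => A j * g j := by
        funext j; exact hfib j
      rw [this]; exact hsum.summable
  have hS := (Equiv.summable_iff e).mp hsig
  refine ⟨hS, ?_⟩
  have hval : ∑' D, (N D : ℝ) ^ (-s) = ∑ j ∈ Finset.range J, A j * g j + α * (u * (1 - y)⁻¹) := by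
    rw [← Equiv.tsum_eq e, ← hsum.tsum_eq]
    exact hsig.tsum_sigma.trans (tsum_congr hfib)
  rw [hval]
  have hu1 : u ≤ 1 := by
    rw [hu, ← hpow, ← neg_sub s 1, Real.rpow_neg (by positivity), ← div_eq_mul_inv, div_le_one (by positivity)]
    exact Real.rpow_le_rpow hNE0.le hNEJ (by linarith)
  have hu0 : y ^ J ≤ u := by
    rw [hu]
    have : 1 ≤ (NE : ℝ) ^ (s - 1) := Real.one_le_rpow (by exact_mod_cast hNE) (by linarith)
    nlinarith [pow_pos hy0 J]
  have hbern : 1 - J * (1 - y) ≤ y ^ J := by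
    have := one_add_mul_le_pow (a := y - 1) (by linarith) J
    simp only [add_sub_cancel] at this
    linarith
  have hd : 0 < 1 - y := by linarith
  have hA0 : ∀ j, 0 ≤ A j := fun j => Nat.cast_nonneg _
  have hfirst : ∀ j, A j * g j ≤ A j := by
    intro j
    by_cases hj : Nonempty {D // jj D = j}
    · obtain ⟨D, hD⟩ := hj
      have : g j ≤ 1 := by
        rw [← hD, ← hNg]
        exact Real.rpow_le_one_of_one_le_of_nonpos (by exact_mod_cast hN D) (by linarith)
      nlinarith [hA0 j]
    · have : A j = 0 := by
        simp only [hA]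
        rw [not_nonempty_iff] at hj
        simp
      simp [this]
  have hf1 : ∑ j ∈ Finset.range J, A j * g j ≤ ∑ j ∈ Finset.range J, A j := Finset.sum_le_sum (fun j _ => hfirst j)
  have hf0 : 0 ≤ ∑ j ∈ Finset.range J, A j * g j := Finset.sum_nonneg (fun j _ => mul_nonneg (hA0 j) (Real.rpow_nonneg (by positivity) _))
  have hm : α * (u * (1 - y)⁻¹) - α / (1 - y) = - (α * ((1 - u) / (1 - y))) := by
    field_simp; ring
  have hm1 : (1 - u) / (1 - y) ≤ J := by
    rw [div_le_iff₀ hd]; linarith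
  have hm0 : 0 ≤ (1 - u) / (1 - y) := div_nonneg (by linarith) hd.le
  rw [add_sub_assoc, hm, abs_le]
  have : 0 ≤ α * ((1 - u) / (1 - y)) := by positivity
  have : α * ((1 - u) / (1 - y)) ≤ α * J := by gcongr
  constructor <;> linarith

lemma G_bounds {ρ : ℝ} (hρ : 1 < ρ) {s : ℝ} (hs : 1 < s) (hs2 : s ≤ 2) : 
    (ρ - 1)⁻¹ / (s - 1) ≤ 1 / (1 - ρ ^ (1 - s)) ∧ 1 / (1 - ρ ^ (1 - s)) ≤ (1 - ρ⁻¹)⁻¹ / (s - 1) := by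
  have hρ0 : 0 < ρ := by linarith
  have ht : 0 < s - 1 := by linarith
  have hi : ρ⁻¹ < 1 := inv_lt_one_of_one_lt₀ hρ
  have h1 : ρ ^ (s - 1) ≤ 1 + (s - 1) * (ρ - 1) := by
    have := rpow_one_add_le_one_add_mul_self (s := ρ - 1) (p := s - 1) (by linarith) ht.le (by linarith)
    simpa using this
  have h2 : (ρ⁻¹) ^ (s - 1) ≤ 1 + (s - 1) * (ρ⁻¹ - 1) := by
    have := rpow_one_add_le_one_add_mul_self (s := ρ⁻¹ - 1) (p := s - 1) (by have := inv_pos.mpr hρ0; linarith) ht.le (by linarith)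
    simpa using this
  have e : ρ ^ (1 - s) = (ρ ^ (s - 1))⁻¹ := by rw [← Real.rpow_neg hρ0.le, neg_sub]
  have e2 : ρ ^ (1 - s) = (ρ⁻¹) ^ (s - 1) := by rw [e, Real.inv_rpow hρ0.le]
  have hp : 0 < ρ ^ (s - 1) := Real.rpow_pos_of_pos hρ0 _
  have hd : 0 < 1 - ρ ^ (1 - s) := by
    rw [e2]; nlinarith
  constructor
  · rw [div_le_div_iff₀ ht hd, one_mul]
    have : 1 - ρ ^ (1 - s) ≤ (s - 1) * (ρ - 1) := by
      rw [e]
      have h3 : (1 + (s - 1) * (ρ - 1))⁻¹ ≤ (ρ ^ (s - 1))⁻¹ := inv_anti₀ hp h1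
      have h4 : 1 - (s - 1) * (ρ - 1) ≤ (1 + (s - 1) * (ρ - 1))⁻¹ := by
        have : 0 < 1 + (s - 1) * (ρ - 1) := by nlinarith
        rw [← one_div, le_div_iff₀ this]; nlinarith [sq_nonneg ((s - 1) * (ρ - 1))]
      linarith
    rw [inv_mul_le_iff₀ (by linarith)]; linarith
  · rw [div_le_div_iff₀ hd ht, one_mul]
    rw [e2, inv_mul_eq_div, le_div_iff₀ (by linarith)]
    nlinarith


set_option linter.unusedSectionVars false

namespace DV
open IsDedekindDomain
variable {O F : Type} [CommRing O] [IsDedekindDomain O] [Field F] [Algebra O F] 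
    [IsFractionRing O F]

/-- elements of order divisible by `n` at `P` -/
def F1 (P : FFPrime F) (n : ℕ) : AddSubgroup (Additive Fˣ) where
  carrier := {x | (n : ℤ) ∣ P.o ((Additive.toMul x : Fˣ) : F)}
  add_mem' {x y} hx hy := by
    change (n : ℤ) ∣ P.o _
    rw [toMul_add, Units.val_mul, P.o_mul (Units.ne_zero _) (Units.ne_zero _)]
    exact dvd_add hx hy
  zero_mem' := by
    change (n : ℤ) ∣ P.o _
    simp [P.o_one]
  neg_mem' {x} hx := by
    change (n : ℤ) ∣ P.o _
    rw [toMul_neg, Units.val_inv_eq_inv_val, P.o_inv]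
    exact (dvd_neg).mpr hx

lemma mem_F1 {P : FFPrime F} {n : ℕ} {x : Additive Fˣ} : x ∈ F1 P n ↔ (n : ℤ) ∣ P.o ((Additive.toMul x : Fˣ) : F) := Iff.rfl

variable (O) in
/-- principal divisors of order divisible by `n` -/
def Hn (P : FFPrime F) (n : ℕ) : AddSubgroup (HeightOneSpectrum O →₀ ℤ) := (F1 P n).map (dvh O F)

lemma mem_Hn {P : FFPrime F} {n : ℕ} {D : HeightOneSpectrum O →₀ ℤ} : 
    D ∈ Hn O P n ↔ ∃ x : F, x ≠ 0 ∧ (n : ℤ) ∣ P.o x ∧ dv O x = D := by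
  constructor
  · rintro ⟨x, hx, rfl⟩
    exact ⟨_, Units.ne_zero _, hx, rfl⟩
  · rintro ⟨x, h0, hx, rfl⟩
    exact ⟨Additive.ofMul (Units.mk0 x h0), hx, rfl⟩

/-- effective divisors as divisors -/
def cD : (HeightOneSpectrum O →₀ ℕ) →+ (HeightOneSpectrum O →₀ ℤ) := 
  Finsupp.mapRange.addMonoidHom (Nat.castAddMonoidHom ℤ)

lemma cD_apply (D : HeightOneSpectrum O →₀ ℕ) (v) : cD D v = (D v : ℤ) := rfl

variable (O) in
/-- class group -/
abbrev Cn (P : FFPrime F) (n : ℕ) := (HeightOneSpectrum O →₀ ℤ) ⧸ Hn O P n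

/-- class of an effective divisor -/
def cl (P : FFPrime F) (n : ℕ) (D : HeightOneSpectrum O →₀ ℕ) : Cn O P n := (cD D : HeightOneSpectrum O →₀ ℤ)

lemma cD_dvn (f : O) : cD (dvn F f) = dv O (algebraMap O F f) := by
  ext v; rw [cD_apply, dvn_apply]; rfl

lemma exists_E (P : FFPrime F) (n : ℕ) (hn : 0 < n) (c : Cn O P n) : ∃ E : HeightOneSpectrum O →₀ ℕ, 
    c = - cl P n E := by
  obtain ⟨D, rfl⟩ := QuotientAddGroup.mk_surjective c
  let D' : HeightOneSpectrum O →₀ ℕ := D.mapRange Int.toNat rfl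
  obtain ⟨g, hg, hg0⟩ := Submodule.exists_mem_ne_zero_of_ne_bot (EI_ne_bot D')
  have hg' := (mem_EI (F := F) hg0).mp hg
  let X := dv O (algebraMap O F (g ^ n)) - D
  have hX : ∀ v, 0 ≤ X v := by
    intro v
    have h1 : nu v (algebraMap O F (g ^ n)) = n * nu v (algebraMap O F g) := by rw [map_pow, nu_pow]
    have h2 := hg' v
    have h3 : D v ≤ (D' v : ℤ) := Int.self_le_toNat (D v)
    have h4 := nu_alg_nonneg (F := F) v g
    have h5 : (1 : ℤ) ≤ n := by exact_mod_cast hn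
    change 0 ≤ dv O (algebraMap O F (g ^ n)) v - D v
    rw [dv_apply, h1]; nlinarith
  refine ⟨X.mapRange Int.toNat rfl, ?_⟩
  have hXc : cD (X.mapRange Int.toNat rfl) = X := by
    ext v; rw [cD_apply, Finsupp.mapRange_apply, Int.toNat_of_nonneg (hX v)]
  rw [cl, hXc, ← QuotientAddGroup.mk_neg, QuotientAddGroup.eq]
  rw [mem_Hn]
  refine ⟨(algebraMap O F (g ^ n))⁻¹, inv_ne_zero (alg_ne (pow_ne_zero _ hg0)), ?_, ?_⟩
  · rw [P.o_inv, map_pow, P.o_pow (alg_ne hg0)]; exact (dvd_neg).mpr (dvd_mul_right _ _)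
  · ext v; simp [X, nu_inv]; ring

variable {P : FFPrime F} (A : Arith O P)

lemma o_unit (A : Arith O P) (u : Oˣ) : P.o (algebraMap O F u) = 0 := by
  have h1 := A.o_nonpos (u : O) u.ne_zero
  have h2 := A.o_nonpos ((u⁻¹ : Oˣ) : O) (u⁻¹).ne_zero
  have h3 : P.o (algebraMap O F u * algebraMap O F ((u⁻¹ : Oˣ) : O)) = 0 := by
    rw [← map_mul, Units.mul_inv, map_one, P.o_one]
  rw [P.o_mul (alg_ne u.ne_zero) (alg_ne (u⁻¹).ne_zero)] at h3
  omega

lemma fin_units (A : Arith O P) : Finite Oˣ := by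
  have := A.finite_V 0
  refine Finite.of_injective (fun u : Oˣ => (⟨(u : O), ?_⟩ : Arith.V O P 0)) ?_
  · rw [Arith.mem_V', o_unit A]; right; simp
  · intro u v h
    exact Units.ext (congrArg Subtype.val h)

/-- exact pole order `m` in the ideal `I`. -/
lemma card_exact (A : Arith O P) (I : Ideal O) (m : ℤ) : 
    Nat.card (Arith.V O P m ⊓ I.toAddSubgroup : AddSubgroup O) = 
    Nat.card (Arith.V O P (m - 1) ⊓ I.toAddSubgroup : AddSubgroup O) + Nat.card {f : O // f ≠ 0 ∧ f ∈ I ∧ P.o (algebraMap O F f) = -m} := by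
  classical
  have := A.finite_V m
  have := A.finite_V (m - 1)
  have hs : ((Arith.V O P m ⊓ I.toAddSubgroup : AddSubgroup O) : Set O) = 
    ((Arith.V O P (m - 1) ⊓ I.toAddSubgroup : AddSubgroup O) : Set O) ∪ {f : O | f ≠ 0 ∧ f ∈ I ∧ P.o (algebraMap O F f) = -m} := by
    ext f
    simp only [SetLike.mem_coe, AddSubgroup.mem_inf, Arith.mem_V', Set.mem_union, Set.mem_ofPred_eq, Submodule.mem_toAddSubgroup]
    by_cases hf : f = 0
    · simp [hf]
    · simp only [hf, false_or, not_false_eq_true, true_and, ne_eq]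
      by_cases hI : f ∈ I
      · simp only [hI, and_true, true_and]; omega
      · simp [hI]
  have hfin : ((Arith.V O P m ⊓ I.toAddSubgroup : AddSubgroup O) : Set O).Finite := by
    refine Set.Finite.subset (s := (Arith.V O P m : Set O)) (Set.toFinite _) ?_
    intro x hx; exact hx.1
  have hdis : Disjoint ((Arith.V O P (m - 1) ⊓ I.toAddSubgroup : AddSubgroup O) : Set O) {f : O | f ≠ 0 ∧ f ∈ I ∧ P.o (algebraMap O F f) = -m} := by
    rw [Set.disjoint_left]
    rintro f ⟨h1, -⟩ ⟨h2, -, h3⟩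
    have := (Arith.mem_V'.mp h1).resolve_left h2
    omega
  have := Set.ncard_union_eq hdis (hfin.subset (by rw [hs]; exact Set.subset_union_left)) (hfin.subset (by rw [hs]; exact Set.subset_union_right))
  rw [← hs] at this
  exact this

lemma card_class (A : Arith O P) (n : ℕ) (E : HeightOneSpectrum O →₀ ℕ) (j : ℕ) : 
    Nat.card {f : O // f ≠ 0 ∧ f ∈ EI E ∧ P.o (algebraMap O F f) = -((n * j : ℕ) : ℤ)} = 
    Nat.card {D : HeightOneSpectrum O →₀ ℕ // cl P n D = - cl P n E ∧ 
      NN D * NN E = Nat.card (IsLocalRing.ResidueField P.vring) ^ (n * j)} * Nat.card Oˣ := by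
  set r := Nat.card (IsLocalRing.ResidueField P.vring) with hr
  have hr1 : 1 < r := A.one_lt_r
  have hex : ∀ D : {D : HeightOneSpectrum O →₀ ℕ // cl P n D = - cl P n E ∧ NN D * NN E = r ^ (n * j)}, 
      ∃ f : {f : O // f ≠ 0 ∧ f ∈ EI E ∧ P.o (algebraMap O F f) = -((n * j : ℕ) : ℤ)}, dvn F f.1 = D.1 + E := by
    rintro ⟨D, h1, h2⟩
    rw [cl, cl, ← QuotientAddGroup.mk_neg, eq_comm, QuotientAddGroup.eq, mem_Hn] at h1
    obtain ⟨x, hx0, hx1, hx2⟩ := h1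
    rw [neg_neg] at hx2
    have hx3 : ∀ v, nu v x = (D v : ℤ) + E v := by
      intro v; rw [← dv_apply, hx2, Finsupp.add_apply, cD_apply, cD_apply, add_comm]
    obtain ⟨f, rfl⟩ := exists_alg (O := O) (x := x) (fun v => by rw [hx3]; positivity)
    have hf0 : f ≠ 0 := by rintro rfl; simp at hx0
    have hd : dvn F f = D + E := by
      ext v
      have := hx3 v
      rw [← dvn_apply] at this
      rw [Finsupp.add_apply]; exact_mod_cast this
    refine ⟨⟨f, hf0, ?_, ?_⟩, hd⟩
    · rw [mem_EI (F := F) hf0]; intro v; rw [hx3]; linarith [Nat.cast_nonneg (α := ℤ) (D v)]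
    · have h3 := NN_dvn A hf0
      rw [hd, NN_add, h2] at h3
      have h4 := Nat.pow_right_injective hr1 h3
      have h5 := A.o_nonpos f hf0
      have h6 : ((-P.o (algebraMap O F f)).toNat : ℤ) = -P.o (algebraMap O F f) := Int.toNat_of_nonneg (by omega)
      rw [← h4] at h6; omega
  choose φ hφ using hex
  rw [← Nat.card_prod]
  symm
  refine Nat.card_congr (Equiv.ofBijective (fun x => ⟨(φ x.1).1 * x.2, ?_, ?_, ?_⟩) ⟨?_, ?_⟩)
  · exact mul_ne_zero (φ x.1).2.1 (Units.ne_zero _)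
  · exact Ideal.mul_mem_right _ _ (φ x.1).2.2.1
  · rw [map_mul, P.o_mul (alg_ne (φ x.1).2.1) (alg_ne (Units.ne_zero _)), o_unit A, (φ x.1).2.2.2, add_zero]
  · rintro ⟨D, u⟩ ⟨D', u'⟩ h
    have h : (φ D).1 * (u : O) = (φ D').1 * (u' : O) := congrArg Subtype.val h
    have hun : ∀ (v : HeightOneSpectrum O) (u : Oˣ), nu v (algebraMap O F u) = 0 := by
      intro v u
      have h1 := nu_alg_nonneg (F := F) v u
      have h2 := nu_alg_nonneg (F := F) v ((u⁻¹ : Oˣ) : O)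
      have h3 : nu v (algebraMap O F u * algebraMap O F ((u⁻¹ : Oˣ) : O)) = 0 := by
        rw [← map_mul, Units.mul_inv, map_one, nu_one]
      rw [nu_mul v (alg_ne u.ne_zero) (alg_ne (u⁻¹).ne_zero)] at h3
      omega
    have hDD : D = D' := by
      apply Subtype.ext
      have : dvn F (φ D).1 = dvn F (φ D').1 := by
        ext v
        have h1 := congrArg (fun z => nu v (algebraMap O F z)) h
        simp only [map_mul] at h1
        rw [nu_mul v (alg_ne (φ D).2.1) (alg_ne u.ne_zero), nu_mul v (alg_ne (φ D').2.1) (alg_ne u'.ne_zero), hun, hun, add_zero, add_zero,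
          ← dvn_apply, ← dvn_apply] at h1
        exact_mod_cast h1
      rw [hφ, hφ] at this
      exact add_right_cancel this
    subst hDD
    have := mul_left_cancel₀ (φ D).2.1 h
    rw [Units.ext this]
  · rintro ⟨f, hf0, hf1, hf2⟩
    have hle := (mem_EI (F := F) hf0).mp hf1
    have hle' : E ≤ dvn F f := by
      intro v; have := hle v; rw [← dvn_apply] at this; exact_mod_cast this
    let D : {D : HeightOneSpectrum O →₀ ℕ // cl P n D = - cl P n E ∧ NN D * NN E = r ^ (n * j)} := by
      refine ⟨dvn F f - E, ?_, ?_⟩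
      · rw [cl, cl, ← QuotientAddGroup.mk_neg, eq_comm, QuotientAddGroup.eq, neg_neg, ← map_add, add_tsub_cancel_of_le hle', cD_dvn, mem_Hn]
        exact ⟨_, alg_ne hf0, by rw [hf2, dvd_neg]; push_cast; exact dvd_mul_right _ _, rfl⟩
      · rw [← NN_add, tsub_add_cancel_of_le hle', NN_dvn A hf0, hf2, neg_neg, Int.toNat_natCast]
    have hD : dvn F (φ D).1 = dvn F f := by rw [hφ]; exact tsub_add_cancel_of_le hle'
    have hsp : Ideal.span {(φ D).1} = Ideal.span {f} := by
      rw [← EI_dvn (F := F) (φ D).2.1, ← EI_dvn (F := F) hf0, hD]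
    obtain ⟨u, hu⟩ := Ideal.span_singleton_eq_span_singleton.mp hsp
    exact ⟨(D, u), Subtype.ext hu⟩

end DV


set_option linter.unusedSectionVars false

namespace DV
open IsDedekindDomain
variable {O F : Type} [CommRing O] [IsDedekindDomain O] [Field F] [Algebra O F] 
    [IsFractionRing O F] {P : FFPrime F}

theorem class_zeta (A : Arith O P) (n : ℕ) (hn : 0 < n) : ∃ α : ℝ, 0 < α ∧ ∀ c : Cn O P n, ∃ B : ℝ, ∀ s : ℝ, 1 < s → s ≤ 2 → 
    Summable (fun D : {D : HeightOneSpectrum O →₀ ℕ // cl P n D = c} => (NN D.1 : ℝ) ^ (-s)) ∧ 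
    |∑' D : {D : HeightOneSpectrum O →₀ ℕ // cl P n D = c}, (NN D.1 : ℝ) ^ (-s) - 
      α / (1 - ((Nat.card (IsLocalRing.ResidueField P.vring) ^ n : ℕ) : ℝ) ^ (1 - s))| ≤ B := by
  set r := Nat.card (IsLocalRing.ResidueField P.vring) with hr
  have hr1 : 1 < r := A.one_lt_r
  have hr0 : (0 : ℝ) < r := by exact_mod_cast (by omega : 0 < r)
  obtain ⟨m0, -, hm0⟩ := A.card_step
  rw [← hr] at hm0
  have := fin_units A
  set w := Nat.card Oˣ with hw
  have hw0 : 0 < w := Nat.card_pos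
  have hw0' : (0 : ℝ) < w := by exact_mod_cast hw0
  have := A.finite_V m0
  set k0 := Nat.card (Arith.V O P m0) with hk0
  have hk0' : 0 < k0 := Nat.card_pos
  have hk0'' : (0 : ℝ) < k0 := by exact_mod_cast hk0'
  have hinv : (r : ℝ)⁻¹ < 1 := inv_lt_one_of_one_lt₀ (by exact_mod_cast hr1)
  refine ⟨k0 * ((r : ℝ) ^ m0)⁻¹ * (1 - (r : ℝ)⁻¹) / w, by
    have : 0 < 1 - (r : ℝ)⁻¹ := by linarith
    positivity, fun c => ?_⟩
  obtain ⟨E, rfl⟩ := exists_E P n hn c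
  have hjj : ∀ D : {D : HeightOneSpectrum O →₀ ℕ // cl P n D = - cl P n E}, ∃ j : ℕ, NN D.1 * NN E = (r ^ n) ^ j := by
    rintro ⟨D, h1⟩
    rw [cl, cl, ← QuotientAddGroup.mk_neg, eq_comm, QuotientAddGroup.eq, mem_Hn] at h1
    obtain ⟨x, hx0, hx1, hx2⟩ := h1
    rw [neg_neg] at hx2
    have hx3 : ∀ v, nu v x = (D v : ℤ) + E v := by
      intro v; rw [← dv_apply, hx2, Finsupp.add_apply, cD_apply, cD_apply, add_comm]
    obtain ⟨f, rfl⟩ := exists_alg (O := O) (x := x) (fun v => by rw [hx3]; positivity)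
    have hf0 : f ≠ 0 := by rintro rfl; simp at hx0
    have hd : dvn F f = D + E := by
      ext v
      have := hx3 v
      rw [← dvn_apply] at this
      rw [Finsupp.add_apply]; exact_mod_cast this
    have h5 := A.o_nonpos f hf0
    obtain ⟨k, hk⟩ := hx1
    refine ⟨(-k).toNat, ?_⟩
    have h3 := NN_dvn A hf0
    rw [hd, NN_add] at h3
    rw [h3, ← pow_mul]
    congr 1
    have hk1 : k ≤ 0 := by
      by_contra hk1
      push Not at hk1
      have : (0 : ℤ) < n := by exact_mod_cast hn
      nlinarith
    zify
    rw [Int.toNat_of_nonneg (by omega), Int.toNat_of_nonneg (by omega), hk]; ring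
  choose jj hjj using hjj
  have hE := NN_pos A E
  have hr2 : 2 ≤ r ^ n := by
    calc 2 ≤ r := hr1
      _ = r ^ 1 := (pow_one r).symm
      _ ≤ r ^ n := Nat.pow_le_pow_right (by omega) hn
  have hfibeq : ∀ j, Nat.card {D : {D : HeightOneSpectrum O →₀ ℕ // cl P n D = - cl P n E} // jj D = j} = 
      Nat.card {D : HeightOneSpectrum O →₀ ℕ // cl P n D = - cl P n E ∧ NN D * NN E = r ^ (n * j)} := by
    intro j
    refine Nat.card_congr ((Equiv.subtypeSubtypeEquivSubtypeInter _ _).symm.trans (Equiv.subtypeEquivRight ?_)).symm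
    intro D
    change NN D.1 * NN E = r ^ (n * j) ↔ _
    rw [hjj, pow_mul]
    exact ⟨fun h => Nat.pow_right_injective hr2 h, fun h => by rw [h]⟩
  have hfin : ∀ j, Finite {D : {D : HeightOneSpectrum O →₀ ℕ // cl P n D = - cl P n E} // jj D = j} := by
    intro j
    have := (fin_NN A ((r ^ n) ^ j)).to_subtype
    refine Finite.of_injective (fun D => (⟨D.1.1, ?_⟩ : {D : HeightOneSpectrum O →₀ ℕ | NN D ≤ (r ^ n) ^ j})) ?_
    · change NN D.1.1 ≤ _
      have h9 := hjj D.1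
      rw [D.2] at h9
      rw [← h9]
      exact Nat.le_mul_of_pos_right _ hE
    · intro x y hxy
      have h8 : x.1.1 = y.1.1 := by simpa using hxy
      exact Subtype.ext (Subtype.ext h8)
  obtain ⟨mI, hmI⟩ := A.card_V_inf (EI E) (EI_ne_bot E)
  refine zeta_aux _ (fun D => NN_pos A D.1) jj (NN E) (r ^ n) hE hr2 hjj hfin _ ?_ (m0 + mI + 1) ?_
  · have : 0 < 1 - (r : ℝ)⁻¹ := by linarith
    positivity
  intro j hj
  rw [hfibeq]
  have e1 := card_class A n E j
  rw [← hr, ← hw] at e1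
  set Aj := Nat.card {D : HeightOneSpectrum O →₀ ℕ // cl P n D = - cl P n E ∧ NN D * NN E = r ^ (n * j)}
  have e2 := card_exact A (EI E) ((n * j : ℕ) : ℤ)
  rw [e1] at e2
  have hnj : m0 + mI + 1 ≤ n * j := hj.trans (Nat.le_mul_of_pos_left _ hn)
  have e3 := hmI ((n * j : ℕ) : ℤ) (by omega)
  have e4 := hmI (((n * j : ℕ) : ℤ) - 1) (by omega)
  rw [card_EI] at e3 e4
  obtain ⟨d, hd⟩ : ∃ d, n * j = m0 + d + 1 := ⟨n * j - m0 - 1, by omega⟩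
  have e5 := hm0 (d + 1)
  have e6 := hm0 d
  have c5 : (m0 : ℤ) + ((d + 1 : ℕ) : ℤ) = ((n * j : ℕ) : ℤ) := by rw [hd]; push_cast; ring
  have c6 : (m0 : ℤ) + (d : ℤ) = ((n * j : ℕ) : ℤ) - 1 := by rw [hd]; push_cast; ring
  rw [c5] at e5
  rw [c6] at e6
  rw [e5] at e3
  rw [e6] at e4
  have e7 : (k0 : ℝ) * r ^ (d + 1) = k0 * r ^ d + (NN E : ℝ) * (Aj * w) := by
    have : k0 * r ^ (d + 1) = k0 * r ^ d + NN E * (Aj * w) := by rw [e3, e4, e2]; ring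
    exact_mod_cast this
  have e8 : ((r ^ n : ℕ) : ℝ) ^ j = r ^ m0 * (r ^ d * r) := by
    push_cast
    rw [← pow_mul, hd, pow_add, pow_add, pow_one, mul_assoc]
  rw [e8]
  have hrm : (r : ℝ) ^ m0 ≠ 0 := by positivity
  field_simp
  rw [pow_succ] at e7
  linarith

theorem finite_Cn (A : Arith O P) (n : ℕ) (hn : 0 < n) : Finite (Cn O P n) := by
  set r := Nat.card (IsLocalRing.ResidueField P.vring) with hr
  have hr1 : 1 < r := A.one_lt_r
  obtain ⟨m0, -, hm0⟩ := A.card_step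
  rw [← hr] at hm0
  have := A.finite_V m0
  set k0 := Nat.card (Arith.V O P m0) with hk0
  have hk0' : 0 < k0 := Nat.card_pos
  obtain ⟨π, hπ0, hπ1⟩ := P.exists_unif
  let cπ : Cn O P n := (dv O π : HeightOneSpectrum O →₀ ℤ)
  have hfin := (fin_NN A (r ^ (m0 + 1))).to_subtype
  let Φ : {D : HeightOneSpectrum O →₀ ℕ | NN D ≤ r ^ (m0 + 1)} × Fin n → Cn O P n := fun x => cl P n x.1.1 + (x.2 : ℕ) • cπ
  refine Finite.of_surjective Φ ?_
  intro c
  obtain ⟨E, rfl⟩ := exists_E P n hn c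
  have hE := NN_pos A E
  -- minimal j
  have hexj : ∃ j, NN E < k0 * r ^ j := by
    refine ⟨NN E, ?_⟩
    have : NN E < r ^ NN E := Nat.lt_pow_self hr1
    nlinarith
  classical
  let j := Nat.find hexj
  have hj : NN E < k0 * r ^ j := Nat.find_spec hexj
  have hjle : r ^ (m0 + j) ≤ r ^ (m0 + 1) * NN E := by
    rcases Nat.eq_zero_or_pos j with h0 | h0
    · rw [h0]
      calc r ^ (m0 + 0) ≤ r ^ (m0 + 1) := Nat.pow_le_pow_right (by omega) (by omega)
        _ ≤ _ := Nat.le_mul_of_pos_right _ hE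
    · have h1 := Nat.find_min hexj (m := j - 1) (by omega)
      push Not at h1
      have h2 : r ^ (j - 1) ≤ NN E := le_trans (Nat.le_mul_of_pos_left _ hk0') h1
      have h3 : m0 + j = (m0 + 1) + (j - 1) := by omega
      rw [h3, pow_add]
      exact Nat.mul_le_mul_left _ h2
  have := A.finite_V (m0 + j)
  have hni : ¬ Function.Injective (fun x : Arith.V O P (m0 + j) => Ideal.Quotient.mk (EI E) (x : O)) := by
    intro hi
    have := A.finq (EI E) (EI_ne_bot E)
    have := Nat.card_le_card_of_injective _ hi
    rw [card_EI, hm0] at this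
    omega
  rw [Function.not_injective_iff] at hni
  obtain ⟨f1, f2, h12, hne⟩ := hni
  obtain ⟨f, hf⟩ : ∃ f : O, f = (f1 : O) - f2 := ⟨_, rfl⟩
  have hfV : f ∈ Arith.V O P (m0 + j) := by rw [hf]; exact AddSubgroup.sub_mem _ f1.2 f2.2
  have hf0 : f ≠ 0 := by
    rw [hf, sub_ne_zero]; exact fun h => hne (Subtype.ext h)
  have hfI : f ∈ EI E := by
    rw [hf, ← Ideal.Quotient.mk_eq_mk_iff_sub_mem]; exact h12
  have hle := (mem_EI (F := F) hf0).mp hfI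
  have hle' : E ≤ dvn F f := by
    intro v; have := hle v; rw [← dvn_apply] at this; exact_mod_cast this
  have ho := (Arith.mem_V'.mp hfV).resolve_left hf0
  have ho' := A.o_nonpos f hf0
  set o := P.o (algebraMap O F f) with hodef
  have hN : NN (dvn F f - E) ≤ r ^ (m0 + 1) := by
    have h1 : NN (dvn F f - E) * NN E = r ^ (-o).toNat := by
      rw [← NN_add, tsub_add_cancel_of_le hle', NN_dvn A hf0]
    have h2 : r ^ (-o).toNat ≤ r ^ (m0 + j) := Nat.pow_le_pow_right (by omega) (by omega)
    have h3 := (h1.le.trans h2).trans hjle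
    exact Nat.le_of_mul_le_mul_right h3 hE
  -- f / π^o has order zero
  have hn0 : (0 : ℤ) < n := by exact_mod_cast hn
  let k : ℕ := ((-o) % n).toNat
  have hk : (k : ℤ) = (-o) % n := Int.toNat_of_nonneg (Int.emod_nonneg _ hn0.ne')
  have hkn : k < n := by
    have := Int.emod_lt_of_pos (-o) hn0
    omega
  refine ⟨(⟨dvn F f - E, hN⟩, ⟨k, hkn⟩), ?_⟩
  change cl P n (dvn F f - E) + k • cπ = - cl P n E
  rw [← sub_eq_zero, sub_neg_eq_add]
  have e : cl P n (dvn F f - E) + k • cπ + cl P n E = ((dv O (algebraMap O F f * π ^ k) : HeightOneSpectrum O →₀ ℤ) : Cn O P n) := by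
    have : cl P n (dvn F f - E) + k • cπ + cl P n E = cl P n (dvn F f - E + E) + k • cπ := by
      simp only [cl, map_add, QuotientAddGroup.mk_add]; abel
    rw [this, tsub_add_cancel_of_le hle', cl, cD_dvn, dv_mul (alg_ne hf0) (pow_ne_zero _ hπ0), QuotientAddGroup.mk_add]
    congr 1
    change k • ((dv O π : HeightOneSpectrum O →₀ ℤ) : Cn O P n) = _
    rw [← QuotientAddGroup.mk_nsmul]
    congr 1
    ext v; simp [nu_pow]
  rw [e, QuotientAddGroup.eq_zero_iff, mem_Hn]
  refine ⟨_, mul_ne_zero (alg_ne hf0) (pow_ne_zero _ hπ0), ?_, rfl⟩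
  rw [P.o_mul (alg_ne hf0) (pow_ne_zero _ hπ0), P.o_pow hπ0, hπ1, ← hodef, mul_one, hk]
  have h9 := Int.emod_add_mul_ediv (-o) n
  exact ⟨-((-o) / n), by linarith⟩

end DV


set_option linter.unusedSectionVars false

namespace EU
open Finset
variable {S : Type} {k : Type} [NormedField k] [CompleteSpace k]

/-- completely multiplicative extension of `f` -/
def wt (f : S → k) (D : S →₀ ℕ) : k := D.prod (fun v n => f v ^ n)

lemma wt_add (f : S → k) (D E : S →₀ ℕ) : wt f (D + E) = wt f D * wt f E := by
  classical
  exact Finsupp.prod_add_index' (by simp) (by intro a m n; exact pow_add _ _ _)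
lemma wt_single (f : S → k) (v : S) (n : ℕ) : wt f (Finsupp.single v n) = f v ^ n := by
  simp [wt]
lemma wt_zero (f : S → k) : wt f 0 = 1 := by simp [wt]

open Classical in
/-- splitting off one prime -/
def insEquiv (T : Finset S) (v : S) (hv : v ∉ T) : 
    ℕ × {D : S →₀ ℕ // D.support ⊆ T} ≃ {D : S →₀ ℕ // D.support ⊆ insert v T} where
  toFun x := ⟨Finsupp.single v x.1 + x.2.1, by
    refine Finsupp.support_add.trans (Finset.union_subset ?_ ?_)
    · exact Finsupp.support_single_subset.trans (by simp)
    · exact x.2.2.trans (Finset.subset_insert _ _)⟩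
  invFun D := (D.1 v, ⟨D.1.erase v, by
    rw [Finsupp.support_erase]
    intro w hw
    rw [Finset.mem_erase] at hw
    exact (Finset.mem_insert.mp (D.2 hw.2)).resolve_left hw.1⟩)
  left_inv x := by
    have h : x.2.1 v = 0 := by
      by_contra h
      exact hv (x.2.2 (Finsupp.mem_support_iff.mpr h))
    refine Prod.ext (by simp [h]) (Subtype.ext ?_)
    ext w
    by_cases hw : w = v
    · subst hw; simp [h]
    · simp [Finsupp.erase_ne hw, Finsupp.single_eq_of_ne hw]
  right_inv D := by
    refine Subtype.ext ?_
    exact Finsupp.single_add_erase v D.1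

theorem euler_fin (f : S → k) (hf : ∀ v, ‖f v‖ < 1) (T : Finset S) : 
    Summable (fun D : {D : S →₀ ℕ // D.support ⊆ T} => ‖wt f D.1‖) ∧ 
    HasSum (fun D : {D : S →₀ ℕ // D.support ⊆ T} => wt f D.1) (∏ v ∈ T, (1 - f v)⁻¹) := by
  classical
  induction T using Finset.induction_on with
  | empty => 
    have : Unique {D : S →₀ ℕ // D.support ⊆ (∅ : Finset S)} := 
      { default := ⟨0, by simp⟩
        uniq := fun D => Subtype.ext (by simpa using D.2) }
    refine ⟨Summable.of_finite, ?_⟩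
    have := hasSum_unique (fun D : {D : S →₀ ℕ // D.support ⊆ (∅ : Finset S)} => wt f D.1)
    have e : wt f (default : {D : S →₀ ℕ // D.support ⊆ (∅ : Finset S)}).1 = 1 := by
      have : (default : {D : S →₀ ℕ // D.support ⊆ (∅ : Finset S)}).1 = 0 := by
        simpa using (default : {D : S →₀ ℕ // D.support ⊆ (∅ : Finset S)}).2
      rw [this, wt_zero]
    rw [e] at this
    simpa using this
  | insert v T hv ih => 
    have e : ∀ x, wt f (insEquiv T v hv x).1 = f v ^ x.1 * wt f x.2.1 := by
      intro x
      change wt f (Finsupp.single v x.1 + x.2.1) = _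
      rw [wt_add, wt_single]
    have hg : Summable (fun n : ℕ => ‖f v ^ n‖) := by
      simp only [norm_pow]
      exact summable_geometric_of_lt_one (norm_nonneg _) (hf v)
    have h1 := Summable.mul_norm hg ih.1
    have h2 := tsum_mul_tsum_of_summable_norm hg ih.1
    rw [(hasSum_geometric_of_norm_lt_one (hf v)).tsum_eq, ih.2.tsum_eq] at h2
    have h3 := summable_mul_of_summable_norm hg ih.1
    constructor
    · rw [← (insEquiv T v hv).summable_iff]
      refine h1.congr ?_
      intro x
      simp only [Function.comp, e]
    · rw [← (insEquiv T v hv).hasSum_iff, Finset.prod_insert hv, h2]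
      have e' : ((fun D : {D : S →₀ ℕ // D.support ⊆ insert v T} => wt f D.1) ∘ (insEquiv T v hv)) = 
          fun x => f v ^ x.1 * wt f x.2.1 := funext e
      rw [e']
      exact h3.hasSum

theorem euler_lim (f : S → k) (hf : ∀ v, ‖f v‖ < 1) (hs : Summable (fun D => ‖wt f D‖)) : 
    Filter.Tendsto (fun T : Finset S => ∏ v ∈ T, (1 - f v)⁻¹) Filter.atTop (nhds (∑' D, wt f D)) := by
  classical
  have h1 : ∀ T : Finset S, ∏ v ∈ T, (1 - f v)⁻¹ = ∑' D, Set.indicator {D : S →₀ ℕ | D.support ⊆ T} (wt f) D := by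
    intro T
    rw [← (euler_fin f hf T).2.tsum_eq]
    exact tsum_subtype {D : S →₀ ℕ | D.support ⊆ T} (wt f)
  simp only [h1]
  refine tendsto_tsum_of_dominated_convergence hs ?_ ?_
  · intro D
    refine tendsto_const_nhds.congr' ?_
    filter_upwards [Filter.eventually_ge_atTop D.support] with T hT
    exact (Set.indicator_of_mem (s := {D : S →₀ ℕ | D.support ⊆ T}) hT _).symm
  · refine Filter.Eventually.of_forall (fun T D => ?_)
    exact norm_indicator_le_norm_self _ _

/-- partial sums are bounded by products -/
theorem partial_le (f : S → ℝ) (h0 : ∀ v, 0 ≤ f v) (h1 : ∀ v, f v < 1) (U : Finset (S →₀ ℕ)) : 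
    ∃ T : Finset S, ∑ D ∈ U, wt f D ≤ ∏ v ∈ T, (1 - f v)⁻¹ := by
  classical
  let T := U.biUnion (fun D => D.support)
  refine ⟨T, ?_⟩
  have h := euler_fin f (fun v => by rw [Real.norm_of_nonneg (h0 v)]; exact h1 v) T
  have hU : ∀ D ∈ U, D.support ⊆ T := fun D hD => Finset.subset_biUnion_of_mem (fun D : S →₀ ℕ => D.support) hD
  have := sum_le_hasSum (U.subtype (fun D => D.support ⊆ T)) (fun D _ => ?_) h.2
  · refine le_trans (le_of_eq ?_) this
    rw [Finset.sum_subtype_of_mem (fun D => wt f D) hU]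
  · exact Finset.prod_nonneg (fun v _ => pow_nonneg (h0 v) _)
end EU


set_option linter.unusedSectionVars false

namespace EU
open Finset
variable {S : Type} {X : Type} [AddCommGroup X] [Fintype X]

lemma char_loc (g : X) (z : ℝ) (h0 : 0 ≤ z) (h1 : z < 1) : 
    ∏ χ : AddChar X ℂ, ‖1 - χ g * (z : ℂ)‖ ^ 2 ≤ Real.exp (Fintype.card X * z ^ 2) := by
  classical
  by_cases hg : g = 0
  · refine le_trans (Finset.prod_le_one (fun _ _ => by positivity) (fun χ _ => ?_)) (Real.one_le_exp (by positivity))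
    rw [hg, AddChar.map_zero_eq_one, one_mul]
    have : ‖1 - (z : ℂ)‖ = 1 - z := by
      rw [← Complex.ofReal_one, ← Complex.ofReal_sub, Complex.norm_real, Real.norm_of_nonneg (by linarith)]
    rw [this]
    exact pow_le_one₀ (by linarith) (by linarith)
  · have h2 : ∀ χ : AddChar X ℂ, ‖1 - χ g * (z : ℂ)‖ ^ 2 ≤ Real.exp (-2 * z * (χ g).re + z ^ 2) := by
      intro χ
      refine le_trans ?_ (Real.add_one_le_exp _)
      have hn : (χ g).re ^ 2 + (χ g).im ^ 2 = 1 := by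
        have := AddChar.norm_apply χ g
        rw [← Complex.sq_norm_sub_sq_re (χ g), this]; ring
      rw [← Complex.normSq_eq_norm_sq, Complex.normSq_apply]
      simp
      nlinarith
    refine le_trans (Finset.prod_le_prod (fun _ _ => by positivity) (fun χ _ => h2 χ)) ?_
    rw [← Real.exp_sum, Finset.sum_add_distrib, ← Finset.mul_sum]
    have h3 : ∑ χ : AddChar X ℂ, (χ g).re = 0 := by
      rw [← Complex.re_sum, AddChar.sum_apply_eq_ite, if_neg hg]; rfl
    rw [h3]
    simp [AddChar.card_eq]

lemma char_loc0 (z : ℝ) (h1 : z < 1) : 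
    ∏ χ : AddChar X ℂ, ‖1 - χ 0 * (z : ℂ)‖ ^ 2 = (1 - z) ^ (2 * Fintype.card X) := by
  classical
  have : ‖1 - (z : ℂ)‖ = 1 - z := by
    rw [← Complex.ofReal_one, ← Complex.ofReal_sub, Complex.norm_real, Real.norm_of_nonneg (by linarith)]
  simp only [AddChar.map_zero_eq_one, one_mul, this]
  rw [Finset.prod_const, Finset.card_univ, AddChar.card_eq, pow_mul]

theorem char_bound (cls : S → X) (z : S → ℝ) (h0 : ∀ v, 0 ≤ z v) (h1 : ∀ v, z v < 1) 
    (Z2 : ℝ) (hZ : ∀ T : Finset S, ∑ v ∈ T, z v ^ 2 ≤ Z2)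
    (hs : Summable (fun D => wt z D)) (T : Finset S) (hT : ∀ v ∈ T, cls v = 0) : 
    (∏ v ∈ T, (1 - z v)⁻¹) ^ (2 * Fintype.card X) ≤ Real.exp (Fintype.card X * Z2) * 
      ∏ χ : AddChar X ℂ, ‖∑' D, wt (fun v => χ (cls v) * (z v : ℂ)) D‖ ^ 2 := by
  classical
  have hn : ∀ (χ : AddChar X ℂ) v, ‖χ (cls v) * (z v : ℂ)‖ = z v := by
    intro χ v
    rw [norm_mul, AddChar.norm_apply, one_mul, Complex.norm_real, Real.norm_of_nonneg (h0 v)]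
  have hw : ∀ (χ : AddChar X ℂ) D, ‖wt (fun v => χ (cls v) * (z v : ℂ)) D‖ = wt z D := by
    intro χ D
    simp only [wt, Finsupp.prod, norm_prod, norm_pow, hn]
  have hlim : ∀ χ : AddChar X ℂ, Filter.Tendsto (fun T : Finset S => ‖∏ v ∈ T, (1 - χ (cls v) * (z v : ℂ))⁻¹‖ ^ 2) 
      Filter.atTop (nhds (‖∑' D, wt (fun v => χ (cls v) * (z v : ℂ)) D‖ ^ 2)) := by
    intro χ
    refine ((euler_lim _ (fun v => ?_) ?_).norm).pow 2
    · rw [hn]; exact h1 v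
    · simp only [hw]; exact hs
  have hlim2 := (tendsto_finsetProd Finset.univ (fun χ _ => hlim χ)).const_mul (Real.exp (Fintype.card X * Z2))
  refine ge_of_tendsto hlim2 ?_
  filter_upwards [Filter.eventually_ge_atTop T] with T' hT'
  have e1 : ∏ χ : AddChar X ℂ, ‖∏ v ∈ T', (1 - χ (cls v) * (z v : ℂ))⁻¹‖ ^ 2 = 
      ∏ v ∈ T', (∏ χ : AddChar X ℂ, ‖1 - χ (cls v) * (z v : ℂ)‖ ^ 2)⁻¹ := by
    simp only [norm_prod, norm_inv, ← Finset.prod_pow, ← Finset.prod_inv_distrib, inv_pow]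
    rw [Finset.prod_comm]
  rw [e1, ← Finset.prod_sdiff hT']
  have e2 : ∏ v ∈ T, (∏ χ : AddChar X ℂ, ‖1 - χ (cls v) * (z v : ℂ)‖ ^ 2)⁻¹ = 
      (∏ v ∈ T, (1 - z v)⁻¹) ^ (2 * Fintype.card X) := by
    rw [← Finset.prod_pow]
    refine Finset.prod_congr rfl (fun v hv => ?_)
    rw [hT v hv, char_loc0 _ (h1 v), inv_pow]
  rw [e2]
  have e3 : Real.exp (-(Fintype.card X * Z2)) ≤ ∏ v ∈ T' \ T, (∏ χ : AddChar X ℂ, ‖1 - χ (cls v) * (z v : ℂ)‖ ^ 2)⁻¹ := by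
    have : ∏ v ∈ T' \ T, Real.exp (-(Fintype.card X * z v ^ 2)) ≤ ∏ v ∈ T' \ T, (∏ χ : AddChar X ℂ, ‖1 - χ (cls v) * (z v : ℂ)‖ ^ 2)⁻¹ := by
      refine Finset.prod_le_prod (fun _ _ => (Real.exp_pos _).le) (fun v _ => ?_)
      rw [Real.exp_neg]
      refine inv_anti₀ ?_ (char_loc _ _ (h0 v) (h1 v))
      refine Finset.prod_pos (fun χ _ => ?_)
      have : 1 - χ (cls v) * (z v : ℂ) ≠ 0 := by
        intro h
        have h2 := hn χ v
        rw [← sub_eq_zero.mp h, norm_one] at h2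
        linarith [h1 v]
      positivity
    refine le_trans ?_ this
    rw [← Real.exp_sum, Real.exp_le_exp, Finset.sum_neg_distrib, ← Finset.mul_sum]
    have := hZ (T' \ T)
    have hc : (0 : ℝ) ≤ Fintype.card X := by positivity
    nlinarith
  have hP : 0 ≤ (∏ v ∈ T, (1 - z v)⁻¹) ^ (2 * Fintype.card X) := by
    refine pow_nonneg (Finset.prod_nonneg (fun v _ => inv_nonneg.mpr ?_)) _
    linarith [h1 v]
  calc (∏ v ∈ T, (1 - z v)⁻¹) ^ (2 * Fintype.card X) = 
      Real.exp (Fintype.card X * Z2) * (Real.exp (-(Fintype.card X * Z2)) * (∏ v ∈ T, (1 - z v)⁻¹) ^ (2 * Fintype.card X)) := by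
        rw [← mul_assoc, ← Real.exp_add]; simp
    _ ≤ _ := mul_le_mul_of_nonneg_left (mul_le_mul_of_nonneg_right e3 hP) (Real.exp_pos _).le

end EU


set_option linter.unusedSectionVars false

namespace DV
open IsDedekindDomain EU
variable {O F : Type} [CommRing O] [IsDedekindDomain O] [Field F] [Algebra O F] 
    [IsFractionRing O F] {P : FFPrime F}

lemma wt_NN (A : Arith O P) (s : ℝ) (D : HeightOneSpectrum O →₀ ℕ) : 
    wt (fun v => (Nq v : ℝ) ^ (-s)) D = (NN D : ℝ) ^ (-s) := by
  simp only [wt, NN, Finsupp.prod]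
  push_cast
  rw [← Real.finsetProd_rpow _ _ (fun v _ => by positivity)]
  refine Finset.prod_congr rfl (fun v _ => ?_)
  rw [← Real.rpow_natCast, ← Real.rpow_mul (by positivity), ← Real.rpow_natCast, ← Real.rpow_mul (by positivity), mul_comm]

lemma summable_all (A : Arith O P) (s : ℝ) (hs : 1 < s) (hs2 : s ≤ 2) : 
    Summable (fun D : HeightOneSpectrum O →₀ ℕ => (NN D : ℝ) ^ (-s)) := by
  obtain ⟨α, hα, h⟩ := class_zeta A 1 one_pos
  have := finite_Cn A 1 one_pos
  have := Fintype.ofFinite (Cn O P 1)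
  rw [← (Equiv.sigmaFiberEquiv (fun D : HeightOneSpectrum O →₀ ℕ => cl P 1 D)).summable_iff]
  refine (summable_sigma_of_nonneg (fun x => by simp only [Function.comp]; positivity)).mpr ⟨fun c => ?_, Summable.of_finite⟩
  obtain ⟨B, hB⟩ := h c
  exact (hB s hs hs2).1

lemma z_lt (A : Arith O P) (s : ℝ) (hs : 1 < s) (v : HeightOneSpectrum O) : (Nq v : ℝ) ^ (-s) < 1 := by
  have := two_le_Nq A v
  exact Real.rpow_lt_one_of_one_lt_of_neg (by exact_mod_cast (by omega : 1 < Nq v)) (by linarith)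

lemma sum_sq (A : Arith O P) : ∃ Z2 : ℝ, 0 ≤ Z2 ∧ ∀ s : ℝ, 1 < s → ∀ T : Finset (HeightOneSpectrum O), 
    ∑ v ∈ T, ((Nq v : ℝ) ^ (-s)) ^ 2 ≤ Z2 := by
  classical
  have h := summable_all A 2 (by norm_num) le_rfl
  refine ⟨∑' D : HeightOneSpectrum O →₀ ℕ, (NN D : ℝ) ^ (-(2 : ℝ)), tsum_nonneg (fun _ => by positivity), ?_⟩
  intro s hs T
  let e : HeightOneSpectrum O ↪ (HeightOneSpectrum O →₀ ℕ) := ⟨fun v => Finsupp.single v 1, Finsupp.single_left_injective one_ne_zero⟩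
  refine le_trans ?_ (h.sum_le_tsum (T.map e) (fun _ _ => by positivity))
  rw [Finset.sum_map]
  refine Finset.sum_le_sum (fun v _ => ?_)
  have h2 := two_le_Nq A v
  have : NN (e v) = Nq v := by
    change NN (Finsupp.single v 1) = _
    simp [NN]
  rw [this, ← Real.rpow_natCast, ← Real.rpow_mul (by positivity)]
  refine Real.rpow_le_rpow_of_exponent_le (by exact_mod_cast (by omega : 1 ≤ Nq v)) ?_
  push_cast; linarith

theorem F_bound {X : Type} [AddCommGroup X] [Fintype X] (A : Arith O P) (n : ℕ) (hn : 0 < n)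
    (φ : (HeightOneSpectrum O →₀ ℤ) →+ X) (hφ : Function.Surjective φ) (hH : ∀ D ∈ Hn O P n, φ D = 0) : 
    ∃ C : ℝ, 0 < C ∧ ∀ s : ℝ, 1 < s → s ≤ 2 → ∀ T : Finset (HeightOneSpectrum O), 
      (∀ v ∈ T, φ (Finsupp.single v 1) = 0) → 
      (∏ v ∈ T, (1 - (Nq v : ℝ) ^ (-s))⁻¹) ^ (2 * Fintype.card X) ≤ C / (s - 1) ^ 2 := by
  classical
  obtain ⟨Z2, hZ0, hZ2⟩ := sum_sq A
  obtain ⟨α, hα, hcz⟩ := class_zeta A n hn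
  have := finite_Cn A n hn
  have := Fintype.ofFinite (Cn O P n)
  choose B hB using hcz
  set ρ : ℝ := ((Nat.card (IsLocalRing.ResidueField P.vring) ^ n : ℕ) : ℝ) with hρ
  have hρ1 : 1 < ρ := by
    rw [hρ]; exact_mod_cast Nat.one_lt_pow hn.ne' A.one_lt_r
  let ψ : Cn O P n →+ X := QuotientAddGroup.lift (Hn O P n) φ hH
  have hψ : ∀ D, ψ (cl P n D) = φ (cD D) := fun D => rfl
  have hψs : Function.Surjective ψ := by
    intro x
    obtain ⟨D, rfl⟩ := hφ x
    exact ⟨(D : Cn O P n), rfl⟩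
  -- the L-functions
  have hwt : ∀ (χ : AddChar X ℂ) (s : ℝ) D, wt (fun v => χ (φ (Finsupp.single v 1)) * (((Nq v : ℝ) ^ (-s) : ℝ) : ℂ)) D = 
      χ (ψ (cl P n D)) * (((NN D : ℝ) ^ (-s) : ℝ) : ℂ) := by
    intro χ s D
    rw [← wt_NN A, hψ]
    induction D using Finsupp.induction_linear with
    | zero => simp [wt_zero]
    | add D E hD hE => 
      rw [wt_add, hD, hE, wt_add, map_add, map_add, AddChar.map_add_eq_mul]; push_cast; ring
    | single v m => 
      rw [wt_single, wt_single]
      have : cD (Finsupp.single v m) = m • (Finsupp.single v (1 : ℤ) : HeightOneSpectrum O →₀ ℤ) := by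
        ext w
        rw [cD_apply]
        by_cases hw : w = v
        · subst hw; simp
        · simp [Finsupp.single_eq_of_ne hw]
      rw [this, map_nsmul, AddChar.map_nsmul_eq_pow, mul_pow]; push_cast; rfl
  set Z : ℝ → Cn O P n → ℝ := fun s c => ∑' D : {D : HeightOneSpectrum O →₀ ℕ // cl P n D = c}, (NN D.1 : ℝ) ^ (-s) with hZ
  have hL : ∀ (χ : AddChar X ℂ) (s : ℝ), 1 < s → s ≤ 2 → 
      ∑' D, wt (fun v => χ (φ (Finsupp.single v 1)) * (((Nq v : ℝ) ^ (-s) : ℝ) : ℂ)) D = ∑ c : Cn O P n, χ (ψ c) * (Z s c : ℂ) := by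
    intro χ s hs hs2
    simp only [hwt]
    have hsum := summable_all A s hs hs2
    have hsum2 : Summable (fun D : HeightOneSpectrum O →₀ ℕ => χ (ψ (cl P n D)) * (((NN D : ℝ) ^ (-s) : ℝ) : ℂ)) := by
      refine Summable.of_norm (hsum.congr (fun D => ?_))
      rw [norm_mul, AddChar.norm_apply, one_mul, Complex.norm_real, Real.norm_of_nonneg (by positivity)]
    have h5 := Summable.tsum_sigma ((Equiv.sigmaFiberEquiv (fun D : HeightOneSpectrum O →₀ ℕ => cl P n D)).summable_iff.mpr hsum2)
    simp only [Function.comp] at h5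
    rw [← (Equiv.sigmaFiberEquiv (fun D : HeightOneSpectrum O →₀ ℕ => cl P n D)).tsum_eq, h5, tsum_fintype]
    refine Finset.sum_congr rfl (fun c _ => ?_)
    rw [hZ, Complex.ofReal_tsum, ← tsum_mul_left]
    refine tsum_congr (fun D => ?_)
    change χ (ψ (cl P n D.1)) * _ = _
    rw [D.2]; rfl
  set B' : ℝ := ∑ c, |B c| with hB'
  have hB'0 : 0 ≤ B' := Finset.sum_nonneg (fun _ _ => abs_nonneg _)
  have hdiff : ∀ (χ : AddChar X ℂ) (s : ℝ), 1 < s → s ≤ 2 → 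
      ‖∑ c : Cn O P n, χ (ψ c) * (Z s c : ℂ) - (∑ c : Cn O P n, χ (ψ c)) * ((α / (1 - ρ ^ (1 - s)) : ℝ) : ℂ)‖ ≤ B' := by
    intro χ s hs hs2
    rw [Finset.sum_mul, ← Finset.sum_sub_distrib]
    refine (norm_sum_le _ _).trans (Finset.sum_le_sum (fun c _ => ?_))
    rw [← mul_sub, norm_mul, AddChar.norm_apply, one_mul, ← Complex.ofReal_sub, Complex.norm_real, Real.norm_eq_abs]
    exact ((hB c s hs hs2).2).trans (le_abs_self _)
  have hne : ∀ χ : AddChar X ℂ, χ ≠ 1 → ∀ s : ℝ, 1 < s → s ≤ 2 → 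
      ‖∑ c : Cn O P n, χ (ψ c) * (Z s c : ℂ)‖ ≤ B' := by
    intro χ hχ s hs hs2
    have h := hdiff χ s hs hs2
    have h0 : ∑ c : Cn O P n, χ (ψ c) = 0 := by
      refine AddChar.sum_eq_zero_of_ne_one (ψ := χ.compAddMonoidHom ψ) ?_
      intro h1
      apply hχ
      ext x
      obtain ⟨c, rfl⟩ := hψs x
      exact DFunLike.congr_fun h1 c
    rwa [h0, zero_mul, sub_zero] at h
  set C1 : ℝ := Fintype.card (Cn O P n) * α * (1 - ρ⁻¹)⁻¹ + B' with hC1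
  have hone : ∀ s : ℝ, 1 < s → s ≤ 2 → 
      ‖∑ c : Cn O P n, (1 : AddChar X ℂ) (ψ c) * (Z s c : ℂ)‖ ≤ C1 / (s - 1) := by
    intro s hs hs2
    have h := hdiff 1 s hs hs2
    have h1 : ∑ c : Cn O P n, (1 : AddChar X ℂ) (ψ c) = Fintype.card (Cn O P n) := by
      simp
    rw [h1] at h
    have hG := (G_bounds hρ1 hs hs2)
    have hs1 : 0 < s - 1 := by linarith
    have hG0 : 0 ≤ 1 / (1 - ρ ^ (1 - s)) := le_trans (by have : 0 < ρ - 1 := by linarith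
                                                         positivity) hG.1
    have h2 : ‖(Fintype.card (Cn O P n) : ℂ) * ((α / (1 - ρ ^ (1 - s)) : ℝ) : ℂ)‖ ≤ Fintype.card (Cn O P n) * α * (1 - ρ⁻¹)⁻¹ / (s - 1) := by
      rw [norm_mul, Complex.norm_natCast, Complex.norm_real, div_eq_mul_one_div, Real.norm_of_nonneg (by positivity)]
      rw [← mul_assoc, mul_div_assoc]
      exact mul_le_mul_of_nonneg_left hG.2 (by positivity)
    have h3 : B' ≤ B' / (s - 1) := by
      rw [le_div_iff₀ hs1]; nlinarith
    calc _ ≤ _ := norm_le_norm_add_norm_sub _ _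
      _ ≤ Fintype.card (Cn O P n) * α * (1 - ρ⁻¹)⁻¹ / (s - 1) + B' / (s - 1) := by
          rw [norm_sub_rev] at h
          exact add_le_add h2 (h.trans h3)
      _ = _ := by rw [hC1]; ring
  have hinv : ρ⁻¹ < 1 := inv_lt_one_of_one_lt₀ hρ1
  have hC1p : 0 < C1 := by
    have : 0 < 1 - ρ⁻¹ := by linarith
    have : 0 < Fintype.card (Cn O P n) := Fintype.card_pos
    positivity
  refine ⟨Real.exp (Fintype.card X * Z2) * ((B' + 1) ^ (2 * (Fintype.card X - 1)) * C1 ^ 2), by positivity, ?_⟩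
  intro s hs hs2 T hT
  have hs1 : 0 < s - 1 := by linarith
  have h := char_bound (fun v => φ (Finsupp.single v 1)) (fun v => (Nq v : ℝ) ^ (-s)) (fun v => by positivity) 
    (z_lt A s hs) Z2 (hZ2 s hs) (by simp only [wt_NN A]; exact summable_all A s hs hs2) T hT
  refine h.trans ?_
  rw [mul_div_assoc]
  refine mul_le_mul_of_nonneg_left ?_ (Real.exp_pos _).le
  rw [← Finset.prod_erase_mul Finset.univ _ (Finset.mem_univ (1 : AddChar X ℂ)), mul_div_assoc]
  refine mul_le_mul ?_ ?_ (by positivity) (by positivity)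
  · have : ∀ χ ∈ Finset.univ.erase (1 : AddChar X ℂ), 
      ‖∑' D, wt (fun v => χ (φ (Finsupp.single v 1)) * (((Nq v : ℝ) ^ (-s) : ℝ) : ℂ)) D‖ ^ 2 ≤ (B' + 1) ^ 2 := by
      intro χ hχ
      rw [hL χ s hs hs2]
      refine pow_le_pow_left₀ (norm_nonneg _) ?_ 2
      linarith [hne χ (Finset.ne_of_mem_erase hχ) s hs hs2]
    refine (Finset.prod_le_prod (fun _ _ => by positivity) this).trans ?_
    rw [Finset.prod_const, Finset.card_erase_of_mem (Finset.mem_univ _), Finset.card_univ, AddChar.card_eq, pow_mul]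
  · rw [hL 1 s hs hs2, ← div_pow]
    exact pow_le_pow_left₀ (norm_nonneg _) (hone s hs hs2) 2

end DV


set_option linter.unusedSectionVars false

namespace DV
open IsDedekindDomain EU
variable {O F : Type} [CommRing O] [IsDedekindDomain O] [Field F] [Algebra O F] 
    [IsFractionRing O F] {P : FFPrime F}
variable {O' F' : Type} [CommRing O'] [IsDedekindDomain O'] [Field F'] [Algebra O' F'] 
    [IsFractionRing O' F'] {P' : FFPrime F'}

lemma L_lower (A : Arith O P) : ∃ c B : ℝ, 0 < c ∧ ∀ s : ℝ, 1 < s → s ≤ 2 → ∀ M : ℝ, 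
    (∀ T : Finset (HeightOneSpectrum O), ∏ v ∈ T, (1 - (Nq v : ℝ) ^ (-s))⁻¹ ≤ M) → c / (s - 1) - B ≤ M := by
  classical
  obtain ⟨α, hα, hcz⟩ := class_zeta A 1 one_pos
  obtain ⟨B, hB⟩ := hcz 0
  set ρ : ℝ := ((Nat.card (IsLocalRing.ResidueField P.vring) ^ 1 : ℕ) : ℝ) with hρ
  have hρ1 : 1 < ρ := by
    rw [hρ]; exact_mod_cast Nat.one_lt_pow one_ne_zero A.one_lt_r
  have hρ2 : 0 < ρ - 1 := by linarith
  refine ⟨α * (ρ - 1)⁻¹, B, by positivity, ?_⟩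
  intro s hs hs2 M hM
  have hG := (G_bounds hρ1 hs hs2).1
  obtain ⟨hs3, hs4⟩ := hB s hs hs2
  have h1 : ∑' D : {D : HeightOneSpectrum O →₀ ℕ // cl P 1 D = 0}, (NN D.1 : ℝ) ^ (-s) ≤ M := by
    refine hs3.tsum_le_of_sum_le (fun U => ?_)
    obtain ⟨T, hT⟩ := partial_le (fun v : HeightOneSpectrum O => (Nq v : ℝ) ^ (-s)) (fun v => by positivity) (z_lt A s hs) 
      (U.map (Function.Embedding.subtype _))
    refine le_trans (le_of_eq ?_) (hT.trans (hM T))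
    rw [Finset.sum_map]
    refine Finset.sum_congr rfl (fun D _ => ?_)
    rw [wt_NN A]; rfl
  have h2 := (abs_le.mp hs4).1
  have h3 : α * (ρ - 1)⁻¹ / (s - 1) ≤ α / (1 - ρ ^ (1 - s)) := by
    rw [mul_div_assoc, div_eq_mul_one_div α]
    exact mul_le_mul_of_nonneg_left hG hα.le
  generalize α / (1 - ρ ^ (1 - s)) = a1 at *
  generalize α * (ρ - 1)⁻¹ / (s - 1) = a2 at *
  linarith

theorem growth {h q : ℕ} {c B K : ℝ} (hc : 0 < c) 
    (H : ∀ Y : ℝ, 1 ≤ Y → 0 ≤ c * Y - B → (c * Y - B) ^ (2 * h) ≤ K * Y ^ (2 * q)) : h ≤ q := by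
  by_contra hlt
  push Not at hlt
  have hc2 : 0 < (c / 2) ^ (2 * h) := by positivity
  let Y : ℝ := 1 + 2 * |B| / c + |K| / (c / 2) ^ (2 * h)
  have e1 : 0 ≤ 2 * |B| / c := by positivity
  have e2 : 0 ≤ |K| / (c / 2) ^ (2 * h) := by positivity
  have hY1 : 1 ≤ Y := by simp only [Y]; linarith
  have hY2 : 2 * |B| ≤ c * Y := by
    have : c * (2 * |B| / c) = 2 * |B| := by field_simp
    simp only [Y]; nlinarith
  have hY3 : |K| < (c / 2) ^ (2 * h) * Y := by
    have : (c / 2) ^ (2 * h) * (|K| / (c / 2) ^ (2 * h)) = |K| := by field_simp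
    simp only [Y]; nlinarith
  have hB := le_abs_self B
  have hB' := abs_nonneg B
  have h1 := H Y hY1 (by linarith)
  have h2 : (c / 2 * Y) ^ (2 * h) ≤ (c * Y - B) ^ (2 * h) := pow_le_pow_left₀ (by positivity) (by linarith) _
  have h3 : Y ^ (2 * q) * Y ≤ Y ^ (2 * h) := by
    rw [← pow_succ]; exact pow_le_pow_right₀ hY1 (by omega)
  have h4 : (c / 2) ^ (2 * h) * (Y ^ (2 * q) * Y) ≤ |K| * Y ^ (2 * q) := by
    calc _ ≤ (c / 2) ^ (2 * h) * Y ^ (2 * h) := mul_le_mul_of_nonneg_left h3 hc2.le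
      _ = (c / 2 * Y) ^ (2 * h) := (mul_pow _ _ _).symm
      _ ≤ _ := h2.trans h1
      _ ≤ _ := mul_le_mul_of_nonneg_right (le_abs_self K) (by positivity)
  have h5 : 0 < Y ^ (2 * q) := by positivity
  nlinarith

theorem first_ineq {X : Type} [AddCommGroup X] [Fintype X] (A : Arith O P) (A' : Arith O' P') (n : ℕ) (hn : 0 < n)
    (φ : (HeightOneSpectrum O →₀ ℤ) →+ X) (hφ : Function.Surjective φ) (hH : ∀ D ∈ Hn O P n, φ D = 0)
    (pr : HeightOneSpectrum O' → HeightOneSpectrum O) (q : ℕ) 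
    (hfib : ∀ v, ∀ T : Finset (HeightOneSpectrum O'), (∀ w ∈ T, pr w = v) → T.card ≤ q)
    (hN : ∀ w, Nq (pr w) ≤ Nq w) 
    (hN2 : ∀ w, φ (Finsupp.single (pr w) 1) = 0 ∨ Nq (pr w) ^ 2 ≤ Nq w) : Fintype.card X ≤ q := by
  classical
  obtain ⟨C, hC, hF⟩ := F_bound A n hn φ hφ hH
  obtain ⟨c, B, hc, hL⟩ := L_lower A'
  obtain ⟨Z2, hZ0, hZ2⟩ := sum_sq A
  refine growth (c := c) (B := B) (K := Real.exp (2 * q * Z2) ^ (2 * Fintype.card X) * C ^ q) hc ?_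
  intro Y hY hYB
  have hY0 : 0 < Y := by linarith
  let s : ℝ := 1 + 1 / Y
  have hs : 1 < s := by simp only [s]; have : 0 < 1 / Y := by positivity
                        linarith
  have hs2 : s ≤ 2 := by simp only [s]; have : 1 / Y ≤ 1 := by rw [div_le_one hY0]; exact hY
                         linarith
  have hsY : s - 1 = 1 / Y := by simp only [s]; ring
  have hF' := hF s hs hs2
  have hL' := hL s hs hs2
  set z : HeightOneSpectrum O → ℝ := fun v => (Nq v : ℝ) ^ (-s) with hz
  have hz0 : ∀ v, 0 < z v := fun v => by
    have := two_le_Nq A v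
    have : (0 : ℝ) < Nq v := by exact_mod_cast (by omega : 0 < Nq v)
    simp only [hz]; positivity
  have hz1 : ∀ v, z v < 1 := z_lt A s hs
  have hz2 : ∀ v, z v ≤ 1 / 2 := by
    intro v
    have h2 := two_le_Nq A v
    have h2' : (2 : ℝ) ≤ Nq v := by exact_mod_cast h2
    calc z v ≤ (Nq v : ℝ) ^ (-1 : ℝ) := Real.rpow_le_rpow_of_exponent_le (by linarith) (by linarith)
      _ = 1 / (Nq v : ℝ) := by rw [Real.rpow_neg_one, one_div]
      _ ≤ 1 / 2 := one_div_le_one_div_of_le (by norm_num) h2'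
  have hnn : 0 ≤ C / (s - 1) ^ 2 := by positivity
  -- key
  have key : ∀ T : Finset (HeightOneSpectrum O'), 
      (∏ w ∈ T, (1 - (Nq w : ℝ) ^ (-s))⁻¹) ^ (2 * Fintype.card X) ≤ 
        Real.exp (2 * q * Z2) ^ (2 * Fintype.card X) * C ^ q * Y ^ (2 * q) := by
    intro T
    have hcardf : ∀ (U : Finset (HeightOneSpectrum O')) v, (U.filter (fun w => pr w = v)).card ≤ q := 
      fun U v => hfib v _ (fun w hw => (Finset.mem_filter.mp hw).2)
    set T1 := T.filter (fun w => φ (Finsupp.single (pr w) 1) = 0)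
    set T2 := T.filter (fun w => ¬ φ (Finsupp.single (pr w) 1) = 0)
    rw [← Finset.prod_filter_mul_prod_filter_not T (fun w => φ (Finsupp.single (pr w) 1) = 0)]
    set W := ∏ v ∈ T1.image pr, (1 - z v)⁻¹ with hW
    have hinv : ∀ v, 1 ≤ (1 - z v)⁻¹ := fun v => one_le_inv_iff₀.mpr ⟨by linarith [hz1 v], by linarith [hz0 v]⟩
    have hW0 : 0 ≤ W := Finset.prod_nonneg (fun v _ => le_trans zero_le_one (hinv v))
    have hnpos : ∀ w : HeightOneSpectrum O', 0 < 1 - (Nq w : ℝ) ^ (-s) := fun w => by linarith [z_lt A' s hs w]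
    have b1 : ∏ w ∈ T1, (1 - (Nq w : ℝ) ^ (-s))⁻¹ ≤ W ^ q := by
      calc _ ≤ ∏ w ∈ T1, (1 - z (pr w))⁻¹ := by
            refine Finset.prod_le_prod (fun w _ => inv_nonneg.mpr (hnpos w).le) (fun w _ => ?_)
            refine inv_anti₀ (by linarith [hz1 (pr w)]) ?_
            have : (Nq w : ℝ) ^ (-s) ≤ z (pr w) := by
              refine Real.rpow_le_rpow_of_nonpos ?_ (by exact_mod_cast hN w) (by linarith)
              exact_mod_cast (by have := two_le_Nq A (pr w); omega : 0 < Nq (pr w))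
            linarith
        _ = ∏ v ∈ T1.image pr, (1 - z v)⁻¹ ^ (T1.filter (fun w => pr w = v)).card := 
            Finset.prod_comp (fun v => (1 - z v)⁻¹) pr
        _ ≤ ∏ v ∈ T1.image pr, (1 - z v)⁻¹ ^ q := by
            refine Finset.prod_le_prod (fun v _ => pow_nonneg (le_trans zero_le_one (hinv v)) _) (fun v _ => ?_)
            exact pow_le_pow_right₀ (hinv v) (hcardf T1 v)
        _ = _ := Finset.prod_pow _ _ _
    have b2 : ∏ w ∈ T2, (1 - (Nq w : ℝ) ^ (-s))⁻¹ ≤ Real.exp (2 * q * Z2) := by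
      calc _ ≤ ∏ w ∈ T2, Real.exp (2 * z (pr w) ^ 2) := by
            refine Finset.prod_le_prod (fun w _ => inv_nonneg.mpr (hnpos w).le) (fun w hw => ?_)
            have h1 : (Nq w : ℝ) ^ (-s) ≤ z (pr w) ^ 2 := by
              have hle := (hN2 w).resolve_left (Finset.mem_filter.mp hw).2
              have hp : (0 : ℝ) < Nq (pr w) := by exact_mod_cast (by have := two_le_Nq A (pr w); omega : 0 < Nq (pr w))
              calc (Nq w : ℝ) ^ (-s) ≤ ((Nq (pr w) : ℝ) ^ 2) ^ (-s) := 
                    Real.rpow_le_rpow_of_nonpos (by positivity) (by exact_mod_cast hle) (by linarith)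
                _ = z (pr w) ^ 2 := by
                  simp only [hz]
                  rw [← Real.rpow_natCast, ← Real.rpow_natCast, ← Real.rpow_mul hp.le, ← Real.rpow_mul hp.le, mul_comm]
            set u := z (pr w) ^ 2 with hu
            have hu1 : u ≤ 1 / 4 := by
              rw [hu]; nlinarith [hz0 (pr w), hz2 (pr w)]
            have hu0 : 0 ≤ u := sq_nonneg _
            rw [inv_le_comm₀ (hnpos w) (Real.exp_pos _), ← Real.exp_neg]
            have h3 : Real.exp (-(2 * u)) * (1 + 2 * u) ≤ 1 := by
              have := Real.add_one_le_exp (2 * u)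
              calc _ ≤ Real.exp (-(2 * u)) * Real.exp (2 * u) := mul_le_mul_of_nonneg_left (by linarith) (Real.exp_pos _).le
                _ = 1 := by rw [← Real.exp_add]; simp
            have h4 : Real.exp (-(2 * u)) ≤ 1 - u := by
              by_contra h
              push Not at h
              have : (1 - u) * (1 + 2 * u) < 1 := lt_of_lt_of_le (mul_lt_mul_of_pos_right h (by linarith)) h3
              nlinarith
            linarith
        _ = ∏ v ∈ T2.image pr, Real.exp (2 * z v ^ 2) ^ (T2.filter (fun w => pr w = v)).card := 
            Finset.prod_comp (fun v => Real.exp (2 * z v ^ 2)) pr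
        _ ≤ ∏ v ∈ T2.image pr, Real.exp (2 * z v ^ 2) ^ q := by
            refine Finset.prod_le_prod (fun v _ => by positivity) (fun v _ => ?_)
            exact pow_le_pow_right₀ (Real.one_le_exp (by positivity)) (hcardf T2 v)
        _ = Real.exp (2 * q * ∑ v ∈ T2.image pr, z v ^ 2) := by
            rw [Finset.prod_pow, ← Real.exp_sum, ← Real.exp_nat_mul, ← Finset.mul_sum]
            congr 1; ring
        _ ≤ _ := by
            refine Real.exp_le_exp.mpr ?_
            have := hZ2 s hs (T2.image pr)
            exact mul_le_mul_of_nonneg_left this (by positivity)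
    have b3 := hF' (T1.image pr) (by
      intro v hv
      obtain ⟨w, hw, rfl⟩ := Finset.mem_image.mp hv
      exact (Finset.mem_filter.mp hw).2)
    have e0 : C / (s - 1) ^ 2 = C * Y ^ 2 := by rw [hsY]; field_simp
    rw [e0] at b3
    calc _ ≤ (W ^ q * Real.exp (2 * q * Z2)) ^ (2 * Fintype.card X) := by
          refine pow_le_pow_left₀ ?_ (mul_le_mul b1 b2 (Finset.prod_nonneg (fun w _ => inv_nonneg.mpr (hnpos w).le)) (by positivity)) _
          exact mul_nonneg (Finset.prod_nonneg (fun w _ => inv_nonneg.mpr (hnpos w).le)) (Finset.prod_nonneg (fun w _ => inv_nonneg.mpr (hnpos w).le))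
      _ = Real.exp (2 * q * Z2) ^ (2 * Fintype.card X) * (W ^ (2 * Fintype.card X)) ^ q := by
          rw [mul_pow, ← pow_mul, ← pow_mul, mul_comm q, mul_comm]
      _ ≤ Real.exp (2 * q * Z2) ^ (2 * Fintype.card X) * (C * Y ^ 2) ^ q := by
          refine mul_le_mul_of_nonneg_left (pow_le_pow_left₀ (by positivity) b3 q) (by positivity)
      _ = _ := by rw [mul_pow, ← pow_mul]; ring
  -- conclude
  have hX : 0 < Fintype.card X := Fintype.card_pos
  set K := Real.exp (2 * q * Z2) ^ (2 * Fintype.card X) * C ^ q * Y ^ (2 * q) with hK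
  have hK0 : 0 ≤ K := by positivity
  have hm : (2 * Fintype.card X) ≠ 0 := by omega
  have h9 := hL' (K ^ ((2 * Fintype.card X : ℕ) : ℝ)⁻¹) (fun T => by
    have h0 : 0 ≤ ∏ w ∈ T, (1 - (Nq w : ℝ) ^ (-s))⁻¹ := 
      Finset.prod_nonneg (fun w _ => inv_nonneg.mpr (by linarith [z_lt A' s hs w]))
    rw [← Real.pow_rpow_inv_natCast h0 hm]
    exact Real.rpow_le_rpow (by positivity) (key T) (by positivity))
  rw [hsY, div_div_eq_mul_div, div_one] at h9
  calc _ ≤ (K ^ ((2 * Fintype.card X : ℕ) : ℝ)⁻¹) ^ (2 * Fintype.card X) := pow_le_pow_left₀ hYB h9 _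
    _ = K := Real.rpow_inv_natCast_pow hK0 hm

end DV


set_option linter.unusedSectionVars false

namespace HB
variable {T : Type} [AddCommGroup T]

lemma index_split {T' : Type} [AddCommGroup T'] (f : T →+ T') {A B : AddSubgroup T} (h : B ≤ A) : 
    B.relIndex A = (B.map f).relIndex (A.map f) * (B ⊓ f.ker).relIndex (A ⊓ f.ker) := by
  have e1 : (B.map f).relIndex (A.map f) = (B ⊔ (A ⊓ f.ker)).relIndex A := by
    rw [AddSubgroup.relIndex_map_map]
    have hsup : A ⊔ f.ker = A ⊔ (B ⊔ f.ker) := by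
      rw [← sup_assoc, sup_eq_left.mpr h]
    rw [hsup, AddSubgroup.relIndex_sup_right, ← AddSubgroup.inf_relIndex_right]
    congr 1
    rw [inf_comm, inf_comm A f.ker, ← sup_inf_assoc_of_le _ h, inf_comm]
  have e2 : (B ⊓ f.ker).relIndex (A ⊓ f.ker) = B.relIndex (B ⊔ (A ⊓ f.ker)) := by
    rw [sup_comm, AddSubgroup.relIndex_sup_right, ← AddSubgroup.inf_relIndex_right B]
    congr 1
    rw [← inf_assoc, inf_eq_left.mpr h]
  rw [e1, e2, mul_comm]
  exact (AddSubgroup.relIndex_mul_relIndex _ _ _ le_sup_left (sup_le h inf_le_left)).symm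

/-- cohomology index -/
def ci (f g : T →+ T) (B : AddSubgroup T) : ℕ := (B.map g).relIndex (B ⊓ f.ker)

lemma map_le_inf {f g : T →+ T} (hfg : ∀ x, f (g x) = 0) {B : AddSubgroup T} (hg : ∀ x ∈ B, g x ∈ B) : 
    B.map g ≤ B ⊓ f.ker := by
  rintro _ ⟨x, hx, rfl⟩
  exact ⟨hg x hx, hfg x⟩

lemma ci_step {f g : T →+ T} (hfg : ∀ x, f (g x) = 0) {A B : AddSubgroup T} (h : B ≤ A)
    (hgA : ∀ x ∈ A, g x ∈ A) (hgB : ∀ x ∈ B, g x ∈ B) : 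
    ci f g A * (B.map g).relIndex (A.map g) = (B ⊓ f.ker).relIndex (A ⊓ f.ker) * ci f g B := by
  unfold ci
  rw [mul_comm, AddSubgroup.relIndex_mul_relIndex _ _ _ (AddSubgroup.map_mono h) (map_le_inf hfg hgA), mul_comm,
    AddSubgroup.relIndex_mul_relIndex _ _ _ (map_le_inf hfg hgB) (inf_le_inf_right _ h)]

lemma ci_finite_index {f g : T →+ T} (hfg : ∀ x, f (g x) = 0) (hgf : ∀ x, g (f x) = 0) {A B : AddSubgroup T} (h : B ≤ A)
    (hgA : ∀ x ∈ A, g x ∈ A) (hgB : ∀ x ∈ B, g x ∈ B) (hfA : ∀ x ∈ A, f x ∈ A) (hfB : ∀ x ∈ B, f x ∈ B) 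
    (hi : B.relIndex A ≠ 0) : ci f g A * ci g f B = ci f g B * ci g f A := by
  have s1 := ci_step hfg h hgA hgB
  have s2 := ci_step hgf h hfA hfB
  have i1 := index_split f h
  have i2 := index_split g h
  have : (ci f g A * ci g f B) * B.relIndex A = (ci f g B * ci g f A) * B.relIndex A := by
    conv_lhs => rw [i2]
    conv_rhs => rw [i1]
    calc _ = (ci f g A * (B.map g).relIndex (A.map g)) * ((B ⊓ g.ker).relIndex (A ⊓ g.ker) * ci g f B) := by ring
      _ = _ := by rw [s1, ← s2]; ring
  exact Nat.eq_of_mul_eq_mul_right (Nat.pos_of_ne_zero hi) this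

lemma ci_acyclic {f g : T →+ T} (hfg : ∀ x, f (g x) = 0) (hgf : ∀ x, g (f x) = 0) {A B : AddSubgroup T} (h : B ≤ A)
    (hgA : ∀ x ∈ A, g x ∈ A) (hgB : ∀ x ∈ B, g x ∈ B)
    (h1 : ∀ x ∈ A, f x ∈ B → ∃ y ∈ A, x - g y ∈ B) (h2 : ∀ x ∈ A, g x ∈ B → ∃ y ∈ A, x - f y ∈ B) : 
    ci f g A = ci f g B := by
  unfold ci
  have e1 : A ⊓ f.ker = (B ⊓ f.ker) ⊔ A.map g := by
    apply le_antisymm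
    · rintro x ⟨hxA, hxf⟩
      have hxf' : f x = 0 := hxf
      obtain ⟨y, hy, hxy⟩ := h1 x hxA (by rw [hxf']; exact B.zero_mem)
      rw [← sub_add_cancel x (g y)]
      refine AddSubgroup.add_mem_sup ⟨hxy, ?_⟩ ⟨y, hy, rfl⟩
      change f (x - g y) = 0
      rw [map_sub, hfg, hxf', sub_zero]
    · exact sup_le (inf_le_inf_right _ h) (map_le_inf hfg hgA)
  rw [e1, AddSubgroup.relIndex_sup_right, ← AddSubgroup.inf_relIndex_right]
  congr 1
  apply le_antisymm
  · rintro _ ⟨⟨y, hy, rfl⟩, hB, -⟩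
    obtain ⟨w, hw, hyw⟩ := h2 y hy hB
    exact ⟨y - f w, hyw, by rw [map_sub, hgf, sub_zero]⟩
  · exact le_inf (AddSubgroup.map_mono h) (map_le_inf hfg hgB)

theorem herbrand_eq {f g : T →+ T} (hfg : ∀ x, f (g x) = 0) (hgf : ∀ x, g (f x) = 0) {A B : AddSubgroup T} (h : B ≤ A)
    (hgA : ∀ x ∈ A, g x ∈ A) (hgB : ∀ x ∈ B, g x ∈ B) (hfA : ∀ x ∈ A, f x ∈ A) (hfB : ∀ x ∈ B, f x ∈ B) 
    (hA : A.index ≠ 0) (hB : Finite B)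
    (h1 : ∀ x ∈ A, f x ∈ B → ∃ y ∈ A, x - g y ∈ B) (h2 : ∀ x ∈ A, g x ∈ B → ∃ y ∈ A, x - f y ∈ B) : 
    g.range.relIndex f.ker = f.range.relIndex g.ker := by
  have t1 : ∀ f g : T →+ T, ci f g ⊤ = g.range.relIndex f.ker := by
    intro f g
    unfold ci
    rw [top_inf_eq, AddMonoidHom.range_eq_map]
  rw [← t1, ← t1]
  have a1 := ci_acyclic hfg hgf h hgA hgB h1 h2
  have a2 := ci_acyclic hgf hfg h hfA hfB h2 h1
  have hbot : ∀ f g : T →+ T, ci f g ⊥ = 1 := by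
    intro f g
    unfold ci
    simp
  have b1 : ci f g B = ci g f B := by
    have := ci_finite_index hfg hgf (bot_le : ⊥ ≤ B) hgB (by simp) hfB (by simp) (by
      rw [AddSubgroup.relIndex_bot_left]; exact Nat.card_pos.ne')
    rw [hbot, hbot] at this
    simpa using this
  have b2 : ci f g B ≠ 0 := by
    unfold ci
    have : Finite (B ⊓ f.ker : AddSubgroup T) := Finite.of_injective (AddSubgroup.inclusion inf_le_left) (AddSubgroup.inclusion_injective _)
    exact AddSubgroup.index_ne_zero_of_finite
  have c1 := ci_finite_index hfg hgf (le_top : A ≤ ⊤) (by simp) hgA (by simp) hfA (by rwa [AddSubgroup.relIndex_top_right])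
  rw [a1, a2, ← b1, mul_comm] at c1
  exact Nat.eq_of_mul_eq_mul_left (Nat.pos_of_ne_zero b2) c1

end HB


set_option linter.unusedSectionVars false

namespace HB
variable {M I : Type} [AddCommGroup M] [AddCommGroup I] (σ N : M →+ M) (τ R : I →+ I) (d : M →+ I)

/-- fixed points -/
def fix {A : Type} [AddCommGroup A] (σ : A →+ A) : AddSubgroup A := (σ - AddMonoidHom.id A).ker
lemma mem_fix {A : Type} [AddCommGroup A] {σ : A →+ A} {x : A} : x ∈ fix σ ↔ σ x = x := by
  change (σ - AddMonoidHom.id A) x = 0 ↔ _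
  rw [AddMonoidHom.sub_apply, sub_eq_zero]; rfl

/-- first differential -/
def d1 : M × I →+ M × I := 
  AddMonoidHom.prod ((σ - AddMonoidHom.id M).comp (AddMonoidHom.fst M I)) (R.comp (AddMonoidHom.snd M I) - d.comp (AddMonoidHom.fst M I))
/-- second differential -/
def d2 : M × I →+ M × I := 
  AddMonoidHom.prod (N.comp (AddMonoidHom.fst M I)) ((τ - AddMonoidHom.id I).comp (AddMonoidHom.snd M I) + d.comp (AddMonoidHom.fst M I))

lemma d1_apply (m : M) (i : I) : d1 σ R d (m, i) = (σ m - m, R i - d m) := rfl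
lemma d2_apply (m : M) (i : I) : d2 N τ d (m, i) = (N m, τ i - i + d m) := rfl

theorem norm_thm (hd : ∀ m, d (σ m) = τ (d m)) (hdN : ∀ m, d (N m) = R (d m)) 
    (hNσ : ∀ m, N (σ m) = N m) (hσN : ∀ m, σ (N m) = N m) (hRτ : ∀ i, R (τ i) = R i) (hτR : ∀ i, τ (R i) = R i)
    (H90 : ∀ m, N m = 0 → ∃ n, m = σ n - n) (HI : ∀ i, R i = 0 → ∃ j, i = τ j - j)
    (hker : Finite d.ker) (hidx : d.range.index ≠ 0)
    (F1 : AddSubgroup M) (hF1 : F1 ≤ fix σ) (hN1 : ∀ m, N m ∈ F1) (q : ℕ) (hq : 0 < q) (hFq : F1.relIndex (fix σ) = q)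
    (hX0 : (R.range ⊔ F1.map d).relIndex (fix τ) ≠ 0) (hX : (R.range ⊔ F1.map d).relIndex (fix τ) ≤ q) 
    (c : M) (hc : c ∈ F1) (hcR : d c ∈ R.range) : c ∈ N.range := by
  set f := d1 σ R d with hf
  set g := d2 N τ d with hg
  have hfg : ∀ x, f (g x) = 0 := by
    rintro ⟨m, i⟩
    rw [hf, hg, d2_apply, d1_apply, hσN, map_add, map_sub, hRτ, hdN]; simp
  have hgf : ∀ x, g (f x) = 0 := by
    rintro ⟨m, i⟩
    rw [hf, hg, d1_apply, d2_apply, map_sub, map_sub, map_sub, hNσ, hτR, hd]; simp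
  -- T1 and T2
  let A : AddSubgroup (M × I) := AddSubgroup.prod ⊤ d.range
  let B : AddSubgroup (M × I) := AddSubgroup.prod d.ker ⊥
  have key := herbrand_eq (f := f) (g := g) hfg hgf (A := A) (B := B) ?_ ?_ ?_ ?_ ?_ ?_ ?_ ?_ ?_
  rotate_left
  · rintro ⟨m, i⟩ ⟨-, hi⟩
    have hi : i = 0 := hi
    subst hi
    exact ⟨trivial, AddSubgroup.zero_mem _⟩
  · rintro ⟨m, _⟩ ⟨-, ⟨n, rfl⟩⟩
    refine ⟨trivial, σ n - n + m, ?_⟩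
    change _ = τ (d n) - d n + d m
    rw [map_add, map_sub, hd]
  · rintro ⟨m, i⟩ ⟨hm, hi⟩
    have hi : i = 0 := hi
    have hm : d m = 0 := hm
    subst hi
    refine ⟨?_, ?_⟩
    · change d (N m) = 0
      rw [hdN, hm, map_zero]
    · change τ 0 - 0 + d m = 0
      rw [hm, map_zero]; simp
  · rintro ⟨m, _⟩ ⟨-, ⟨n, rfl⟩⟩
    refine ⟨trivial, N n - m, ?_⟩
    change _ = R (d n) - d m
    rw [map_sub, hdN]
  · rintro ⟨m, i⟩ ⟨hm, hi⟩
    have hi : i = 0 := hi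
    have hm : d m = 0 := hm
    subst hi
    refine ⟨?_, ?_⟩
    · change d (σ m - m) = 0
      rw [map_sub, hd, hm, map_zero, sub_zero]
    · change R 0 - d m = 0
      rw [hm, map_zero]; simp
  · have : A = d.range.comap (AddMonoidHom.snd M I) := by
      ext x; exact ⟨fun h => h.2, fun h => ⟨trivial, h⟩⟩
    rw [this, AddSubgroup.index_comap_of_surjective _ Prod.snd_surjective]
    exact hidx
  · have : Finite ((d.ker : Set M) ×ˢ ((⊥ : AddSubgroup I) : Set I) : Set (M × I)) := by
      have h1 : (d.ker : Set M).Finite := Set.toFinite _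
      exact (h1.prod (by rw [AddSubgroup.coe_bot]; exact Set.finite_singleton _)).to_subtype
    exact this
  · rintro ⟨m, _⟩ ⟨-, ⟨n, rfl⟩⟩ ⟨h1, h2⟩
    have h2 : R (d n) - d m = 0 := h2
    refine ⟨(n, 0), ⟨trivial, AddSubgroup.zero_mem _⟩, ?_, ?_⟩
    · change d (m - N n) = 0
      rw [map_sub, hdN, ← neg_sub, h2, neg_zero]
    · change d n - (τ 0 - 0 + d n) = 0
      rw [map_zero]; simp
  · rintro ⟨m, _⟩ ⟨-, ⟨n, rfl⟩⟩ ⟨h1, h2⟩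
    have h2 : τ (d n) - d n + d m = 0 := h2
    refine ⟨(-n, 0), ⟨trivial, AddSubgroup.zero_mem _⟩, ?_, ?_⟩
    · change d (m - (σ (-n) - (-n))) = 0
      rw [map_sub, map_sub, hd, map_neg, map_neg, ← h2]; abel
    · change d n - (R 0 - d (-n)) = 0
      rw [map_zero, map_neg]; abel
  -- identify a
  set W' : AddSubgroup M := R.range.comap d ⊓ fix σ with hW
  have hNW : N.range ≤ W' ⊓ F1 := by
    rintro _ ⟨m, rfl⟩
    refine ⟨⟨⟨d m, (hdN m).symm⟩, hF1 (hN1 m)⟩, hN1 m⟩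
  have ea : g.range.relIndex f.ker = N.range.relIndex W' := by
    rw [index_split (AddMonoidHom.fst M I)]
    · have e1 : g.range.map (AddMonoidHom.fst M I) = N.range := by
        ext m; constructor
        · rintro ⟨_, ⟨⟨n, i⟩, rfl⟩, rfl⟩
          exact ⟨n, rfl⟩
        · rintro ⟨n, rfl⟩
          exact ⟨_, ⟨(n, 0), rfl⟩, rfl⟩
      have e2 : f.ker.map (AddMonoidHom.fst M I) = W' := by
        ext m; constructor
        · rintro ⟨⟨n, i⟩, h, rfl⟩
          have h : (σ n - n, R i - d n) = (0 : M × I) := h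
          rw [Prod.mk_eq_zero] at h
          exact ⟨⟨i, sub_eq_zero.mp h.2⟩, mem_fix.mpr (sub_eq_zero.mp h.1)⟩
        · rintro ⟨⟨i, hi⟩, h⟩
          refine ⟨(m, i), ?_, rfl⟩
          change (σ m - m, R i - d m) = (0 : M × I)
          rw [Prod.mk_eq_zero]
          exact ⟨sub_eq_zero.mpr (mem_fix.mp h), sub_eq_zero.mpr hi⟩
      have e3 : (g.range ⊓ (AddMonoidHom.fst M I).ker).relIndex (f.ker ⊓ (AddMonoidHom.fst M I).ker) = 1 := by
        rw [AddSubgroup.relIndex_eq_one]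
        rintro ⟨m, i⟩ ⟨h1, h2⟩
        have h2 : m = 0 := h2
        subst h2
        have h1 : (σ 0 - 0, R i - d 0) = (0 : M × I) := h1
        rw [Prod.mk_eq_zero, map_zero, sub_zero, map_zero d, sub_zero] at h1
        obtain ⟨j, rfl⟩ := HI i h1.2
        refine ⟨⟨(0, j), ?_⟩, rfl⟩
        rw [hg, d2_apply]; simp
      rw [e1, e2, e3, mul_one]
    · rintro _ ⟨x, rfl⟩
      exact hfg x
  have eb : f.range.relIndex g.ker = (R.range ⊔ (fix σ).map d).relIndex (fix τ) := by
    have e1 : g.ker = (fix τ).map (AddMonoidHom.inr M I) ⊔ f.range := by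
      apply le_antisymm
      · rintro ⟨m, i⟩ h
        have h : (N m, τ i - i + d m) = (0 : M × I) := h
        rw [Prod.mk_eq_zero] at h
        obtain ⟨n, rfl⟩ := H90 m h.1
        have e : ((σ n - n, i) : M × I) = (0, i + d n) + f (n, 0) := by
          rw [hf, d1_apply]; simp
        rw [e]
        refine AddSubgroup.add_mem_sup ⟨i + d n, ?_, rfl⟩ ⟨_, rfl⟩
        refine mem_fix.mpr ?_
        have h2 := h.2
        rw [map_sub, hd] at h2
        rw [← sub_eq_zero, map_add, ← h2]; abel
      · refine sup_le ?_ ?_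
        · rintro _ ⟨i, hi, rfl⟩
          change g (0, i) = 0
          rw [hg, d2_apply, mem_fix.mp hi]; simp
        · rintro _ ⟨x, rfl⟩
          exact hgf x
    rw [e1, AddSubgroup.relIndex_sup_right, ← AddSubgroup.relIndex_comap]
    congr 1
    apply le_antisymm
    · rintro i ⟨⟨m, j⟩, h⟩
      have h : (σ m - m, R j - d m) = (0, i) := h
      rw [Prod.mk.injEq] at h
      rw [← h.2, sub_eq_add_neg, ← map_neg]
      exact AddSubgroup.add_mem_sup ⟨j, rfl⟩ ⟨-m, AddSubgroup.neg_mem _ (mem_fix.mpr (sub_eq_zero.mp h.1)), rfl⟩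
    · refine sup_le ?_ ?_
      · rintro _ ⟨j, rfl⟩
        refine ⟨(0, j), ?_⟩
        rw [hf, d1_apply]; simp
      · rintro _ ⟨m, hm, rfl⟩
        refine ⟨(-m, 0), ?_⟩
        have hm := mem_fix.mp hm
        rw [hf, d1_apply]; simp [hm]
  rw [ea, eb] at key
  have hfixd : (fix σ).map d ≤ fix τ := by
    rintro _ ⟨m, hm, rfl⟩
    rw [mem_fix, ← hd, mem_fix.mp hm]
  have hRfix : R.range ≤ fix τ := by
    rintro _ ⟨i, rfl⟩
    exact mem_fix.mpr (hτR i)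
  have c1 : (R.range ⊔ F1.map d).relIndex (fix τ) = 
      (F1 ⊔ W').relIndex (fix σ) * (R.range ⊔ (fix σ).map d).relIndex (fix τ) := by
    rw [← AddSubgroup.relIndex_mul_relIndex (R.range ⊔ F1.map d) (R.range ⊔ (fix σ).map d) (fix τ) 
      (sup_le_sup_left (AddSubgroup.map_mono hF1) _) (sup_le hRfix hfixd)]
    congr 1
    have e1 : R.range ⊔ (fix σ).map d = (fix σ).map d ⊔ (R.range ⊔ F1.map d) := by
      rw [sup_comm, sup_comm R.range, ← sup_assoc, sup_eq_left.mpr (AddSubgroup.map_mono (f := d) hF1)]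
    rw [e1, AddSubgroup.relIndex_sup_right, ← AddSubgroup.relIndex_comap, ← AddSubgroup.inf_relIndex_right]
    congr 1
    apply le_antisymm
    · rintro m ⟨hm1, hm2⟩
      obtain ⟨i, hi, j, ⟨n, hn, rfl⟩, hij⟩ := AddSubgroup.mem_sup.mp hm1
      rw [← sub_add_cancel m n, add_comm]
      refine AddSubgroup.add_mem_sup hn ⟨?_, AddSubgroup.sub_mem _ hm2 (hF1 hn)⟩
      change d (m - n) ∈ R.range
      rw [map_sub, ← hij, add_sub_cancel_right]
      exact hi
    · refine sup_le (le_inf ?_ hF1) (inf_le_inf_right _ ?_)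
      · intro m hm
        exact AddSubgroup.mem_sup_right ⟨m, hm, rfl⟩
      · intro m hm
        exact AddSubgroup.mem_sup_left hm
  have c2 : (W' ⊓ F1).relIndex W' * (F1 ⊔ W').relIndex (fix σ) = q := by
    rw [← hFq, AddSubgroup.inf_relIndex_left, ← AddSubgroup.relIndex_sup_left, 
      AddSubgroup.relIndex_mul_relIndex _ _ _ le_sup_left (sup_le hF1 inf_le_right)]
  have c3 : N.range.relIndex (W' ⊓ F1) * (W' ⊓ F1).relIndex W' = N.range.relIndex W' := 
    AddSubgroup.relIndex_mul_relIndex _ _ _ hNW inf_le_left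
  have c4 : (R.range ⊔ F1.map d).relIndex (fix τ) = N.range.relIndex (W' ⊓ F1) * q := by
    rw [c1, ← key, ← c3, ← c2]; ring
  rw [c4] at hX hX0
  have ht : N.range.relIndex (W' ⊓ F1) = 1 := by
    have h0 : N.range.relIndex (W' ⊓ F1) ≠ 0 := left_ne_zero_of_mul hX0
    have : N.range.relIndex (W' ⊓ F1) ≤ 1 := by
      by_contra h
      push Not at h
      nlinarith
    omega
  rw [AddSubgroup.relIndex_eq_one] at ht
  exact ht ⟨⟨hcR, hF1 hc⟩, hc⟩

end HB


set_option linter.unusedSectionVars false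

namespace DV
open IsDedekindDomain
open scoped Pointwise
variable {O F : Type} [CommRing O] [IsDedekindDomain O] [Field F] [Algebra O F] 
    [IsFractionRing O F]
variable {O' L : Type} [CommRing O'] [IsDedekindDomain O'] [Field L] [Algebra O' L] 
    [IsFractionRing O' L]
variable [Algebra F L]

/-- What we need to know about the primes in a cyclic unramified extension. -/
structure ExtP (q : ℕ) (σ : L ≃ₐ[F] L) (pr : HeightOneSpectrum O' → HeightOneSpectrum O) 
    (act : HeightOneSpectrum O' → HeightOneSpectrum O') : Prop where
  nu_act : ∀ w, ∀ x : L, nu (act w) (σ x) = nu w x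
  nu_pr : ∀ w, ∀ x : F, nu w (algebraMap F L x) = nu (pr w) x
  pr_act : ∀ w, pr (act w) = pr w
  trans : ∀ w w', pr w = pr w' → ∃ i : ℕ, w' = act^[i] w
  pow : ∀ w, act^[q] w = w
  surj : Function.Surjective pr
  le : ∀ w, Nq (pr w) ≤ Nq w
  inert : ∀ w, act w = w → Nq (pr w) ^ 2 ≤ Nq w

section act
variable {G : Type} [Group G] [MulSemiringAction G O']

def actP (g : G) (w : HeightOneSpectrum O') : HeightOneSpectrum O' where
  asIdeal := g • w.asIdeal
  isPrime := inferInstance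
  ne_bot := by
    intro h
    apply w.ne_bot
    rw [← inv_smul_smul g w.asIdeal, h]
    simp

lemma actP_mul (g h : G) (w : HeightOneSpectrum O') : actP (g * h) w = actP g (actP h w) := by
  ext1; exact mul_smul g h w.asIdeal

lemma actP_one (w : HeightOneSpectrum O') : actP (1 : G) w = w := by
  ext1; exact one_smul G w.asIdeal

lemma actP_iter (g : G) (w : HeightOneSpectrum O') (n : ℕ) : (actP g)^[n] w = actP (g ^ n) w := by
  induction n with
  | zero => simp [actP_one]
  | succ n ih => rw [Function.iterate_succ_apply', ih, pow_succ', actP_mul]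

variable [MulSemiringAction G L] [SMulDistribClass G O' L]

lemma nu_actP (g : G) (w : HeightOneSpectrum O') (x : L) : nu (actP g w) (g • x) = nu w x := by
  have key : ∀ f : O', f ≠ 0 → nu (actP g w) (algebraMap O' L (g • f)) = nu w (algebraMap O' L f) := by
    intro f hf
    have hgf : g • f ≠ 0 := (smul_ne_zero_iff_ne g).mpr hf
    have h1 : ∀ n : ℕ, (n : ℤ) ≤ nu (actP g w) (algebraMap O' L (g • f)) ↔ (n : ℤ) ≤ nu w (algebraMap O' L f) := by
      intro n
      rw [le_nu_alg_iff _ hgf, le_nu_alg_iff _ hf]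
      change g • f ∈ (g • w.asIdeal) ^ n ↔ _
      rw [← smul_pow', Ideal.smul_mem_pointwise_smul_iff]
    have h2 := nu_alg_nonneg (F := L) (actP g w) (g • f)
    have h3 := nu_alg_nonneg (F := L) w f
    have h4 := (h1 (nu w (algebraMap O' L f)).toNat).mpr (by rw [Int.toNat_of_nonneg h3])
    have h5 := (h1 (nu (actP g w) (algebraMap O' L (g • f))).toNat).mp (by rw [Int.toNat_of_nonneg h2])
    rw [Int.toNat_of_nonneg h3] at h4
    rw [Int.toNat_of_nonneg h2] at h5
    exact le_antisymm h5 h4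
  obtain ⟨f, m, hm, rfl⟩ := IsFractionRing.div_surjective (A := O') x
  have hm0 : m ≠ 0 := nonZeroDivisors.ne_zero hm
  by_cases hf : f = 0
  · simp [hf, nu_zero]
  rw [smul_div₀', ← algebraMap.coe_smul', ← algebraMap.coe_smul', nu_div _ (alg_ne ((smul_ne_zero_iff_ne g).mpr hf)) (alg_ne ((smul_ne_zero_iff_ne g).mpr hm0)),
    nu_div _ (alg_ne hf) (alg_ne hm0), key _ hf, key _ hm0]

variable [Algebra O O'] [Algebra O L] [IsScalarTower O F L] [IsScalarTower O O' L] 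
  [Module.Finite O O'] [Finite G] [IsGaloisGroup G O O']

variable (O) in
def prP (hinj : Function.Injective (algebraMap O O')) (w : HeightOneSpectrum O') : HeightOneSpectrum O where
  asIdeal := w.asIdeal.under O
  isPrime := inferInstance
  ne_bot := by
    have : FaithfulSMul O O' := (faithfulSMul_iff_algebraMap_injective O O').mpr hinj
    exact Ideal.IsIntegral.comap_ne_bot _ w.ne_bot

theorem extP (q : ℕ) (hq : q.Prime) (σ : G) (hσ : ∀ g : G, g ∈ Subgroup.zpowers σ) (hG : Nat.card G = q)
    (σ' : L ≃ₐ[F] L) (hσ' : ∀ x, σ • x = σ' x)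
    (hfin : ∀ v : HeightOneSpectrum O, Finite (O ⧸ v.asIdeal))
    (hfin' : ∀ v : HeightOneSpectrum O', Finite (O' ⧸ v.asIdeal))
    (hunr : ∀ w : HeightOneSpectrum O', ∃ β : O', σ • β - β ∉ w.asIdeal) :
    ∃ pr act, ExtP (O := O) (O' := O') q σ' pr act := by
  classical
  have hinj : Function.Injective (algebraMap O O') := by
    have h : Function.Injective (algebraMap O L) := by
      rw [IsScalarTower.algebraMap_eq O F L]
      exact (algebraMap F L).injective.comp (inj (O := O) (F := F))
    rw [IsScalarTower.algebraMap_eq O O' L] at h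
    exact Function.Injective.of_comp h
  have : FaithfulSMul O O' := (faithfulSMul_iff_algebraMap_injective O O').mpr hinj
  have : Module.IsTorsionFree O O' := inferInstance
  have hper : ∀ v : HeightOneSpectrum O, PerfectField v.asIdeal.ResidueField := by
    intro v
    have := hfin v
    have : Finite v.asIdeal.ResidueField := Finite.of_surjective _ 
      (Ideal.bijective_algebraMap_quotient_residueField v.asIdeal).surjective
    infer_instance
  have hI : ∀ w : HeightOneSpectrum O', Nat.card (w.asIdeal.inertia G) = 1 := by
    intro w
    have hd := Subgroup.card_subgroup_dvd_card (w.asIdeal.inertia G)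
    rw [hG] at hd
    rcases (Nat.dvd_prime hq).mp hd with h | h
    · exact h
    · exfalso
      have htop : w.asIdeal.inertia G = ⊤ := Subgroup.eq_top_of_card_eq _ (by rw [h, hG])
      obtain ⟨β, hβ⟩ := hunr w
      have : σ ∈ w.asIdeal.inertia G := by rw [htop]; trivial
      exact hβ (this β)
  have hlo : ∀ w : HeightOneSpectrum O', w.asIdeal.LiesOver (prP O hinj w).asIdeal := fun w => ⟨rfl⟩
  have he : ∀ w : HeightOneSpectrum O', (prP O hinj w).asIdeal.ramificationIdx' w.asIdeal = 1 := by
    intro w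
    have := hlo w
    have := hper (prP O hinj w)
    rw [Ideal.ramificationIdx'_eq_ramificationIdx _ _ (prP O hinj w).ne_bot,
      ← Ideal.ramificationIdxIn_eq_ramificationIdx (prP O hinj w).asIdeal w.asIdeal G,
      ← Ideal.card_inertia_eq_ramificationIdxIn (G := G) _ w.asIdeal, hI]
  have hq1 : ∀ w : HeightOneSpectrum O', Nq w = Nq (prP O hinj w) ^ (w.asIdeal.inertiaDeg O) := by
    intro w
    have := hlo w
    have := hfin' w
    have := hfin (prP O hinj w)
    have := (prP O hinj w).isMaximal
    have := w.isMaximal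
    rw [← Ideal.inertiaDeg'_eq_inertiaDeg (prP O hinj w).asIdeal w.asIdeal, Ideal.inertiaDeg'_algebraMap]
    let _ : Field (O ⧸ (prP O hinj w).asIdeal) := Ideal.Quotient.field _
    exact Module.natCard_eq_pow_finrank (K := (O ⧸ (prP O hinj w).asIdeal)) (V := O' ⧸ w.asIdeal)
  have hcount : ∀ w : HeightOneSpectrum O', ((prP O hinj w).asIdeal.primesOver O').ncard * w.asIdeal.inertiaDeg O = q := by
    intro w
    have := hlo w
    have := hper (prP O hinj w)
    have := Ideal.ncard_primesOver_mul_card_inertia_mul_finrank (G := G) (prP O hinj w).asIdeal w.asIdeal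
    rwa [hI, mul_one, hG] at this
  have hN2 : ∀ v : HeightOneSpectrum O, 1 ≤ Nq v := by
    intro v
    have := hfin v
    exact Nat.one_le_iff_ne_zero.mpr Nat.card_pos.ne'
  have hact : ∀ w : HeightOneSpectrum O', prP O hinj (actP σ w) = prP O hinj w := by
    intro w
    ext1
    exact Ideal.under_smul O w.asIdeal σ
  have htr : ∀ w w' : HeightOneSpectrum O', prP O hinj w = prP O hinj w' → ∃ i : ℕ, w' = (actP σ)^[i] w := by
    intro w w' h
    obtain ⟨g, hg⟩ := Algebra.IsInvariant.exists_smul_of_under_eq O O' G w.asIdeal w'.asIdeal (congrArg HeightOneSpectrum.asIdeal h)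
    obtain ⟨i, hi⟩ := (mem_powers_iff_mem_zpowers).mpr (hσ g)
    refine ⟨i, ?_⟩
    rw [actP_iter]
    ext1
    rw [hg, ← hi]
    rfl
  refine ⟨prP O hinj, actP σ, ?_, ?_, hact, htr, ?_, ?_, ?_, ?_⟩
  · intro w x
    rw [← hσ']; exact nu_actP σ w x
  · intro w x
    have := hlo w
    have h := HeightOneSpectrum.valuation_liesOver (K := F) L (prP O hinj w) w x
    rw [he, pow_one] at h
    rw [nu, nu, h]
  · intro w
    rw [actP_iter, ← hG, pow_card_eq_one', actP_one]
  · intro v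
    have := v.isMaximal
    obtain ⟨Q, hQ, hQ2⟩ := Ideal.exists_maximal_ideal_liesOver_of_isIntegral (S := O') v.asIdeal
    refine ⟨⟨Q, hQ.isPrime, ?_⟩, ?_⟩
    · rintro rfl
      apply v.ne_bot
      rw [hQ2.over, eq_bot_iff]
      intro x hx
      rw [Ideal.mem_comap, Ideal.mem_bot] at hx
      exact (map_eq_zero_iff _ hinj).mp hx
    · ext1
      exact hQ2.over.symm
  · intro w
    rw [hq1 w]
    refine Nat.le_self_pow ?_ _
    intro h
    have := hcount w
    rw [h, mul_zero] at this
    exact hq.ne_zero this.symm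
  · intro w hw
    rw [hq1 w]
    refine Nat.pow_le_pow_right (hN2 _) ?_
    have h1 : (prP O hinj w).asIdeal.primesOver O' = {w.asIdeal} := by
      ext Q
      constructor
      · rintro ⟨hQ, hQ2⟩
        obtain ⟨g, hg⟩ := Algebra.IsInvariant.exists_smul_of_under_eq O O' G w.asIdeal Q hQ2.over
        obtain ⟨i, hi⟩ := (mem_powers_iff_mem_zpowers).mpr (hσ g)
        have h2 : actP g w = w := by
          rw [← hi]
          change actP (σ ^ i) w = w
          rw [← actP_iter]
          exact Function.iterate_fixed hw i
        rw [Set.mem_singleton_iff, hg]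
        exact congrArg HeightOneSpectrum.asIdeal h2
      · rintro rfl
        exact ⟨w.isPrime, hlo w⟩
    have := hcount w
    rw [h1, Set.ncard_singleton, one_mul] at this
    rw [this]; exact hq.two_le
end act
end DV


set_option linter.unusedSectionVars false

namespace PermD
open Finset
variable {S S' : Type} {q : ℕ} {pr : S' → S} {act : S' → S'}

/-- cyclic action with quotient `S` -/
structure Cyc (q : ℕ) (pr : S' → S) (act : S' → S') : Prop where
  hq : q.Prime
  pr_act : ∀ w, pr (act w) = pr w
  trans : ∀ w w', pr w = pr w' → ∃ i : ℕ, w' = act^[i] w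
  pow : ∀ w, act^[q] w = w
  surj : Function.Surjective pr

variable (act) in
def tau : AddMonoid.End (S' →₀ ℤ) := Finsupp.mapDomain.addMonoidHom act
variable (q act) in
def RR : AddMonoid.End (S' →₀ ℤ) := ∑ j ∈ range q, (tau act) ^ j

@[simp] lemma tau_single (w : S') (n : ℤ) : tau act (Finsupp.single w n) = Finsupp.single (act w) n :=
  Finsupp.mapDomain_single

lemma tau_pow_single (w : S') (n : ℤ) (k : ℕ) : (tau act ^ k) (Finsupp.single w n) = Finsupp.single (act^[k] w) n := by
  induction k with
  | zero => simp
  | succ k ih => 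
    rw [pow_succ', Function.iterate_succ_apply', ← tau_single, ← ih]; rfl

lemma RR_apply (i : S' →₀ ℤ) : RR q act i = ∑ j ∈ range q, (tau act ^ j) i := by
  exact AddMonoidHom.finsetSum_apply (fun j => (tau act ^ j : AddMonoid.End (S' →₀ ℤ))) (range q) i

namespace Cyc
variable (C : Cyc q pr act)
include C

lemma tau_pow : tau act ^ q = 1 := by
  apply Finsupp.addHom_ext
  intro w n
  refine (tau_pow_single w n q).trans ?_
  rw [C.pow]; rfl

lemma tau_RR : tau act * RR q act = RR q act := by
  have := mul_geom_sum (tau act) q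
  rw [C.tau_pow, sub_self, sub_mul, one_mul, sub_eq_zero] at this
  exact this

lemma RR_tau : RR q act * tau act = RR q act := by
  have := geom_sum_mul (tau act) q
  rw [C.tau_pow, sub_self, mul_sub, mul_one, sub_eq_zero] at this
  exact this

lemma pr_iter (w : S') (k : ℕ) : pr (act^[k] w) = pr w := by
  induction k with
  | zero => rfl
  | succ k ih => rw [Function.iterate_succ_apply', C.pr_act, ih]

lemma trans' (w w' : S') (h : pr w = pr w') : ∃ i < q, w' = act^[i] w := by
  obtain ⟨i, hi⟩ := C.trans w w' h
  refine ⟨i % q, Nat.mod_lt _ C.hq.pos, ?_⟩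
  rw [hi]
  conv_lhs => rw [← Nat.mod_add_div i q]
  rw [Function.iterate_add_apply, Function.iterate_mul]
  congr 1
  exact Function.iterate_fixed (C.pow w) _

lemma fib_fin (v : S) : {w | pr w = v}.Finite := by
  obtain ⟨w, rfl⟩ := C.surj v
  refine ((range q).finite_toSet.image (fun i => act^[i] w)).subset ?_
  intro w' hw'
  obtain ⟨i, hi, h⟩ := C.trans' w w' hw'.symm
  exact ⟨i, by simpa using hi, h.symm⟩

lemma fib_card (v : S) (T : Finset S') (hT : ∀ w ∈ T, pr w = v) : T.card ≤ q := by
  classical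
  obtain ⟨w, rfl⟩ := C.surj v
  have : T ⊆ (range q).image (fun i => act^[i] w) := by
    intro w' hw'
    obtain ⟨i, hi, h⟩ := C.trans' w w' (hT w' hw').symm
    simp only [mem_image, mem_range]
    exact ⟨i, hi, h.symm⟩
  exact (card_le_card this).trans (card_image_le.trans (by simp))

def DD : (S →₀ ℤ) →+ (S' →₀ ℤ) where
  toFun δ := Finsupp.ofSupportFinite (fun w => δ (pr w)) (by
    refine (Set.Finite.biUnion (δ.support.finite_toSet) (fun v _ => C.fib_fin v)).subset ?_
    intro w hw
    simp only [Set.mem_iUnion]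
    exact ⟨pr w, by simpa using hw, rfl⟩)
  map_zero' := by ext; rfl
  map_add' := by intro x y; ext; rfl

lemma DD_apply (δ : S →₀ ℤ) (w : S') : C.DD δ w = δ (pr w) := rfl

lemma act_inj : Function.Injective act := by
  intro w w' h
  have h1 := C.pow w
  have h2 := C.pow w'
  obtain ⟨n, hn⟩ : ∃ n, q = n + 1 := ⟨q - 1, by have := C.hq.pos; omega⟩
  rw [hn, Function.iterate_succ_apply] at h1 h2
  rw [← h1, ← h2, h]

lemma act_surj : Function.Surjective act := by
  intro w
  have h1 := C.pow w
  obtain ⟨n, hn⟩ : ∃ n, q = n + 1 := ⟨q - 1, by have := C.hq.pos; omega⟩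
  rw [hn, Function.iterate_succ_apply'] at h1
  exact ⟨_, h1⟩

lemma tau_apply (i : S' →₀ ℤ) (w : S') : tau act i (act w) = i w := 
  Finsupp.mapDomain_apply C.act_inj i w

lemma DD_fix (δ : S →₀ ℤ) : tau act (C.DD δ) = C.DD δ := by
  ext w
  obtain ⟨w, rfl⟩ := C.act_surj w
  rw [C.tau_apply, DD_apply, DD_apply, C.pr_act]

lemma DD_surj (i : S' →₀ ℤ) (hi : tau act i = i) : ∃ δ, C.DD δ = i := by
  have h1 : ∀ w, i (act w) = i w := by
    intro w
    conv_lhs => rw [← hi]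
    exact C.tau_apply i w
  have h2 : ∀ w (k : ℕ), i (act^[k] w) = i w := by
    intro w k
    induction k with
    | zero => rfl
    | succ k ih => rw [Function.iterate_succ_apply', h1, ih]
  have h3 : ∀ w w', pr w = pr w' → i w = i w' := by
    intro w w' h
    obtain ⟨k, rfl⟩ := C.trans w w' h
    rw [h2]
  let ρ := Function.surjInv C.surj
  have hρ : ∀ v, pr (ρ v) = v := Function.surjInv_eq C.surj
  refine ⟨Finsupp.ofSupportFinite (fun v => i (ρ v)) ?_, ?_⟩
  · refine (i.support.finite_toSet.image pr).subset ?_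
    intro v hv
    exact ⟨ρ v, by simpa using hv, hρ v⟩
  · ext w
    rw [DD_apply]
    exact h3 _ _ (hρ _)

lemma RR_single_split (w : S') (hw : act w ≠ w) : RR q act (Finsupp.single w 1) = C.DD (Finsupp.single (pr w) 1) := by
  classical
  have hper : Function.minimalPeriod act w = q := by
    have hd : Function.minimalPeriod act w ∣ q := Function.IsPeriodicPt.minimalPeriod_dvd (C.pow w)
    rcases (Nat.dvd_prime C.hq).mp hd with h | h
    · exact absurd (Function.minimalPeriod_eq_one_iff_isFixedPt.mp h) hw
    · exact h
  ext w'
  rw [RR_apply, Finsupp.finsetSum_apply, DD_apply]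
  simp only [tau_pow_single]
  by_cases h : pr w = pr w'
  · obtain ⟨k, hk, rfl⟩ := C.trans' w w' h
    rw [← h, Finsupp.single_eq_same, sum_eq_single k, Finsupp.single_eq_same]
    · intro j hj hjk
      refine Finsupp.single_eq_of_ne ?_
      intro he
      refine hjk (Function.iterate_injOn_Iio_minimalPeriod (f := act) (x := w) ?_ ?_ he.symm)
      · rw [hper]; simpa using hj
      · rw [hper]; simpa using hk
    · intro h; simp at h; omega
  · rw [Finsupp.single_eq_of_ne (fun h' => h h'.symm)]
    refine sum_eq_zero (fun j _ => Finsupp.single_eq_of_ne ?_)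
    rintro rfl
    exact h (C.pr_iter w j).symm

lemma RR_single_inert (w : S') (hw : act w = w) : RR q act (Finsupp.single w 1) = C.DD (q • Finsupp.single (pr w) 1) := by
  classical
  have h1 : C.DD (Finsupp.single (pr w) 1) = Finsupp.single w 1 := by
    ext w'
    rw [DD_apply]
    by_cases h : pr w = pr w'
    · obtain ⟨k, rfl⟩ := C.trans w w' h
      rw [Function.iterate_fixed hw k, Finsupp.single_eq_same, Finsupp.single_eq_same]
    · rw [Finsupp.single_eq_of_ne (fun h' => h h'.symm), Finsupp.single_eq_of_ne]
      rintro rfl; exact h rfl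
  rw [map_nsmul, h1, RR_apply]
  simp only [tau_pow_single, Function.iterate_fixed hw, sum_const, card_range]

/-- `H^{-1}` of the divisor group vanishes. -/
lemma HI (i : S' →₀ ℤ) (hi : RR q act i = 0) : ∃ j, i = tau act j - j := by
  classical
  let ρ := Function.surjInv C.surj
  have hρ : ∀ v, pr (ρ v) = v := Function.surjInv_eq C.surj
  have key : ∀ i : S' →₀ ℤ, ∃ j, Finsupp.mapDomain ρ (Finsupp.mapDomain pr i) - i = tau act j - j := by
    intro i
    induction i using Finsupp.induction_linear with
    | zero => exact ⟨0, by simp⟩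
    | add f g hf hg =>
      obtain ⟨j, hj⟩ := hf
      obtain ⟨j', hj'⟩ := hg
      refine ⟨j + j', ?_⟩
      rw [Finsupp.mapDomain_add, Finsupp.mapDomain_add, map_add, add_sub_add_comm, hj, hj']
      abel
    | single w n =>
      rw [Finsupp.mapDomain_single, Finsupp.mapDomain_single]
      obtain ⟨k, hk⟩ := C.trans w (ρ (pr w)) (hρ _).symm
      rw [hk]
      have : ∀ k : ℕ, ∃ j, Finsupp.single (act^[k] w) n - Finsupp.single w n = tau act j - j := by
        intro k
        induction k with
        | zero => exact ⟨0, by simp⟩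
        | succ k ih =>
          obtain ⟨j, hj⟩ := ih
          refine ⟨j + Finsupp.single (act^[k] w) n, ?_⟩
          rw [map_add, tau_single, Function.iterate_succ_apply', add_sub_add_comm, ← hj]
          abel
      exact this k
  have h1 : Finsupp.mapDomain pr (RR q act i) = q • Finsupp.mapDomain pr i := by
    rw [RR_apply, Finsupp.mapDomain_finsetSum]
    have : ∀ j : ℕ, Finsupp.mapDomain pr ((tau act ^ j) i) = Finsupp.mapDomain pr i := by
      intro j
      induction j with
      | zero => rfl
      | succ j ih =>
        rw [pow_succ', ← ih]
        change Finsupp.mapDomain pr (Finsupp.mapDomain act ((tau act ^ j) i)) = _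
        rw [← Finsupp.mapDomain_comp]
        congr 1
        funext w; exact C.pr_act w
    rw [sum_congr rfl (fun j _ => this j), sum_const, card_range]
  rw [hi, Finsupp.mapDomain_zero] at h1
  have h2 : Finsupp.mapDomain pr i = 0 := by
    ext v
    have := DFunLike.congr_fun h1 v
    simp only [Finsupp.coe_zero, Pi.zero_apply, Finsupp.coe_smul, Pi.smul_apply, nsmul_eq_mul] at this
    rcases mul_eq_zero.mp this.symm with h | h
    · exact absurd (by exact_mod_cast h) C.hq.ne_zero
    · exact h
  obtain ⟨j, hj⟩ := key i
  refine ⟨-j, ?_⟩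
  rw [h2, Finsupp.mapDomain_zero, zero_sub] at hj
  rw [map_neg, ← neg_neg i, hj]
  abel

end Cyc
end PermD


set_option linter.unusedSectionVars false

namespace DV
open IsDedekindDomain PermD
variable {O F : Type} [CommRing O] [IsDedekindDomain O] [Field F] [Algebra O F] 
    [IsFractionRing O F] {P : FFPrime F}
variable {O' L : Type} [CommRing O'] [IsDedekindDomain O'] [Field L] [Algebra O' L] 
    [IsFractionRing O' L] {P' : FFPrime L}
variable [Algebra F L] {q : ℕ} {σ : L ≃ₐ[F] L} {pr : HeightOneSpectrum O' → HeightOneSpectrum O}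
    {act : HeightOneSpectrum O' → HeightOneSpectrum O'}

lemma ExtP.cyc (E : ExtP q σ pr act) (hq : q.Prime) : Cyc q pr act := ⟨hq, E.pr_act, E.trans, E.pow, E.surj⟩

def sM (σ : L ≃ₐ[F] L) : Additive Lˣ →+ Additive Lˣ := MonoidHom.toAdditive (Units.map (σ : L →* L))
variable (F L) in
def iM : Additive Fˣ →+ Additive Lˣ := MonoidHom.toAdditive (Units.map (algebraMap F L : F →* L))
variable (F L) in
def NM0 : Additive Lˣ →+ Additive Fˣ := MonoidHom.toAdditive (Units.map (Algebra.norm F : L →* F))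
variable (F L) in
def NM : Additive Lˣ →+ Additive Lˣ := (iM F L).comp (NM0 F L)

lemma iM_inj : Function.Injective (iM F L) := by
  intro x y h
  have h1 := congrArg (fun z : Additive Lˣ => ((Additive.toMul z : Lˣ) : L)) h
  exact Additive.toMul.injective (Units.ext ((algebraMap F L).injective h1))

lemma index_F1 (P : FFPrime F) (q : ℕ) : (F1 P q).index = q := by
  let f : Additive Fˣ →+ ℤ := 
    { toFun := fun x => P.o ((Additive.toMul x : Fˣ) : F)
      map_zero' := P.o_one
      map_add' := fun x y => P.o_mul (Units.ne_zero _) (Units.ne_zero _) }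
  have hf : Function.Surjective f := by
    intro n
    obtain ⟨π, h0, h1⟩ := P.exists_unif
    refine ⟨Additive.ofMul (Units.mk0 π h0 ^ n), ?_⟩
    change P.o ((Units.mk0 π h0 ^ n : Fˣ) : F) = n
    rw [Units.val_zpow_eq_zpow_val, Units.val_mk0, P.o_zpow h0, h1, mul_one]
  have : F1 P q = (AddSubgroup.zmultiples (q : ℤ)).comap f := by
    ext x
    rw [AddSubgroup.mem_comap, Int.mem_zmultiples_iff]
    rfl
  rw [this, AddSubgroup.index_comap_of_surjective _ hf, Int.index_zmultiples, Int.natAbs_natCast]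

variable [FiniteDimensional F L] [IsGalois F L]

lemma norm_prod (hσ : ∀ g : L ≃ₐ[F] L, g ∈ Subgroup.zpowers σ) (hcard : Nat.card (L ≃ₐ[F] L) = q) (y : L) : 
    algebraMap F L (Algebra.norm F y) = ∏ j ∈ Finset.range q, (σ ^ j) y := by
  classical
  rw [Algebra.norm_eq_prod_automorphisms]
  have h1 := IsCyclic.image_range_card hσ
  rw [hcard] at h1
  rw [← h1, Finset.prod_image]
  have h2 : orderOf σ = q := by rw [← hcard]; exact orderOf_eq_card_of_forall_mem_zpowers hσ
  intro i hi j hj hij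
  refine pow_injOn_Iio_orderOf ?_ ?_ hij
  · rw [h2]; simpa using hi
  · rw [h2]; simpa using hj

lemma norm_sum (hσ : ∀ g : L ≃ₐ[F] L, g ∈ Subgroup.zpowers σ) (hcard : Nat.card (L ≃ₐ[F] L) = q) (m : Additive Lˣ) : 
    NM F L m = ∑ j ∈ Finset.range q, (sM σ)^[j] m := by
  have h : ∀ j : ℕ, (((sM σ)^[j] m).toMul : Lˣ) = Units.map ((σ ^ j : L ≃ₐ[F] L) : L →* L) m.toMul := by
    intro j
    induction j with
    | zero => ext; rfl
    | succ j ih =>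
      rw [Function.iterate_succ_apply']
      change Units.map (σ : L →* L) (((sM σ)^[j] m).toMul : Lˣ) = _
      rw [ih, pow_succ']
      ext; rfl
  apply Additive.toMul.injective
  rw [toMul_sum]
  ext
  rw [Units.coe_prod, Finset.prod_congr rfl (fun j _ => by rw [h j])]
  exact norm_prod hσ hcard _

lemma fix_sM (hσ : ∀ g : L ≃ₐ[F] L, g ∈ Subgroup.zpowers σ) : HB.fix (sM σ) = (iM F L).range := by
  ext m
  rw [HB.mem_fix]
  constructor
  · intro h
    have h1 : σ (m.toMul : Lˣ) = ((m.toMul : Lˣ) : L) := congrArg (fun z : Additive Lˣ => ((Additive.toMul z : Lˣ) : L)) h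
    have h2 : ∀ g : L ≃ₐ[F] L, g (m.toMul : Lˣ) = ((m.toMul : Lˣ) : L) := by
      intro g
      have h3 : σ ∈ MulAction.stabilizer (L ≃ₐ[F] L) ((m.toMul : Lˣ) : L) := h1
      exact (Subgroup.zpowers_le.mpr h3) (hσ g)
    obtain ⟨x, hx⟩ := (IsGalois.mem_range_algebraMap_iff_fixed (F := F) _).mpr h2
    have hx0 : x ≠ 0 := by
      rintro rfl
      rw [map_zero] at hx
      exact Units.ne_zero _ hx.symm
    refine ⟨Additive.ofMul (Units.mk0 x hx0), ?_⟩
    apply Additive.toMul.injective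
    ext
    exact hx
  · rintro ⟨x, rfl⟩
    apply Additive.toMul.injective
    ext
    exact σ.commutes _

theorem exists_norm (A : Arith O P) (A' : Arith O' P') (hq : q.Prime) (E : ExtP q σ pr act)
    (hσ : ∀ g : L ≃ₐ[F] L, g ∈ Subgroup.zpowers σ) (hcard : Nat.card (L ≃ₐ[F] L) = q)
    (hnorm : ∀ y : L, y ≠ 0 → P.o (Algebra.norm F y) = q * P'.o y) 
    (c : F) (hc : c ≠ 0) (hcP : (q : ℤ) ∣ P.o c) (hcs : ∀ w, (q : ℤ) ∣ nu (pr w) c ∨ act w ≠ w) : 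
    ∃ y : L, Algebra.norm F y = c := by
  classical
  have C := E.cyc hq
  have hd : ∀ m, dvh O' L (sM σ m) = tau act (dvh O' L m) := by
    intro m
    ext w
    obtain ⟨w, rfl⟩ := C.act_surj w
    rw [C.tau_apply]
    exact E.nu_act w _
  have hdj : ∀ m (j : ℕ), dvh O' L ((sM σ)^[j] m) = (tau act ^ j) (dvh O' L m) := by
    intro m j
    induction j with
    | zero => rfl
    | succ j ih => rw [Function.iterate_succ_apply', hd, ih, pow_succ']; rfl
  have hdN : ∀ m, dvh O' L (NM F L m) = RR q act (dvh O' L m) := by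
    intro m
    rw [norm_sum hσ hcard, map_sum, RR_apply]
    exact Finset.sum_congr rfl (fun j _ => hdj m j)
  have hdi : ∀ x : Additive Fˣ, dvh O' L (iM F L x) = C.DD (dvh O F x) := by
    intro x
    ext w
    exact E.nu_pr w _
  have hfix := fix_sM (F := F) hσ
  have hDsingle : ∀ w, act w ≠ w → C.DD (Finsupp.single (pr w) 1) ∈ (AddMonoidHom.range (RR q act)) := by
    intro w hw
    exact ⟨_, C.RR_single_split w hw⟩
  have hHn1 : (dvh O' L).range = Hn O' P' 1 := by
    ext D
    rw [mem_Hn]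
    constructor
    · rintro ⟨x, rfl⟩
      exact ⟨_, Units.ne_zero _, by simp, rfl⟩
    · rintro ⟨x, hx, -, rfl⟩
      exact ⟨Additive.ofMul (Units.mk0 x hx), rfl⟩
  -- the quotient
  let J : AddSubgroup (HeightOneSpectrum O' →₀ ℤ) := (AddMonoidHom.range (RR q act)) ⊔ ((F1 P q).map (iM F L)).map (dvh O' L)
  let X := HB.fix (tau act) ⧸ J.addSubgroupOf (HB.fix (tau act))
  let φ0 : (HeightOneSpectrum O →₀ ℤ) →+ HB.fix (tau act) := C.DD.codRestrict _ (fun δ => HB.mem_fix.mpr (C.DD_fix δ))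
  let φ : (HeightOneSpectrum O →₀ ℤ) →+ X := (QuotientAddGroup.mk' _).comp φ0
  have hφ : Function.Surjective φ := by
    refine (QuotientAddGroup.mk'_surjective _).comp ?_
    rintro ⟨i, hi⟩
    obtain ⟨δ, hδ⟩ := C.DD_surj i (HB.mem_fix.mp hi)
    exact ⟨δ, Subtype.ext hδ⟩
  have hφ0 : ∀ δ, C.DD δ ∈ J → φ δ = 0 := by
    intro δ hδ
    exact (QuotientAddGroup.eq_zero_iff _).mpr hδ
  have hH : ∀ D ∈ Hn O P q, φ D = 0 := by
    rintro D ⟨x, hx, rfl⟩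
    apply hφ0
    refine AddSubgroup.mem_sup_right ?_
    rw [← hdi]
    exact ⟨_, ⟨x, hx, rfl⟩, rfl⟩
  have hfinX : Finite X := by
    have := finite_Cn A q hq.pos
    refine Finite.of_surjective (QuotientAddGroup.lift (Hn O P q) φ hH) ?_
    intro x
    obtain ⟨D, rfl⟩ := hφ x
    exact ⟨(D : Cn O P q), rfl⟩
  let _ : Fintype X := Fintype.ofFinite X
  have hcardX : Fintype.card X ≤ q := by
    refine first_ineq A A' q hq.pos φ hφ hH pr q (fun v T hT => C.fib_card v T hT) E.le ?_
    intro w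
    by_cases hw : act w = w
    · exact Or.inr (E.inert w hw)
    · exact Or.inl (hφ0 _ (AddSubgroup.mem_sup_left (hDsingle w hw)))
  have hXr : J.relIndex (HB.fix (tau act)) = Nat.card X := rfl
  let cc : Additive Fˣ := Additive.ofMul (Units.mk0 c hc)
  have hres : iM F L cc ∈ (NM F L).range := by
    refine HB.norm_thm (sM σ) (NM F L) (tau act) (RR q act) (dvh O' L) hd hdN ?_ ?_ ?_ ?_ ?_ C.HI ?_ ?_ 
      ((F1 P q).map (iM F L)) ?_ ?_ q hq.pos ?_ ?_ ?_ _ ?_ ?_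
    · intro m
      change iM F L (NM0 F L (sM σ m)) = iM F L (NM0 F L m)
      congr 1
      apply Additive.toMul.injective
      ext
      exact Algebra.norm_eq_of_algEquiv σ _
    · intro m
      apply Additive.toMul.injective
      ext
      exact σ.commutes _
    · intro i; exact DFunLike.congr_fun C.RR_tau i
    · intro i; exact DFunLike.congr_fun C.tau_RR i
    · intro m hm
      have h1 : Algebra.norm F ((m.toMul : Lˣ) : L) = 1 := by
        have := congrArg (fun z : Additive Lˣ => ((Additive.toMul z : Lˣ) : L)) hm
        exact (algebraMap F L).injective (this.trans (map_one _).symm)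
      have : IsCyclic (L ≃ₐ[F] L) := ⟨σ, hσ⟩
      obtain ⟨y, hy⟩ := groupCohomology.exists_div_of_norm_eq_one (K := F) (L := L) hσ h1
      refine ⟨Additive.ofMul y⁻¹, ?_⟩
      apply Additive.toMul.injective
      ext
      rw [← hy]
      change _ = ((Units.map (σ : L →* L) y⁻¹ / y⁻¹ : Lˣ) : L)
      rw [map_inv, div_inv_eq_mul, Units.val_mul, Units.val_inv_eq_inv_val, mul_comm, div_eq_mul_inv]
      rfl
    · have := fin_units A'
      refine Finite.of_surjective (fun u : O'ˣ => (⟨Additive.ofMul (Units.map (algebraMap O' L : O' →* L) u), ?_⟩ : (dvh O' L).ker)) ?_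
      · rw [AddMonoidHom.mem_ker]
        ext w
        have h1 := nu_alg_nonneg (F := L) w (u : O')
        have h2 := nu_alg_nonneg (F := L) w ((u⁻¹ : O'ˣ) : O')
        have h3 : nu w (algebraMap O' L u * algebraMap O' L ((u⁻¹ : O'ˣ) : O')) = 0 := by
          rw [← map_mul, Units.mul_inv, map_one, nu_one]
        rw [nu_mul _ (alg_ne u.ne_zero) (alg_ne (u⁻¹).ne_zero)] at h3
        change nu w (algebraMap O' L u) = 0
        omega
      · rintro ⟨m, hm⟩
        have h0 : ∀ w, nu w ((m.toMul : Lˣ) : L) = 0 := fun w => DFunLike.congr_fun hm w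
        obtain ⟨f, hf⟩ := exists_alg (O := O') (x := ((m.toMul : Lˣ) : L)) (fun w => (h0 w).ge)
        obtain ⟨g, hg⟩ := exists_alg (O := O') (x := (((m.toMul : Lˣ) : L))⁻¹) (fun w => by rw [nu_inv, h0 w]; simp)
        have hfg : f * g = 1 := by
          apply inj (O := O') (F := L)
          rw [map_mul, hf, hg, map_one, mul_inv_cancel₀ (Units.ne_zero _)]
        refine ⟨⟨f, g, hfg, by rw [mul_comm, hfg]⟩, ?_⟩
        apply Subtype.ext
        apply Additive.toMul.injective
        ext
        exact hf
    · rw [hHn1]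
      have := finite_Cn A' 1 one_pos
      exact (Nat.card_pos (α := Cn O' P' 1)).ne'
    · rw [hfix]
      rintro _ ⟨x, -, rfl⟩
      exact ⟨x, rfl⟩
    · intro m
      refine ⟨NM0 F L m, ?_, rfl⟩
      change (q : ℤ) ∣ P.o (Algebra.norm F ((m.toMul : Lˣ) : L))
      rw [hnorm _ (Units.ne_zero _)]
      exact dvd_mul_right _ _
    · rw [hfix, AddMonoidHom.range_eq_map, AddSubgroup.relIndex_map_map_of_injective _ _ iM_inj, AddSubgroup.relIndex_top_right,
        index_F1]
    · change J.relIndex _ ≠ 0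
      rw [hXr]; exact Nat.card_pos.ne'
    · change J.relIndex _ ≤ q
      rw [hXr, Nat.card_eq_fintype_card]; exact hcardX
    · exact ⟨cc, hcP, rfl⟩
    · rw [hdi]
      have : dvh O F cc = (dvh O F cc).sum (fun v n => Finsupp.single v n) := (Finsupp.sum_single _).symm
      rw [this, Finsupp.sum, map_sum]
      refine sum_mem (fun v _ => ?_)
      obtain ⟨w, rfl⟩ := E.surj v
      by_cases hw : act w = w
      · rcases hcs w with h | h
        · obtain ⟨k, hk⟩ := h
          have h1 : Finsupp.single (pr w) (dvh O F cc (pr w)) = k • (q • Finsupp.single (pr w) (1 : ℤ)) := by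
            change Finsupp.single (pr w) (nu (pr w) c) = _
            rw [hk, Finsupp.smul_single, Finsupp.smul_single]
            simp [mul_comm]
          rw [h1, map_zsmul, ← C.RR_single_inert w hw]
          exact AddSubgroup.zsmul_mem (AddMonoidHom.range (RR q act)) ⟨_, rfl⟩ k
        · exact absurd hw h
      · have h1 : Finsupp.single (pr w) (dvh O F cc (pr w)) = (dvh O F cc (pr w)) • Finsupp.single (pr w) (1 : ℤ) := by
          rw [Finsupp.smul_single, smul_eq_mul, mul_one]
        rw [h1, map_zsmul]
        exact zsmul_mem (hDsingle w hw) _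
  obtain ⟨m, hm⟩ := hres
  refine ⟨(m.toMul : Lˣ), ?_⟩
  have h1 := iM_inj (F := F) (L := L) (a₁ := NM0 F L m) (a₂ := cc) hm
  exact congrArg (fun z : Additive Fˣ => ((Additive.toMul z : Fˣ) : F)) h1
end DV


set_option linter.unusedSectionVars false

namespace DV
open IsDedekindDomain PermD
variable {O F : Type} [CommRing O] [IsDedekindDomain O] [Field F] [Algebra O F] 
    [IsFractionRing O F] {P : FFPrime F}

variable (F) in
open Classical in
/-- the prime of the field attached to a prime of the ring -/
def ffp (v : HeightOneSpectrum O) : FFPrime F where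
  ord x := if x = 0 then ⊤ else ((nu v x : ℤ) : WithTop ℤ)
  ord_zero := by simp
  ord_ne_top x hx := by simp [hx]
  ord_one := by simp [nu_one]
  ord_mul x y := by
    by_cases hx : x = 0
    · simp [hx]
    by_cases hy : y = 0
    · simp [hy]
    rw [if_neg (mul_ne_zero hx hy), if_neg hx, if_neg hy, nu_mul v hx hy, WithTop.coe_add]
  ord_add x y := by
    by_cases hx : x = 0
    · simp [hx]
    by_cases hy : y = 0
    · simp [hy]
    by_cases hxy : x + y = 0
    · simp [hxy]
    rw [if_neg hx, if_neg hy, if_neg hxy, ← WithTop.coe_min, WithTop.coe_le_coe]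
    have h := (v.valuation F).map_add x y
    have h0 : ∀ z : F, z ≠ 0 → v.valuation F z ≠ 0 := fun z hz => by simpa using hz
    rw [le_max_iff, ← WithZero.log_le_log (h0 _ hxy) (h0 _ hx), ← WithZero.log_le_log (h0 _ hxy) (h0 _ hy)] at h
    simp only [nu]
    rw [min_le_iff]
    rcases h with h | h
    · left; linarith
    · right; linarith
  ord_surj n := by
    obtain ⟨x, hx, h⟩ := exists_nu_eq_one (F := F) v
    refine ⟨x ^ n, ?_⟩
    rw [if_neg (zpow_ne_zero n hx)]
    congr 1
    have : ∀ k : ℕ, nu v (x ^ k) = k := fun k => by rw [nu_pow, h, mul_one]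
    obtain ⟨k, rfl | rfl⟩ := n.eq_nat_or_neg
    · rw [zpow_natCast, this]
    · rw [zpow_neg, zpow_natCast, nu_inv, this]

lemma ffp_ord (v : HeightOneSpectrum O) {x : F} (hx : x ≠ 0) : (ffp F v).ord x = ((nu v x : ℤ) : WithTop ℤ) := if_neg hx

lemma ffp_o (v : HeightOneSpectrum O) {x : F} (hx : x ≠ 0) : (ffp F v).o x = nu v x := 
  FFPrime.o_of_ord _ (ffp_ord v hx)

lemma ffp_ne (A : Arith O P) (v : HeightOneSpectrum O) : ffp F v ≠ P := by
  rintro rfl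
  obtain ⟨x, hx⟩ := A.exP
  by_cases h0 : x = 0
  · rw [h0, map_zero, FFPrime.ord_zero] at hx; simp at hx
  · rw [ffp_ord v (alg_ne h0)] at hx
    have := nu_alg_nonneg (F := F) v x
    have h2 : nu v (algebraMap O F x) < 0 := by exact_mod_cast hx
    omega

lemma exists_denom (v : HeightOneSpectrum O) (x : F) (hx : x ≠ 0) (h : nu v x = 0) : 
    ∃ m n : O, m ∉ v.asIdeal ∧ n ∉ v.asIdeal ∧ algebraMap O F m * x = algebraMap O F n := by
  classical
  obtain ⟨f, g, hg, hfg⟩ := IsFractionRing.div_surjective (A := O) x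
  have hg0 : g ≠ 0 := nonZeroDivisors.ne_zero hg
  have hf0 : f ≠ 0 := by rintro rfl; rw [map_zero, zero_div] at hfg; exact hx hfg.symm
  let D := (dvn F g).erase v
  have h1 : ∃ m ∈ EI D, m ∉ v.asIdeal := by
    by_contra hcon
    push Not at hcon
    have h2 : EI D ≤ v.asIdeal := hcon
    rw [EI, Finsupp.prod, v.isPrime.prod_le] at h2
    obtain ⟨u, hu, h3⟩ := h2
    have h4 : u.asIdeal ≤ v.asIdeal := v.isPrime.le_of_pow_le h3
    have h5 : u = v := HeightOneSpectrum.ext (u.isMaximal.eq_of_le v.isPrime.ne_top h4)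
    rw [h5] at hu
    simp [D] at hu
  obtain ⟨m, hm, hmv⟩ := h1
  have hm0 : m ≠ 0 := by rintro rfl; exact hmv (zero_mem _)
  rw [mem_EI (F := F) hm0] at hm
  have hv : ∀ y : O, y ≠ 0 → (y ∉ v.asIdeal ↔ nu v (algebraMap O F y) = 0) := by
    intro y hy
    have := le_nu_alg_iff (F := F) v hy 1
    rw [pow_one] at this
    rw [← this]
    have := nu_alg_nonneg (F := F) v y
    push_cast; omega
  obtain ⟨n, hn⟩ : ∃ n : O, algebraMap O F n = algebraMap O F m * x := by
    refine exists_alg (fun u => ?_)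
    rw [nu_mul _ (alg_ne hm0) hx]
    by_cases huv : u = v
    · rw [huv, h]; have := nu_alg_nonneg (F := F) v m; omega
    · have h6 := hm u
      rw [show D u = dvn F g u from Finsupp.erase_ne huv, dvn_apply] at h6
      have h7 := nu_alg_nonneg (F := F) u f
      rw [← hfg, nu_div _ (alg_ne hf0) (alg_ne hg0)]
      omega
  refine ⟨m, n, hmv, ?_, hn.symm⟩
  have hn0 : n ≠ 0 := by
    rintro rfl
    rw [map_zero] at hn
    exact mul_ne_zero (alg_ne hm0) hx hn.symm
  rw [hv n hn0, hn, nu_mul _ (alg_ne hm0) hx, h, (hv m hm0).mp hmv, add_zero]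

variable {O' L : Type} [CommRing O'] [IsDedekindDomain O'] [Field L] [Algebra O' L] 
    [IsFractionRing O' L] {P' : FFPrime L} [Algebra F L] {q : ℕ} {σ : L ≃ₐ[F] L} 

set_option maxHeartbeats 1000000 in
lemma act_ne {pr : HeightOneSpectrum O' → HeightOneSpectrum O}
    {act : HeightOneSpectrum O' → HeightOneSpectrum O'} (hq : q.Prime) (E : ExtP q σ pr act) {a : F} {α ξ : L}
    (hα : α ^ q = algebraMap F L a) (ha : a ≠ 0) (hξ : IsPrimitiveRoot ξ q) (hσα : σ α = ξ * α) (hσξ : σ ξ = ξ) 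
    (hu : ∃ u : O', algebraMap O' L u * (ξ - 1) = 1) (w : HeightOneSpectrum O') 
    (h1 : 0 < (ffp F (pr w)).ord (a - 1)) : act w ≠ w := by
  intro hw
  set W := ffp L w with hW
  have hext : ∀ x : F, W.ord (algebraMap F L x) = (ffp F (pr w)).ord x := by
    intro x
    by_cases hx : x = 0
    · rw [hx, map_zero, FFPrime.ord_zero, FFPrime.ord_zero]
    · rw [hW, ffp_ord _ (by simpa using hx), ffp_ord _ hx, E.nu_pr]
  have hsig : ∀ x : L, W.ord (σ x) = W.ord x := by
    intro x
    by_cases hx : x = 0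
    · rw [hx, map_zero]
    · rw [hW, ffp_ord _ (by simpa using hx), ffp_ord _ hx]
      have := E.nu_act w x
      rw [hw] at this
      rw [this]
  have hα0 : α ≠ 0 := by
    rintro rfl
    rw [zero_pow hq.ne_zero] at hα
    exact ha ((map_eq_zero _).mp hα.symm)
  have h2 : 0 < W.ord (α ^ q - 1) := by
    rw [hα, ← map_one (algebraMap F L), ← map_sub, hext]; exact h1
  have hαo : W.ord α = 0 := by
    have h3 : W.ord (α ^ q) = 0 := by
      have e : α ^ q = 1 + (α ^ q - 1) := by ring
      have h4 := W.o_add_eq (x := 1) (y := α ^ q - 1) one_ne_zero (by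
        rw [FFPrime.o_one]
        exact W.ord_pos_iff.mp h2)
      rw [← e, FFPrime.o_one] at h4
      rw [W.ord_eq h4.1, h4.2]; rfl
    rw [W.ord_eq hα0]
    have h4 : W.o (α ^ q) = 0 := W.o_of_ord h3
    rw [W.o_pow hα0] at h4
    rcases mul_eq_zero.mp h4 with h | h
    · exact absurd (by exact_mod_cast h) hq.ne_zero
    · rw [h]; rfl
  have h3 : ∃ ξ' ∈ Polynomial.nthRootsFinset q (1 : L), 0 < W.ord (α - ξ') := by
    by_contra hcon
    push Not at hcon
    have h4 := congrArg (Polynomial.eval α) (Polynomial.X_pow_sub_one_eq_prod hq.pos hξ)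
    rw [Polynomial.eval_prod] at h4
    simp only [Polynomial.eval_sub, Polynomial.eval_pow, Polynomial.eval_X, Polynomial.eval_one, Polynomial.eval_C] at h4
    rw [h4] at h2
    refine absurd h2 ?_
    refine Finset.prod_induction _ (fun x => ¬ 0 < W.ord x) ?_ ?_ ?_
    · intro x y hx hy
      rw [W.ord_mul]
      exact not_lt.mpr (add_nonpos (not_lt.mp hx) (not_lt.mp hy))
    · rw [W.ord_one]; exact lt_irrefl _
    · intro x hx; exact not_lt.mpr (hcon x hx)
  obtain ⟨ξ', hξ', h4⟩ := h3
  rw [Polynomial.mem_nthRootsFinset hq.pos] at hξ'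
  have : NeZero q := ⟨hq.ne_zero⟩
  obtain ⟨i, -, rfl⟩ := hξ.eq_pow_of_pow_eq_one hξ'
  have h5 := hsig (α - ξ ^ i)
  rw [map_sub, map_pow, hσα, hσξ] at h5
  rw [← h5] at h4
  have h6 : 0 < W.ord ((ξ * α - ξ ^ i) - (α - ξ ^ i)) := W.ord_sub_pos h4 (by rw [← h5]; exact h4)
  have e : (ξ * α - ξ ^ i) - (α - ξ ^ i) = (ξ - 1) * α := by ring
  rw [e, W.ord_mul, hαo, add_zero] at h6
  obtain ⟨u, hu⟩ := hu
  have hu0 : u ≠ 0 := by rintro rfl; simp at hu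
  have h7 : W.ord (algebraMap O' L u * (ξ - 1)) = 0 := by rw [hu, W.ord_one]
  rw [W.ord_mul] at h7
  have h8 : 0 ≤ W.ord (algebraMap O' L u) := by
    rw [hW, ffp_ord _ (alg_ne hu0)]
    exact WithTop.coe_nonneg.mpr (nu_alg_nonneg (F := L) w u)
  have h9 : 0 < W.ord (algebraMap O' L u) + W.ord (ξ - 1) := lt_of_lt_of_le h6 (le_add_of_nonneg_left h8)
  rw [h7] at h9
  exact lt_irrefl _ h9
end DV


set_option linter.unusedSectionVars false

namespace DV
open IsDedekindDomain PermD
variable {O F : Type} [CommRing O] [IsDedekindDomain O] [Field F] [Algebra O F] 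
    [IsFractionRing O F] {P : FFPrime F}
variable {O' L : Type} [CommRing O'] [IsDedekindDomain O'] [Field L] [Algebra O' L] 
    [IsFractionRing O' L] {P' : FFPrime L} [Algebra F L] {q : ℕ} {σ : L ≃ₐ[F] L} 
variable [Algebra O O'] [Algebra O L] [IsScalarTower O F L] [IsScalarTower O O' L] [IsIntegralClosure O' O L]
variable [FiniteDimensional F L] [IsGalois F L]

set_option maxHeartbeats 1000000 in
theorem kummer_abs (A : Arith O P) (A' : Arith O' P') (hq : q.Prime)
    (hσ : ∀ g : L ≃ₐ[F] L, g ∈ Subgroup.zpowers σ) (hcard : Nat.card (L ≃ₐ[F] L) = q)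
    (hnorm : ∀ y : L, y ≠ 0 → P.o (Algebra.norm F y) = q * P'.o y) 
    {a : F} {α ξ : L}
    (hα : α ^ q = algebraMap F L a) (ha : a ≠ 0) (hξ : IsPrimitiveRoot ξ q) (hσα : σ α = ξ * α) (hσξ : σ ξ = ξ) 
    (hu : ∃ u : O', algebraMap O' L u * (ξ - 1) = 1)
    (c : F) (hc : c ≠ 0) (hcP : (q : ℤ) ∣ P.o c)
    (hall : ∀ w : FFPrime F, w ≠ P → (q : ℤ) ∣ w.o a ∧ ((q : ℤ) ∣ w.o c ∨ 0 < w.ord (a - 1))) :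
    ∃ y : L, Algebra.norm F y = c := by
  classical
  have : Module.Finite O O' := IsIntegralClosure.finite O F L O'
  let _ := IsIntegralClosure.MulSemiringAction O F L O'
  have : IsGaloisGroup (L ≃ₐ[F] L) O O' := IsGaloisGroup.of_isFractionRing _ _ _ F L
  have hinj : Function.Injective (algebraMap O O') := by
    have h : Function.Injective (algebraMap O L) := by
      rw [IsScalarTower.algebraMap_eq O F L]
      exact (algebraMap F L).injective.comp (inj (O := O) (F := F))
    rw [IsScalarTower.algebraMap_eq O O' L] at h
    exact Function.Injective.of_comp h
  have hα0 : α ≠ 0 := by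
    rintro rfl
    rw [zero_pow hq.ne_zero] at hα
    exact ha ((map_eq_zero _).mp hα.symm)
  have hunr : ∀ w : HeightOneSpectrum O', ∃ β : O', σ • β - β ∉ w.asIdeal := by
    intro w
    let v := prP O hinj w
    obtain ⟨k, hk⟩ := (hall (ffp F v) (ffp_ne A v)).1
    rw [ffp_o _ ha] at hk
    obtain ⟨t, ht, ht1⟩ := (ffp F v).exists_unif
    have h0 : t ^ (-k) ≠ 0 := zpow_ne_zero _ ht
    have h1 : nu v (a * (t ^ (-k)) ^ q) = 0 := by
      rw [← ffp_o (F := F) v (mul_ne_zero ha (pow_ne_zero _ h0)), FFPrime.o_mul _ ha (pow_ne_zero _ h0), 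
        FFPrime.o_pow _ h0, FFPrime.o_zpow _ ht, ffp_o _ ha, hk]
      have : (ffp F v).o t = 1 := by exact ht1
      rw [this]; ring
    obtain ⟨m, n, hm, hn, hmn⟩ := exists_denom v _ (mul_ne_zero ha (pow_ne_zero _ h0)) h1
    let β : L := α * algebraMap F L (t ^ (-k) * algebraMap O F m)
    have hβq : β ^ q = algebraMap O L (n * m ^ (q - 1)) := by
      have e : m ^ q = m ^ (q-1) * m := by rw [← pow_succ, Nat.sub_add_cancel hq.one_le]
      rw [IsScalarTower.algebraMap_apply O F L, mul_pow, hα, ← map_pow, ← map_mul]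
      congr 1
      rw [map_mul, ← hmn, mul_pow, ← map_pow _ m q, e, map_mul]
      ring
    have hβi : IsIntegral O β := by
      refine IsIntegral.of_pow hq.pos ?_
      rw [hβq]; exact isIntegral_algebraMap
    let β' : O' := IsIntegralClosure.mk' O' β hβi
    have hβ' : algebraMap O' L β' = β := IsIntegralClosure.algebraMap_mk' O' β hβi
    refine ⟨β', ?_⟩
    have hβw : β' ∉ w.asIdeal := by
      intro h
      have h2 : β' ^ q ∈ w.asIdeal := Ideal.pow_mem_of_mem _ h _ hq.pos
      have h3 : β' ^ q = algebraMap O O' (n * m ^ (q - 1)) := by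
        apply IsFractionRing.injective O' L
        rw [map_pow, hβ', hβq, IsScalarTower.algebraMap_apply O O' L]
      rw [h3] at h2
      have h4 : n * m ^ (q-1) ∈ v.asIdeal := h2
      rcases v.isPrime.mem_or_mem h4 with h | h
      · exact hn h
      · exact hm (v.isPrime.mem_of_pow_mem _ h)
    obtain ⟨u, hu⟩ := hu
    intro h
    apply hβw
    have : β' = u * (σ • β' - β') := by
      apply IsFractionRing.injective O' L
      have e : algebraMap O' L (σ • β') = σ β := by
        exact (algebraMap_galRestrict_apply O σ β').trans (by rw [hβ'])
      rw [map_mul, map_sub, e, hβ']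
      have e2 : σ β = ξ * β := by
        simp only [β]
        rw [map_mul, hσα, AlgEquiv.commutes]; ring
      rw [e2]
      linear_combination (-β) * hu
    rw [this]
    exact Ideal.mul_mem_left _ _ h
  obtain ⟨pr, act, E⟩ := extP (O := O) (F := F) (O' := O') (L := L) q hq σ hσ hcard σ (fun x => rfl) 
    (fun v => A.finq _ v.ne_bot) (fun v => A'.finq _ v.ne_bot) hunr
  refine exists_norm A A' hq E hσ hcard hnorm c hc hcP (fun w => ?_)
  rcases (hall (ffp F (pr w)) (ffp_ne A _)).2 with h | h
  · left; rwa [ffp_o _ hc] at h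
  · right; exact act_ne hq E hα ha hξ hσα hσξ hu w h
end DV


set_option linter.unusedSectionVars false

namespace FFC
open Polynomial
variable {k F L : Type} [Field k] [Finite k] [Field F] [Field L] [Algebra F L]

section
variable [Algebra k[X] F] [Algebra (RatFunc k) F] [IsScalarTower k[X] (RatFunc k) F] [FiniteDimensional (RatFunc k) F]
variable [Algebra k[X] L] [Algebra (RatFunc k) L] [IsScalarTower k[X] (RatFunc k) L] [FiniteDimensional (RatFunc k) L]
variable [IsScalarTower k[X] F L] [FiniteDimensional F L] [IsGalois F L]

variable (k F L) in
def icMap : integralClosure k[X] F →+* integralClosure k[X] L :=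
  ((algebraMap F L).comp (algebraMap (integralClosure k[X] F) F)).codRestrict (integralClosure k[X] L).toSubring 
    (fun x => by
      change IsIntegral k[X] (algebraMap F L x)
      exact IsIntegral.algebraMap (B := L) x.2)

set_option maxHeartbeats 1000000 in
theorem kummer_conc {P : FFPrime F} {P' : FFPrime L} {q : ℕ} {σ : L ≃ₐ[F] L}
    (A : Arith (integralClosure k[X] F) P) (A' : Arith (integralClosure k[X] L) P') (hq : q.Prime)
    (hσ : ∀ g : L ≃ₐ[F] L, g ∈ Subgroup.zpowers σ) (hcard : Nat.card (L ≃ₐ[F] L) = q)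
    (hnorm : ∀ y : L, y ≠ 0 → P.o (Algebra.norm F y) = q * P'.o y) 
    {a : F} {α ξ : L}
    (hα : α ^ q = algebraMap F L a) (ha : a ≠ 0) (hξ : IsPrimitiveRoot ξ q) (hσα : σ α = ξ * α) (hσξ : σ ξ = ξ) 
    (c : F) (hc : c ≠ 0) (hcP : (q : ℤ) ∣ P.o c)
    (hall : ∀ w : FFPrime F, w ≠ P → (q : ℤ) ∣ w.o a ∧ ((q : ℤ) ∣ w.o c ∨ 0 < w.ord (a - 1))) :
    ∃ y : L, Algebra.norm F y = c := by
  have hu : ∃ u : integralClosure k[X] L, algebraMap (integralClosure k[X] L) L u * (ξ - 1) = 1 := by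
    let _ : Algebra k L := ((algebraMap k[X] L).comp C).toAlgebra
    have : IsScalarTower k k[X] L := IsScalarTower.of_algebraMap_eq (fun _ => rfl)
    have h1 : IsIntegral k ξ := by
      refine IsIntegral.of_pow hq.pos ?_
      rw [hξ.pow_eq_one]; exact isIntegral_one
    have h2 : IsIntegral k (ξ - 1)⁻¹ := (h1.sub isIntegral_one).inv
    have h3 : IsIntegral k[X] (ξ - 1)⁻¹ := h2.tower_top
    exact ⟨⟨_, h3⟩, inv_mul_cancel₀ (sub_ne_zero.mpr (hξ.ne_one hq.one_lt))⟩
  let _ : Algebra (integralClosure k[X] F) (integralClosure k[X] L) := (icMap k F L).toAlgebra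
  have : IsScalarTower (integralClosure k[X] F) (integralClosure k[X] L) L := 
    IsScalarTower.of_algebraMap_eq (fun _ => rfl)
  have : IsScalarTower k[X] (integralClosure k[X] F) (integralClosure k[X] L) := 
    IsScalarTower.of_algebraMap_eq (fun x => Subtype.ext (IsScalarTower.algebraMap_apply k[X] F L x))
  have : IsScalarTower k[X] (integralClosure k[X] F) L := 
    IsScalarTower.of_algebraMap_eq (fun x => (IsScalarTower.algebraMap_apply k[X] F L x))
  have : IsScalarTower (integralClosure k[X] F) F L := 
    IsScalarTower.of_algebraMap_eq (fun x => rfl)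
  have : IsIntegralClosure (integralClosure k[X] L) (integralClosure k[X] F) L := 
    IsIntegralClosure.tower_top (R := k[X])
  exact DV.kummer_abs A A' hq hσ hcard hnorm hα ha hξ hσα hσξ hu c hc hcP hall
end

set_option maxHeartbeats 1000000 in
theorem kummer_norm (ψ0 : RatFunc k →+* F) (hψ0 : ψ0.Finite) {q : ℕ} (hq : q.Prime) {ζ : F} (hζ : IsPrimitiveRoot ζ q)
    {P : FFPrime F} {a c : F} (ha : P.ord a = 0) (ha' : ¬ ∃ u, 0 < P.ord (a - u ^ q)) 
    (hc : c ≠ 0) (hcP : (q : ℤ) ∣ P.o c) {α : L}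
    (hα : α ^ q = algebraMap F L a) (htop : IntermediateField.adjoin F {α} = ⊤)
    (hall : ∀ w : FFPrime F, w ≠ P → (q : ℤ) ∣ w.o a ∧ ((q : ℤ) ∣ w.o c ∨ 0 < w.ord (a - 1))) :
    ∃ y : L, Algebra.norm F y = c := by
  have ha0 : a ≠ 0 := by rintro rfl; rw [FFPrime.ord_zero] at ha; exact absurd ha (by simp)
  have hα0 : α ≠ 0 := by
    rintro rfl
    rw [zero_pow hq.ne_zero] at hα
    exact ha0 ((map_eq_zero _).mp hα.symm)
  obtain ⟨P', hE, huniq, hfr, hnorm⟩ := FFPrime.exists_inert hq ha ha' hα htop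
  have : FiniteDimensional F L := Module.finite_of_finrank_pos (by rw [hfr]; exact hq.pos)
  have hK : (primitiveRoots (Module.finrank F L) F).Nonempty := by
    rw [hfr]; exact ⟨ζ, (mem_primitiveRoots hq.pos).mpr hζ⟩
  have h31 : (∃ α : L, α ^ (Module.finrank F L) ∈ Set.range (algebraMap F L) ∧ IntermediateField.adjoin F {α} = ⊤) → 
      IsGalois F L ∧ IsCyclic (L ≃ₐ[F] L) := ((isCyclic_tfae F L hK).out 2 0).mp
  obtain ⟨hG, hC⟩ := h31 ⟨α, ⟨a, by rw [hfr, hα]⟩, htop⟩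
  have hcard : Nat.card (L ≃ₐ[F] L) = q := by rw [IsGalois.card_aut_eq_finrank, hfr]
  obtain ⟨σ, hσ⟩ := hC.exists_generator
  set ξ : L := σ α / α with hξd
  have hσα : σ α = ξ * α := by rw [hξd, div_mul_cancel₀ _ hα0]
  have hξq : ξ ^ q = 1 := by
    rw [hξd, div_pow, ← map_pow, hα, AlgEquiv.commutes, div_self]
    rwa [Ne, map_eq_zero]
  have hξ1 : ξ ≠ 1 := by
    intro h
    rw [h, one_mul] at hσα
    have h1 : σ = 1 := by
      ext y
      have hy : y ∈ IntermediateField.adjoin F {α} := by rw [htop]; trivial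
      change σ y = y
      induction hy using IntermediateField.adjoin_induction with
      | mem x hx => rw [Set.mem_singleton_iff.mp hx, hσα]
      | algebraMap x => exact σ.commutes x
      | add x y _ _ hx hy => rw [map_add, hx, hy]
      | inv x _ hx => rw [map_inv₀, hx]
      | mul x y _ _ hx hy => rw [map_mul, hx, hy]
    have h2 : ∀ g : L ≃ₐ[F] L, g = 1 := by
      intro g
      have := hσ g
      rw [h1, Subgroup.zpowers_one_eq_bot] at this
      exact Subgroup.mem_bot.mp this
    have : Subsingleton (L ≃ₐ[F] L) := ⟨fun a b => by rw [h2 a, h2 b]⟩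
    have h3 := Nat.card_of_subsingleton (1 : L ≃ₐ[F] L)
    rw [hcard] at h3
    exact hq.ne_one h3
  have hξ : IsPrimitiveRoot ξ q := by
    have : Fact q.Prime := ⟨hq⟩
    have := IsPrimitiveRoot.orderOf ξ
    rwa [orderOf_eq_prime hξq hξ1] at this
  have : NeZero q := ⟨hq.ne_zero⟩
  have hσξ : σ ξ = ξ := by
    obtain ⟨i, -, h⟩ := (hζ.map_of_injective (algebraMap F L).injective).eq_pow_of_pow_eq_one hξq
    rw [← h, map_pow, AlgEquiv.commutes]
  obtain ⟨hres, ψ, hψ, hP⟩ := exists_t ψ0 hψ0 P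
  have hfinL : (algebraMap F L).Finite := RingHom.finite_algebraMap.mpr inferInstance
  obtain ⟨hres', -⟩ := exists_t ((algebraMap F L).comp ψ0) (hfinL.comp hψ0) P'
  let _ : Algebra (RatFunc k) F := ψ.toAlgebra
  let _ : Algebra k[X] F := (ψ.comp (algebraMap k[X] (RatFunc k))).toAlgebra
  have : IsScalarTower k[X] (RatFunc k) F := IsScalarTower.of_algebraMap_eq (fun _ => rfl)
  have : FiniteDimensional (RatFunc k) F := hψ
  let _ : Algebra (RatFunc k) L := ((algebraMap F L).comp ψ).toAlgebra
  let _ : Algebra k[X] L := (((algebraMap F L).comp ψ).comp (algebraMap k[X] (RatFunc k))).toAlgebra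
  have : IsScalarTower k[X] (RatFunc k) L := IsScalarTower.of_algebraMap_eq (fun _ => rfl)
  have : IsScalarTower k[X] F L := IsScalarTower.of_algebraMap_eq (fun _ => rfl)
  have : FiniteDimensional (RatFunc k) L := hfinL.comp hψ
  have e1 : algebraMap k[X] F X = ψ RatFunc.X := by
    change ψ (algebraMap k[X] (RatFunc k) X) = _
    rw [RatFunc.algebraMap_X]
  have e2 : algebraMap k[X] L X = algebraMap F L (ψ RatFunc.X) := by
    rw [IsScalarTower.algebraMap_apply k[X] F L, e1]
  have A : Arith (integralClosure k[X] F) P := arith P (fun V => by rw [e1]; exact hP V) hres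
  have A' : Arith (integralClosure k[X] L) P' := by
    refine arith P' (fun V => ?_) hres'
    rw [e2]
    constructor
    · intro h
      apply huniq
      have h1 : V.comap (algebraMap F L) = P.vring := (hP _).mp h
      intro x
      rw [← h1]; rfl
    · rintro rfl h
      rw [FFPrime.mem_vring, hE, ← FFPrime.mem_vring] at h
      exact (hP _).mpr rfl h
  exact kummer_conc A A' hq hσ hcard hnorm hα ha0 hξ hσα hσξ c hc hcP hall
end FFC


set_option linter.unusedSectionVars false

namespace FFPrime
variable {K M : Type} [Field K] [Field M]

lemma restrict (φ : K →+* M) (w : FFPrime M) {z : K} (hz : z ≠ 0) (hw : w.o (φ z) ≠ 0) :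
    ∃ (u : FFPrime K) (e : ℤ), 0 < e ∧ ∀ x, x ≠ 0 → w.o (φ x) = e * u.o x := by
  classical
  let H : AddSubgroup ℤ := 
    { carrier := {n | ∃ x : K, x ≠ 0 ∧ w.o (φ x) = n}
      zero_mem' := ⟨1, one_ne_zero, by rw [map_one, o_one]⟩
      add_mem' := by
        rintro _ _ ⟨x, hx, rfl⟩ ⟨y, hy, rfl⟩
        exact ⟨x * y, mul_ne_zero hx hy, by rw [map_mul, w.o_mul (by simpa using hx) (by simpa using hy)]⟩
      neg_mem' := by
        rintro _ ⟨x, hx, rfl⟩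
        exact ⟨x⁻¹, inv_ne_zero hx, by rw [map_inv₀, o_inv]⟩ }
  obtain ⟨a0, ha0⟩ := Int.subgroup_cyclic H
  have hmem0 : ∀ n, n ∈ H ↔ a0 ∣ n := by
    intro n
    rw [ha0, ← AddSubgroup.zmultiples_eq_closure, Int.mem_zmultiples_iff]
  obtain ⟨e, he, hmem⟩ : ∃ e : ℤ, 0 < e ∧ ∀ n, n ∈ H ↔ e ∣ n := by
    refine ⟨|a0|, ?_, fun n => by rw [hmem0, abs_dvd]⟩
    rw [abs_pos]
    rintro rfl
    exact hw (zero_dvd_iff.mp ((hmem0 _).mp ⟨z, hz, rfl⟩))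
  have hdvd : ∀ x, x ≠ 0 → e ∣ w.o (φ x) := fun x hx => (hmem _).mp ⟨x, hx, rfl⟩
  have hnz : ∀ x, x ≠ 0 → φ x ≠ 0 := fun x hx => by simpa using hx
  let u : FFPrime K := 
    { ord := fun x => if x = 0 then ⊤ else ((w.o (φ x) / e : ℤ) : WithTop ℤ)
      ord_zero := by simp
      ord_ne_top := fun x hx => by simp [hx]
      ord_one := by simp
      ord_mul := fun x y => by
        by_cases hx : x = 0
        · simp [hx]
        by_cases hy : y = 0
        · simp [hy]
        rw [if_neg (mul_ne_zero hx hy), if_neg hx, if_neg hy, map_mul, w.o_mul (hnz _ hx) (hnz _ hy), 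
          Int.add_ediv_of_dvd_left (hdvd _ hx), WithTop.coe_add]
      ord_add := fun x y => by
        by_cases hx : x = 0
        · simp [hx]
        by_cases hy : y = 0
        · simp [hy]
        by_cases hxy : x + y = 0
        · simp [hxy]
        rw [if_neg hxy, if_neg hx, if_neg hy, ← WithTop.coe_min, WithTop.coe_le_coe]
        have h := w.o_add (hnz _ hx) (hnz _ hy) (by rw [← map_add]; exact hnz _ hxy)
        rw [map_add]
        rw [min_le_iff] at h ⊢
        rcases h with h | h
        · left; exact Int.ediv_le_ediv he h
        · right; exact Int.ediv_le_ediv he h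
      ord_surj := fun n => by
        obtain ⟨x, hx, h⟩ := (hmem (e * n)).mpr ⟨n, rfl⟩
        refine ⟨x, ?_⟩
        rw [if_neg hx, h, Int.mul_ediv_cancel_left _ he.ne'] }
  refine ⟨u, e, he, fun x hx => ?_⟩
  have : u.o x = w.o (φ x) / e := o_of_ord _ (if_neg hx)
  rw [this, Int.mul_ediv_cancel' (hdvd _ hx)]

lemma o_eq_of_sub_one {w : FFPrime K} {a : K} (h : 0 < w.ord (a - 1)) : w.o a = 0 := by
  have h4 := w.o_add_eq (x := 1) (y := a - 1) one_ne_zero (by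
    rw [FFPrime.o_one]
    exact w.ord_pos_iff.mp h)
  rw [add_sub_cancel, o_one] at h4
  exact h4.2

lemma o_one_add {w : FFPrime K} {y : K} (hy : w.o y < 0) : 1 + y ≠ 0 ∧ w.o (1 + y) = w.o y := by
  have hy0 : y ≠ 0 := by
    rintro rfl
    have : w.o 0 = 0 := by simp [o, w.ord_zero]
    omega
  rw [add_comm]
  exact w.o_add_eq hy0 (Or.inr (by rwa [o_one]))

/-- the places where `b` is a unit -/
lemma local_case {w : FFPrime K} {q : ℕ} (hq : q ≠ 0) {A B X γ1 γ2 : K} (hA : A ≠ 0) (hB : B ≠ 0) (hX : X ≠ 0)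
    (hC : B * X ^ q + B ^ q ≠ 0) (h1 : γ1 ^ q = 1 + (B * X ^ q + B ^ q)⁻¹) (h2 : γ2 ^ q = 1 + (A + A⁻¹) * B⁻¹)
    (hw : w.o B = 0) : (q : ℤ) ∣ w.o A ∧ (q : ℤ) ∣ w.o (B * X ^ q + B ^ q) := by
  have hpow : ∀ γ : K, ∀ y, γ ^ q = 1 + y → w.o y < 0 → (q : ℤ) ∣ w.o y := by
    intro γ y h hy
    obtain ⟨h3, h4⟩ := o_one_add hy
    have hγ : γ ≠ 0 := by rintro rfl; rw [zero_pow hq] at h; exact h3 h.symm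
    rw [← h4, ← h, w.o_pow hγ]
    exact ⟨_, rfl⟩
  constructor
  · have key : ∀ D : K, D ≠ 0 → A + A⁻¹ = D + D⁻¹ → w.o D < 0 → (q : ℤ) ∣ w.o D := by
      intro D hD e hn
      obtain ⟨h3, h4⟩ := w.o_add_eq hD (y := D⁻¹) (Or.inr (by rw [o_inv]; omega))
      have h5 : w.o ((A + A⁻¹) * B⁻¹) = w.o D := by
        rw [e, w.o_mul h3 (inv_ne_zero hB), h4, o_inv, hw]; ring
      rw [← h5]
      exact hpow _ _ h2 (by rw [h5]; exact hn)
    rcases lt_trichotomy (w.o A) 0 with h | h | h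
    · exact key A hA rfl h
    · rw [h]; exact dvd_zero _
    · have := key A⁻¹ (inv_ne_zero hA) (by rw [inv_inv, add_comm]) (by rw [o_inv]; omega)
      rw [o_inv] at this
      exact (dvd_neg).mp this
  · set C := B * X ^ q + B ^ q with hCd
    rcases lt_trichotomy (w.o C) 0 with h | h | h
    · have h3 := w.o_add_eq hC (y := - B ^ q) (Or.inr (by rw [o_neg, w.o_pow hB, hw, mul_zero]; exact h))
      have e : C + - B ^ q = B * X ^ q := by rw [hCd]; ring
      rw [e, w.o_mul hB (pow_ne_zero _ hX), hw, w.o_pow hX, zero_add] at h3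
      rw [← h3.2]; exact ⟨_, rfl⟩
    · rw [h]; exact dvd_zero _
    · have := hpow _ _ h1 (by rw [o_inv]; omega)
      rw [o_inv] at this
      exact (dvd_neg).mp this

end FFPrime

lemma exists_simple (F : Type) [Field F] (d : F) (q : ℕ) (hq : q ≠ 0) : ∃ (M : Type) (_ : Field M) (_ : Algebra F M) (α : M), 
    α ^ q = algebraMap F M d ∧ IntermediateField.adjoin F {α} = ⊤ := by
  obtain ⟨β, hβ⟩ := IsAlgClosed.exists_pow_nat_eq (algebraMap F (AlgebraicClosure F) d) (Nat.pos_of_ne_zero hq)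
  refine ⟨IntermediateField.adjoin F {β}, inferInstance, inferInstance, IntermediateField.AdjoinSimple.gen F β, ?_, ?_⟩
  · apply Subtype.ext
    exact hβ
  · apply IntermediateField.lift_injective
    rw [IntermediateField.lift_adjoin_simple, IntermediateField.lift_top]
    rfl


set_option linter.unusedSectionVars false

namespace FFPrime
variable {K M1 M2 : Type} [Field K] [Field M1] [Field M2] [Algebra K M1] [Algebra M1 M2] {v : FFPrime K}

lemma exists_tower {q : ℕ} (hq : q.Prime) (hqv : v.ord (q : K) = 0) {ζ : K} (hζ : IsPrimitiveRoot ζ q)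
    {d1 d2 : K} (hd1 : 0 < v.ord (d1 - 1)) (hd2 : 0 < v.ord (d2 - 1)) {α1 : M1} {α2 : M2}
    (hα1 : α1 ^ q = algebraMap K M1 d1) (htop1 : IntermediateField.adjoin K {α1} = ⊤)
    (hα2 : α2 ^ q = algebraMap M1 M2 (algebraMap K M1 d2)) (htop2 : IntermediateField.adjoin M1 {α2} = ⊤) 
    {a : K} (h2 : v.ord a = 0) (h2' : ¬ ∃ u : K, 0 < v.ord (a - u ^ q)) :
    ∃ P : FFPrime M2, (∀ x : K, P.ord (algebraMap M1 M2 (algebraMap K M1 x)) = v.ord x) ∧ 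
      ¬ ∃ u : M2, 0 < P.ord (algebraMap M1 M2 (algebraMap K M1 a) - u ^ q) := by
  obtain ⟨P1, hE1, hR1⟩ := exists_split hq.pos hqv hζ hd1 hα1 htop1
  obtain ⟨P, hE2, hR2⟩ := exists_split (v := P1) (d := algebraMap K M1 d2) hq.pos 
    (by rw [← map_natCast (algebraMap K M1), hE1, hqv]) (hζ.map_of_injective (algebraMap K M1).injective)
    (by rw [← map_one (algebraMap K M1), ← map_sub, hE1]; exact hd2) hα2 htop2
  have hE : ∀ x : K, P.ord (algebraMap M1 M2 (algebraMap K M1 x)) = v.ord x := fun x => by rw [hE2, hE1]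
  refine ⟨P, hE, ?_⟩
  rintro ⟨u, hu⟩
  apply h2'
  have huq : 0 ≤ P.ord (u ^ q) := by
    have e : u ^ q = algebraMap M1 M2 (algebraMap K M1 a) - (algebraMap M1 M2 (algebraMap K M1 a) - u ^ q) := by ring
    rw [e]
    exact P.ord_sub_nonneg (by rw [hE, h2]) hu.le
  have hu0 : u ∈ P.vring := mem_of_pow_mem _ hq.ne_zero huq
  obtain ⟨y, hy⟩ := hR2 u hu0
  have hy0 : 0 ≤ P1.ord y := by
    have e : algebraMap M1 M2 y = u - (u - algebraMap M1 M2 y) := by ring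
    rw [← hE2, e]
    exact P.ord_sub_nonneg hu0 hy.le
  obtain ⟨x, hx⟩ := hR1 y hy0
  refine ⟨x, ?_⟩
  set X := algebraMap M1 M2 (algebraMap K M1 x) with hX
  have h3 : 0 < P.ord (u - X) := by
    rw [← hE2, map_sub] at hx
    have := P.ord_add_pos hy hx
    rwa [sub_add_sub_cancel] at this
  have hX0 : X ∈ P.vring := by
    have e : X = u - (u - X) := by ring
    rw [e]; exact P.ord_sub_nonneg hu0 h3.le
  obtain ⟨t, ht⟩ := sub_dvd_pow_sub_pow (⟨u, hu0⟩ : P.vring) ⟨X, hX0⟩ q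
  have ht' : u ^ q - X ^ q = (u - X) * t := congrArg Subtype.val ht
  have h4 : 0 < P.ord (u ^ q - X ^ q) := by
    rw [ht', P.ord_mul]
    exact lt_of_lt_of_le h3 (le_add_of_nonneg_right t.2)
  have h5 := P.ord_add_pos hu h4
  rw [sub_add_sub_cancel] at h5
  rw [← hE, map_sub, map_sub, map_pow, map_pow]
  exact h5

lemma final {p q : ℕ} [Fact p.Prime] (hq : q.Prime) (hqp : q ≠ p)
    [Algebra (RatFunc (ZMod p)) K] [FiniteDimensional (RatFunc (ZMod p)) K]
    (ζ : K) (hζ : IsPrimitiveRoot ζ q)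
    (a b x : K) (ha : a ≠ 0) (hb : b ≠ 0) (hx : x ≠ 0)
    (h1 : v.ord b < 0) (h1' : ¬ v.OrdDvd q b)
    (h2 : v.ord a = 0) (h2' : ¬ ∃ u : K, 0 < v.ord (a - u ^ q))
    (h3 : ∀ w : FFPrime K, w ≠ v → w.ord b ≠ 0 → 0 < w.ord (a - 1)) :
    NormTower2Solvable q K a b x ↔
      (((q : ℤ) - 1 : ℤ) : WithTop ℤ) * v.ord b < ((q : ℤ) : WithTop ℤ) * v.ord x := by
  have hob : v.o b < 0 := by rw [v.ord_eq hb] at h1; exact_mod_cast h1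
  have hndvd : ¬ (q : ℤ) ∣ v.o b := by
    rintro ⟨n, hn⟩
    exact h1' ⟨n, by rw [v.ord_eq hb, hn]⟩
  have hoa : v.o a = 0 := v.o_of_ord h2
  have hq1 : (1 : ℤ) < q := by exact_mod_cast hq.one_lt
  have hqv : v.ord (q : K) = 0 := by
    have h0 : ((q : ZMod p)) ≠ 0 := by
      rw [Ne, ZMod.natCast_eq_zero_iff]
      exact fun h => hqp ((Nat.prime_dvd_prime_iff_eq Fact.out hq).mp h).symm
    have h4 := congrArg ((algebraMap (RatFunc (ZMod p)) K).comp (algebraMap (ZMod p) (RatFunc (ZMod p)))) 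
      (ZMod.pow_card_sub_one_eq_one h0)
    rw [map_pow, map_natCast, map_one] at h4
    exact ord_of_root (Nat.sub_ne_zero_of_lt (Fact.out : p.Prime).one_lt) h4
  have hRHS : (((q : ℤ) - 1 : ℤ) : WithTop ℤ) * v.ord b < ((q : ℤ) : WithTop ℤ) * v.ord x ↔ 
      ((q : ℤ) - 1) * v.o b < q * v.o x := by
    rw [v.ord_eq hb, v.ord_eq hx, ← WithTop.coe_mul, ← WithTop.coe_mul, WithTop.coe_lt_coe]
  rw [hRHS]
  have hbx : b * x ^ q ≠ 0 := mul_ne_zero hb (pow_ne_zero _ hx)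
  have ho1 : v.o (b * x ^ q) = v.o b + q * v.o x := by rw [v.o_mul hb (pow_ne_zero _ hx), v.o_pow hx]
  have ho2 : v.o (b ^ q) = q * v.o b := v.o_pow hb q
  have hd2 : 0 < v.ord (1 + (a + a⁻¹) * b⁻¹ - 1) := by
    rw [add_sub_cancel_left, v.ord_mul]
    have h4 : 0 ≤ v.ord (a + a⁻¹) := by
      refine le_trans (le_min h2.ge ?_) (v.ord_add _ _)
      rw [v.ord_eq (inv_ne_zero ha), o_inv, hoa]; simp
    have h5 : 0 < v.ord b⁻¹ := by
      rw [ord_pos_iff, o_inv]; right; omega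
    exact lt_of_lt_of_le h5 (le_add_of_nonneg_left h4)
  have hd1 : ∀ c : K, v.o c < 0 → 0 < v.ord (1 + c⁻¹ - 1) := by
    intro c hc
    rw [add_sub_cancel_left, ord_pos_iff, o_inv]; right; omega
  by_cases hlt : ((q : ℤ) - 1) * v.o b < q * v.o x
  · refine ⟨fun _ => hlt, fun _ => ?_⟩
    obtain ⟨hc0, hoc⟩ := v.o_add_eq (pow_ne_zero q hb) (y := b * x ^ q) (Or.inr (by rw [ho1, ho2]; linarith))
    rw [add_comm] at hc0 hoc
    rw [ho2] at hoc
    intro M1 _ _ α1 hα1 htop1 M2 _ _ α2 hα2 htop2 M3 _ _ α3 hα3 htop3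
    obtain ⟨P, hE, hP⟩ := exists_tower hq hqv hζ (hd1 _ (by rw [hoc]; nlinarith)) hd2 hα1 htop1 hα2 htop2 h2 h2'
    let φ : K →+* M2 := (algebraMap M1 M2).comp (algebraMap K M1)
    have hφ0 : ∀ z, z ≠ 0 → φ z ≠ 0 := fun z hz => by simpa using hz
    have hfin1 : (algebraMap K M1).Finite := by
      rw [RingHom.finite_algebraMap]
      have : FiniteDimensional K (IntermediateField.adjoin K {α1}) := 
        IntermediateField.adjoin.finiteDimensional (IsIntegral.of_pow hq.pos (by rw [hα1]; exact isIntegral_algebraMap))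
      rw [htop1] at this
      exact Module.Finite.equiv (IntermediateField.topEquiv (F := K) (E := M1)).toLinearEquiv
    have hfin2 : (algebraMap M1 M2).Finite := by
      rw [RingHom.finite_algebraMap]
      have : FiniteDimensional M1 (IntermediateField.adjoin M1 {α2}) := 
        IntermediateField.adjoin.finiteDimensional (IsIntegral.of_pow hq.pos (by rw [hα2]; exact isIntegral_algebraMap))
      rw [htop2] at this
      exact Module.Finite.equiv (IntermediateField.topEquiv (F := M1) (E := M2)).toLinearEquiv
    have hfin0 : (algebraMap (RatFunc (ZMod p)) K).Finite := RingHom.finite_algebraMap.mpr inferInstance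
    have hφfin : (φ.comp (algebraMap (RatFunc (ZMod p)) K)).Finite := (hfin2.comp hfin1).comp hfin0
    have hζ' : IsPrimitiveRoot (φ ζ) q := hζ.map_of_injective φ.injective
    refine FFC.kummer_norm _ hφfin hq hζ' (P := P) (a := φ a) (c := φ (b * x ^ q + b ^ q)) 
      ((hE a).trans h2) hP (hφ0 _ hc0) ?_ hα3 htop3 ?_
    · have : P.o (φ (b * x ^ q + b ^ q)) = q * v.o b := by
        rw [← hoc]; unfold o; rw [← hE]; rfl
      rw [this]; exact ⟨_, rfl⟩
    intro w _
    by_cases hwb : w.o (φ b) = 0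
    · have := local_case (w := w) (q := q) hq.ne_zero (A := φ a) (B := φ b) (X := φ x) (γ1 := algebraMap M1 M2 α1) 
        (γ2 := α2) (hφ0 _ ha) (hφ0 _ hb) (hφ0 _ hx) (by rw [← map_pow, ← map_pow, ← map_mul, ← map_add]; exact hφ0 _ hc0)
        (by
          rw [← map_pow, hα1]
          change φ _ = _
          simp only [map_add, map_one, map_inv₀, map_mul, map_pow]) 
        (by
          rw [hα2]
          change φ _ = _
          simp only [map_add, map_one, map_inv₀, map_mul]) hwb
      refine ⟨this.1, Or.inl ?_⟩
      rw [map_add, map_mul, map_pow, map_pow]; exact this.2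
    · obtain ⟨u, e, he, hu⟩ := restrict φ w hb hwb
      by_cases huv : u = v
      · subst huv
        refine ⟨?_, Or.inl ?_⟩
        · rw [hu _ ha, hoa, mul_zero]; exact dvd_zero _
        · rw [hu _ hc0, hoc]; exact ⟨e * u.o b, by ring⟩
      · have hub : u.ord b ≠ 0 := by
          intro h
          apply hwb
          rw [hu _ hb, u.o_of_ord (n := 0) h, mul_zero]
        have h4 := h3 u huv hub
        have h5 : 0 < w.ord (φ a - 1) := by
          rw [ord_pos_iff] at h4 ⊢
          by_cases h0 : a - 1 = 0
          · left; rw [← map_one φ, ← map_sub, h0, map_zero]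
          · right
            rw [← map_one φ, ← map_sub, hu _ h0]
            exact mul_pos he (h4.resolve_left h0)
        refine ⟨?_, Or.inr h5⟩
        rw [o_eq_of_sub_one h5]; exact dvd_zero _
  · refine ⟨fun hN => ?_, fun h => absurd h hlt⟩
    exfalso
    have hlt' : v.o (b * x ^ q) < v.o (b ^ q) := by
      rw [ho1, ho2]
      push Not at hlt
      rcases hlt.lt_or_eq with h | h
      · linarith
      · exact absurd ⟨v.o b - v.o x, by linarith⟩ hndvd
    obtain ⟨hc0, hoc⟩ := v.o_add_eq hbx (y := b ^ q) (Or.inr hlt')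
    have hneg : v.o (b * x ^ q + b ^ q) < 0 := by
      rw [hoc]; refine hlt'.trans ?_; rw [ho2]; nlinarith
    obtain ⟨M1, _, _, α1, hα1, htop1⟩ := exists_simple K (1 + (b * x ^ q + b ^ q)⁻¹) q hq.ne_zero
    obtain ⟨M2, _, _, α2, hα2, htop2⟩ := exists_simple M1 (algebraMap K M1 (1 + (a + a⁻¹) * b⁻¹)) q hq.ne_zero
    obtain ⟨M3, _, _, α3, hα3, htop3⟩ := exists_simple M2 (algebraMap M1 M2 (algebraMap K M1 a)) q hq.ne_zero
    obtain ⟨P, hE, hP⟩ := exists_tower hq hqv hζ (hd1 _ hneg) hd2 hα1 htop1 hα2 htop2 h2 h2'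
    obtain ⟨y, hy⟩ := hN M1 α1 hα1 htop1 M2 α2 hα2 htop2 M3 α3 hα3 htop3
    obtain ⟨P', -, -, hfr, hnorm⟩ := exists_inert hq ((hE a).trans h2) hP hα3 htop3
    have : FiniteDimensional M2 M3 := Module.finite_of_finrank_pos (by rw [hfr]; exact hq.pos)
    have hy0 : y ≠ 0 := by
      rintro rfl
      rw [Algebra.norm_zero] at hy
      exact hc0 ((map_eq_zero _).mp ((map_eq_zero _).mp hy.symm))
    have h4 := hnorm y hy0
    have h5 : P.o (Algebra.norm M2 y) = v.o b + q * v.o x := by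
      rw [← ho1, ← hoc, hy]; unfold o; rw [hE]
    rw [h5] at h4
    exact hndvd ⟨P'.o y - v.o x, by linarith⟩

end FFPrime


/-- With `a, b` as in the proposition (`ord_𝔭 b < 0` and
`ord_𝔭 b ≢ 0 mod q`; `a` a unit at `𝔭` whose residue is not a `q`-th power; `a ≡ 1`
at all other primes of the divisor of `b`), the norm equation
`N_{L₂(a^{1/q})/L₂}(y) = b x^q + b^q` is solvable if and only if
`ord_𝔭 x > ((q-1)/q)·ord_𝔭 b`. -/
theorem statement7 (p q : ℕ) [Fact p.Prime] (hq : q.Prime) (hqp : q ≠ p)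
    (K : Type) [Field K] [Algebra (RatFunc (ZMod p)) K]
    [FiniteDimensional (RatFunc (ZMod p)) K]
    (ζ : K) (hζ : IsPrimitiveRoot ζ q)
    (a b x : K) (ha : a ≠ 0) (hb : b ≠ 0) (hx : x ≠ 0)
    (v : FFPrime K)
    (h1 : v.ord b < 0) (h1' : ¬ v.OrdDvd q b)
    (h2 : v.ord a = 0) (h2' : ¬ ∃ u : K, 0 < v.ord (a - u ^ q))
    (h3 : ∀ w : FFPrime K, w ≠ v → w.ord b ≠ 0 → 0 < w.ord (a - 1)) :
    NormTower2Solvable q K a b x ↔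
      (((q : ℤ) - 1 : ℤ) : WithTop ℤ) * v.ord b < ((q : ℤ) : WithTop ℤ) * v.ord x := by
  exact FFPrime.final (v := v) hq hqp ζ hζ a b x ha hb hx h1 h1' h2 h2' h3
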